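/- Let B = B(0,1) ⊂ ℝ^d, let A₀ be a constant symmetric real d×d matrix satisfying λ|ξ|² ≤ A₀ξ·ξ for all ξ ∈ ℝ^d and |A₀| ≤ Λ for some λ, Λ > 0, and let f : ℝ^d → ℝ be smooth. Suppose u is continuous on the closed ball B̄, twice continuously differentiable on B, u = 0 on ∂B, and tr(A₀ D²u(x)) = f(x) for every x ∈ B. Then for every α > 0, the Lebesgue measure of {x ∈ B : |D²u(x)| > α} is at most (C/α) ∫_B |f| dx, where C depends only on d, λ, Λ. -/

import Mathlib

open MeasureTheory Metric Matrix Set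

/-- The Hessian matrix `D²u` of a real-valued function. -/
noncomputable def hess {d : ℕ} (u : EuclideanSpace ℝ (Fin d) → ℝ)
    (x : EuclideanSpace ℝ (Fin d)) : Fin d → Fin d → ℝ :=
  fun i j => iteratedFDeriv ℝ 2 u x ![EuclideanSpace.single i 1, EuclideanSpace.single j 1]

namespace WeakHessian

open Filter Topology
open scoped ContDiff

/-- The `d`-dimensional Euclidean space. -/
abbrev Euc (d : ℕ) : Type := EuclideanSpace ℝ (Fin d)

/-- The partial derivative in the `i`-th coordinate direction. -/
noncomputable def pd {d : ℕ} (i : Fin d) (f : Euc d → ℝ) : Euc d → ℝ :=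
  fun x => fderiv ℝ f x (EuclideanSpace.single i 1)

/-- The operator `∑ aᵢ ∂ᵢ∂ᵢ`. -/
noncomputable def diagOp {d : ℕ} (a : Fin d → ℝ) (u : Euc d → ℝ) (x : Euc d) : ℝ :=
  ∑ i, a i * pd i (pd i u) x

/-- The defining function `1 - |x|²` of the unit ball. -/
noncomputable def rho {d : ℕ} (x : Euc d) : ℝ := 1 - ‖x‖ ^ 2

variable {d : ℕ}

section Calculus

theorem contDiff_pd (i : Fin d) {f : Euc d → ℝ} (hf : ContDiff ℝ ∞ f) :
    ContDiff ℝ ∞ (pd i f) :=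
  (hf.fderiv_right (m := ∞) (by simp)).clm_apply contDiff_const

theorem contDiffAt_pd (i : Fin d) {f : Euc d → ℝ} {x : Euc d} {n : WithTop ℕ∞}
    (hf : ContDiffAt ℝ (n + 1) f x) : ContDiffAt ℝ n (pd i f) x :=
  (hf.fderiv_right (m := n) le_rfl).clm_apply contDiffAt_const

theorem pd_congr {f g : Euc d → ℝ} {x : Euc d} (i : Fin d) (h : f =ᶠ[𝓝 x] g) :
    pd i f x = pd i g x := by
  simp only [pd, h.fderiv_eq]

theorem pd_const (i : Fin d) (c : ℝ) : pd i (fun _ : Euc d => c) = fun _ => 0 := by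
  ext x; simp [pd]

theorem pd_add_apply (i : Fin d) {f g : Euc d → ℝ} {x : Euc d} (hf : DifferentiableAt ℝ f x)
    (hg : DifferentiableAt ℝ g x) : pd i (fun y => f y + g y) x = pd i f x + pd i g x := by
  simp only [pd]; rw [fderiv_fun_add hf hg]; rfl

theorem pd_sub_apply (i : Fin d) {f g : Euc d → ℝ} {x : Euc d} (hf : DifferentiableAt ℝ f x)
    (hg : DifferentiableAt ℝ g x) : pd i (fun y => f y - g y) x = pd i f x - pd i g x := by
  simp only [pd]; rw [fderiv_fun_sub hf hg]; rfl

theorem pd_const_mul_apply (i : Fin d) (c : ℝ) {f : Euc d → ℝ} {x : Euc d}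
    (hf : DifferentiableAt ℝ f x) : pd i (fun y => c * f y) x = c * pd i f x := by
  simp only [pd]; rw [fderiv_const_mul hf]; rfl

theorem pd_mul_apply (i : Fin d) {f g : Euc d → ℝ} {x : Euc d} (hf : DifferentiableAt ℝ f x)
    (hg : DifferentiableAt ℝ g x) :
    pd i (fun y => f y * g y) x = pd i f x * g x + f x * pd i g x := by
  simp only [pd]; rw [fderiv_fun_mul hf hg]; simp; ring

theorem smooth_differentiable {f : Euc d → ℝ} (hf : ContDiff ℝ ∞ f) : Differentiable ℝ f :=
  hf.differentiable (by simp)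

theorem pd_add (i : Fin d) {f g : Euc d → ℝ} (hf : ContDiff ℝ ∞ f) (hg : ContDiff ℝ ∞ g) :
    pd i (fun y => f y + g y) = fun y => pd i f y + pd i g y :=
  funext fun x => pd_add_apply i (smooth_differentiable hf x) (smooth_differentiable hg x)

theorem pd_sub (i : Fin d) {f g : Euc d → ℝ} (hf : ContDiff ℝ ∞ f) (hg : ContDiff ℝ ∞ g) :
    pd i (fun y => f y - g y) = fun y => pd i f y - pd i g y :=
  funext fun x => pd_sub_apply i (smooth_differentiable hf x) (smooth_differentiable hg x)

theorem pd_mul (i : Fin d) {f g : Euc d → ℝ} (hf : ContDiff ℝ ∞ f) (hg : ContDiff ℝ ∞ g) :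
    pd i (fun y => f y * g y) = fun y => pd i f y * g y + f y * pd i g y :=
  funext fun x => pd_mul_apply i (smooth_differentiable hf x) (smooth_differentiable hg x)

theorem pd_const_mul (i : Fin d) (c : ℝ) {f : Euc d → ℝ} (hf : ContDiff ℝ ∞ f) :
    pd i (fun y => c * f y) = fun y => c * pd i f y :=
  funext fun x => pd_const_mul_apply i c (smooth_differentiable hf x)

theorem pd_sum {ι : Type*} (s : Finset ι) (i : Fin d) {f : ι → Euc d → ℝ}
    (hf : ∀ k ∈ s, ContDiff ℝ ∞ (f k)) :
    pd i (fun y => ∑ k ∈ s, f k y) = fun y => ∑ k ∈ s, pd i (f k) y := by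
  ext x
  simp only [pd]
  rw [fderiv_fun_sum fun k hk => smooth_differentiable (hf k hk) x]
  simp

theorem pd_comm_apply (i j : Fin d) {f : Euc d → ℝ} {x : Euc d} (hf : ContDiffAt ℝ 2 f x) :
    pd i (pd j f) x = pd j (pd i f) x := by
  have hd : DifferentiableAt ℝ (fderiv ℝ f) x :=
    (hf.fderiv_right (m := 1) (by norm_num)).differentiableAt (by simp)
  have key : ∀ v w : Euc d, fderiv ℝ (fun y => fderiv ℝ f y v) x w
      = fderiv ℝ (fderiv ℝ f) x w v := by
    intro v w
    rw [fderiv_clm_apply hd (by fun_prop)]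
    simp
  unfold pd
  rw [key, key]
  exact (hf.isSymmSndFDerivAt (by simp)).eq _ _

theorem pd_comm (i j : Fin d) {f : Euc d → ℝ} (hf : ContDiff ℝ ∞ f) :
    pd i (pd j f) = pd j (pd i f) :=
  funext fun _ => pd_comm_apply i j (contDiff_infty.1 hf 2).contDiffAt

theorem hess_eq_pd {u : Euc d → ℝ} {x : Euc d} (hu : ContDiffAt ℝ 2 u x) (i j : Fin d) :
    hess u x i j = pd i (pd j u) x := by
  have hd : DifferentiableAt ℝ (fderiv ℝ u) x :=
    (hu.fderiv_right (m := 1) (by norm_num)).differentiableAt (by simp)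
  have hj : pd i (pd j u) x = fderiv ℝ (fun y => fderiv ℝ u y (EuclideanSpace.single j 1)) x
      (EuclideanSpace.single i 1) := rfl
  rw [hj, fderiv_clm_apply hd (by fun_prop)]
  simp [hess, iteratedFDeriv_two_apply]

theorem contDiff_coord (i : Fin d) : ContDiff ℝ ∞ (fun x : Euc d => x i) :=
  contDiff_piLp_apply (p := 2)

theorem pd_coord (i j : Fin d) :
    pd i (fun x : Euc d => x j) = fun _ => if i = j then 1 else 0 := by
  ext x
  have : (fun x : Euc d => x j) = (EuclideanSpace.proj j : Euc d →L[ℝ] ℝ) := rfl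
  simp only [pd, this, ContinuousLinearMap.fderiv]
  simp [eq_comm]

theorem contDiff_rho : ContDiff ℝ ∞ (rho : Euc d → ℝ) :=
  contDiff_const.sub (contDiff_norm_sq ℝ)

theorem rho_eq (x : Euc d) : rho x = 1 - ∑ i, x i * x i := by
  rw [rho, EuclideanSpace.norm_sq_eq]
  simp [sq]

theorem pd_rho (i : Fin d) : pd i (rho : Euc d → ℝ) = fun x => -2 * x i := by
  have : (rho : Euc d → ℝ) = fun x => 1 - ∑ i, x i * x i := funext rho_eq
  have hs : ∀ k, ContDiff ℝ ∞ (fun x : Euc d => x k * x k) := fun k =>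
    (contDiff_coord k).mul (contDiff_coord k)
  rw [this, pd_sub i contDiff_const (ContDiff.sum fun k _ => hs k), pd_sum _ _ fun k _ => hs k]
  ext x
  simp only [pd_const, pd_mul i (contDiff_coord _) (contDiff_coord _), pd_coord]
  rw [Finset.sum_eq_single i] <;> simp +contextual [eq_comm]
  ring

theorem rho_pos_iff {x : Euc d} : 0 < rho x ↔ x ∈ ball (0 : Euc d) 1 := by
  simp [rho]

theorem rho_eq_zero_of_mem_sphere {x : Euc d} (hx : x ∈ sphere (0 : Euc d) 1) : rho x = 0 := by
  simp [rho, mem_sphere_zero_iff_norm.1 hx]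

theorem continuous_pd (i : Fin d) {f : Euc d → ℝ} (hf : ContDiff ℝ 1 f) :
    Continuous (pd i f) :=
  (hf.continuous_fderiv (by simp)).clm_apply continuous_const

theorem continuous_mul_of_tsupport {f g : Euc d → ℝ} (hf : Continuous f)
    (hg : ∀ x ∈ tsupport f, ContinuousAt g x) : Continuous fun x => f x * g x := by
  rw [continuous_iff_continuousAt]
  intro x
  by_cases hx : x ∈ tsupport f
  · exact hf.continuousAt.mul (hg x hx)
  · have : (fun y => f y * g y) =ᶠ[𝓝 x] fun _ => 0 := by
      filter_upwards [notMem_tsupport_iff_eventuallyEq.1 hx] with y hy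
      simp [hy]
    exact this.continuousAt

/-- Integration by parts against a compactly supported function. -/
theorem integral_mul_pd (i : Fin d) {f g : Euc d → ℝ} (hf : ContDiff ℝ 1 f)
    (hc : HasCompactSupport f) (hg : ∀ x ∈ tsupport f, ContDiffAt ℝ 1 g x) :
    ∫ x, f x * pd i g x = -∫ x, pd i f x * g x := by
  have hc' : HasCompactSupport (pd i f) := hc.fderiv_apply ℝ _
  refine integral_mul_fderiv_eq_neg_fderiv_mul_of_integrable (𝕜 := ℝ) ?_ ?_ ?_
    (fun x _ => hf.differentiable (by simp) x)
    (fun x hx => (hg x hx).differentiableAt (by simp))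
  · exact (continuous_mul_of_tsupport (continuous_pd i hf) fun x hx =>
      (hg x (tsupport_fderiv_apply_subset ℝ _ hx)).continuousAt).integrable_of_hasCompactSupport
      hc'.mul_right
  · exact (continuous_mul_of_tsupport hf.continuous fun x hx =>
      (contDiffAt_pd i (n := 0) (by simpa using hg x hx)).continuousAt
      ).integrable_of_hasCompactSupport hc.mul_right
  · exact (continuous_mul_of_tsupport hf.continuous fun x hx =>
      (hg x hx).continuousAt).integrable_of_hasCompactSupport hc.mul_right

end Calculus

section Divergence

theorem smoothTransition_deriv_nonneg (t : ℝ) : 0 ≤ deriv Real.smoothTransition t :=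
  Real.smoothTransition.monotone.deriv_nonneg

theorem smoothTransition_deriv_eq_zero {t : ℝ} (ht : t ≤ 0 ∨ 1 ≤ t) :
    deriv Real.smoothTransition t = 0 := by
  rcases ht with ht | ht
  · refine IsLocalMin.deriv_eq_zero (Eventually.of_forall fun s => ?_)
    rw [Real.smoothTransition.zero_of_nonpos ht]; exact Real.smoothTransition.nonneg s
  · refine IsLocalMax.deriv_eq_zero (Eventually.of_forall fun s => ?_)
    rw [Real.smoothTransition.one_of_one_le ht]; exact Real.smoothTransition.le_one s

theorem continuous_deriv_smoothTransition : Continuous (deriv Real.smoothTransition) :=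
  (Real.smoothTransition.contDiff (n := 1)).continuous_deriv (by simp)

theorem exists_bound_mul_deriv_smoothTransition :
    ∃ M : ℝ, ∀ t : ℝ, ‖t * deriv Real.smoothTransition t‖ ≤ M := by
  obtain ⟨M, hM⟩ := (isCompact_Icc (a := (0 : ℝ)) (b := 1)).exists_bound_of_continuousOn
    (continuous_id.mul continuous_deriv_smoothTransition).continuousOn
  refine ⟨M, fun t => ?_⟩
  by_cases ht : t ∈ Icc (0 : ℝ) 1
  · exact hM t ht
  · rw [smoothTransition_deriv_eq_zero, mul_zero, norm_zero]
    · exact (norm_nonneg _).trans (hM 0 (by simp))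
    · by_contra h; push Not at h; exact ht ⟨h.1.le, h.2.le⟩

/-- The smooth cutoff `S(n(1-|x|²))` of the unit ball. -/
noncomputable def ballCutoff (d : ℕ) (n : ℕ) (x : Euc d) : ℝ :=
  Real.smoothTransition (n * rho x)

theorem contDiff_ballCutoff (n : ℕ) : ContDiff ℝ ∞ (ballCutoff d n) :=
  Real.smoothTransition.contDiff.comp (contDiff_const.mul contDiff_rho)

theorem ballCutoff_eq_zero {n : ℕ} {x : Euc d} (hx : x ∉ ball (0 : Euc d) 1) :
    ballCutoff d n x = 0 := by
  rw [← rho_pos_iff, not_lt] at hx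
  exact Real.smoothTransition.zero_of_nonpos (mul_nonpos_of_nonneg_of_nonpos n.cast_nonneg hx)

theorem hasCompactSupport_ballCutoff (n : ℕ) : HasCompactSupport (ballCutoff d n) :=
  HasCompactSupport.intro (isCompact_closedBall (0 : Euc d) 1) fun _ hx =>
    ballCutoff_eq_zero fun h => hx (ball_subset_closedBall h)

theorem pd_ballCutoff (i : Fin d) (n : ℕ) (x : Euc d) :
    pd i (ballCutoff d n) x = deriv Real.smoothTransition (n * rho x) * (n * (-2 * x i)) := by
  have h1 : DifferentiableAt ℝ Real.smoothTransition (n * rho x) :=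
    (Real.smoothTransition.contDiff (n := 1)).differentiable (by simp) _
  have h2 : DifferentiableAt ℝ (fun y : Euc d => n * rho y) x :=
    smooth_differentiable (contDiff_const.mul contDiff_rho) x
  have h3 := pd_const_mul_apply i (n : ℝ) (smooth_differentiable (contDiff_rho (d := d)) x)
  rw [pd_rho] at h3
  have h4 : ballCutoff d n = Real.smoothTransition ∘ fun y : Euc d => n * rho y := rfl
  rw [pd, h4, fderiv_comp x h1 h2, ← h3]
  simp [pd, mul_comm]

theorem tendsto_mul_rho_atTop {x : Euc d} (hx : x ∈ ball (0 : Euc d) 1) :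
    ∀ᶠ n : ℕ in atTop, 1 ≤ (n : ℝ) * rho x :=
  (tendsto_natCast_atTop_atTop.atTop_mul_const (rho_pos_iff.2 hx)).eventually_ge_atTop 1

theorem integrableOn_ball {f : Euc d → ℝ} (hf : Continuous f) :
    IntegrableOn f (ball (0 : Euc d) 1) :=
  (hf.continuousOn.integrableOn_compact (isCompact_closedBall 0 1)).mono_set ball_subset_closedBall

theorem volume_ball_lt_top : volume (ball (0 : Euc d) 1) < ⊤ := measure_ball_lt_top

/-- A one-sided divergence theorem on the unit ball. -/
theorem integral_div_nonneg (F : Fin d → Euc d → ℝ) (hF : ∀ i, ContDiff ℝ ∞ (F i)) (C : ℝ)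
    (h : ∀ x ∈ ball (0 : Euc d) 1, -C * rho x ≤ ∑ i, x i * F i x) :
    0 ≤ ∫ x in ball (0 : Euc d) 1, ∑ i, pd i (F i) x := by
  have hdiv : Continuous fun x => ∑ i, pd i (F i) x :=
    continuous_finsetSum _ fun i _ => (contDiff_pd i (hF i)).continuous
  set S' := deriv Real.smoothTransition with hS'
  have hS'c : Continuous S' := continuous_deriv_smoothTransition
  have hrc : Continuous (rho : Euc d → ℝ) := contDiff_rho.continuous
  have hparts : ∀ n : ℕ, ∫ x in ball (0 : Euc d) 1, ballCutoff d n x * ∑ i, pd i (F i) x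
      = ∫ x in ball (0 : Euc d) 1, 2 * (n * S' (n * rho x)) * ∑ i, x i * F i x := by
    intro n
    have e1 : ∀ G : Euc d → ℝ, (∀ x ∉ ball (0 : Euc d) 1, G x = 0) →
        ∫ x in ball (0 : Euc d) 1, G x = ∫ x, G x := fun G hG =>
      setIntegral_eq_integral_of_forall_compl_eq_zero hG
    rw [e1 _ fun x hx => by rw [ballCutoff_eq_zero hx, zero_mul], e1]
    swap
    · intro x hx
      rw [← rho_pos_iff, not_lt] at hx
      rw [hS', smoothTransition_deriv_eq_zero
        (Or.inl (mul_nonpos_of_nonneg_of_nonpos n.cast_nonneg hx))]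
      simp
    have hχ := contDiff_ballCutoff (d := d) n
    have hχc := hasCompactSupport_ballCutoff (d := d) n
    calc ∫ x, ballCutoff d n x * ∑ i, pd i (F i) x
        = ∑ i, ∫ x, ballCutoff d n x * pd i (F i) x := by
          rw [← integral_finsetSum]
          · simp only [Finset.mul_sum]
          · exact fun i _ => (hχ.continuous.mul
              (contDiff_pd i (hF i)).continuous).integrable_of_hasCompactSupport hχc.mul_right
      _ = ∑ i, ∫ x, 2 * (n * S' (n * rho x)) * (x i * F i x) := by
          refine Finset.sum_congr rfl fun i _ => ?_
          rw [integral_mul_pd i (hχ.of_le (by simp)) hχc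
            fun x _ => ((hF i).of_le (by simp)).contDiffAt, ← integral_neg]
          congr 1; ext x
          rw [pd_ballCutoff]; ring
      _ = _ := by
          rw [← integral_finsetSum]
          · simp only [Finset.mul_sum]
          · intro i _
            have hc : HasCompactSupport (pd i (ballCutoff d n)) := hχc.fderiv_apply ℝ _
            have : Integrable fun x => pd i (ballCutoff d n) x * F i x :=
              ((contDiff_pd i hχ).continuous.mul
                (hF i).continuous).integrable_of_hasCompactSupport hc.mul_right
            refine this.neg.congr (Eventually.of_forall fun x => ?_)
            simp only [Pi.neg_apply, pd_ballCutoff]; ring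
  have hfin : IsFiniteMeasure (volume.restrict (ball (0 : Euc d) 1)) :=
    ⟨by rw [Measure.restrict_apply_univ]; exact volume_ball_lt_top⟩
  obtain ⟨M, hM⟩ := exists_bound_mul_deriv_smoothTransition
  have lim1 : Tendsto (fun n : ℕ => ∫ x in ball (0 : Euc d) 1,
      ballCutoff d n x * ∑ i, pd i (F i) x) atTop
      (𝓝 (∫ x in ball (0 : Euc d) 1, ∑ i, pd i (F i) x)) := by
    refine tendsto_integral_of_dominated_convergence (fun x => ‖∑ i, pd i (F i) x‖)
      (fun n => ((contDiff_ballCutoff n).continuous.mul hdiv).aestronglyMeasurable)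
      (integrableOn_ball hdiv).norm (fun n => Eventually.of_forall fun x => ?_) ?_
    · rw [norm_mul]
      refine mul_le_of_le_one_left (norm_nonneg _) ?_
      rw [ballCutoff, Real.norm_of_nonneg (Real.smoothTransition.nonneg _)]
      exact Real.smoothTransition.le_one _
    · filter_upwards [ae_restrict_mem measurableSet_ball] with x hx
      refine tendsto_const_nhds.congr' ?_
      filter_upwards [tendsto_mul_rho_atTop hx] with n hn
      rw [ballCutoff, Real.smoothTransition.one_of_one_le hn, one_mul]
  have lim2 : Tendsto (fun n : ℕ => ∫ x in ball (0 : Euc d) 1,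
      (-2 * C) * (n * rho x * S' (n * rho x))) atTop
      (𝓝 (∫ x in ball (0 : Euc d) 1, (0 : ℝ))) := by
    refine tendsto_integral_of_dominated_convergence (fun x => |-2 * C| * M)
      (fun n => Continuous.aestronglyMeasurable (by fun_prop))
      (integrable_const _) (fun n => Eventually.of_forall fun x => ?_) ?_
    · rw [norm_mul]
      exact mul_le_mul_of_nonneg_left (hM _) (norm_nonneg _)
    · filter_upwards [ae_restrict_mem measurableSet_ball] with x hx
      refine tendsto_const_nhds.congr' ?_
      filter_upwards [tendsto_mul_rho_atTop hx] with n hn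
      rw [hS', smoothTransition_deriv_eq_zero (Or.inr hn)]; simp
  rw [integral_zero] at lim2
  refine le_of_tendsto_of_tendsto' lim2 lim1 fun n => ?_
  rw [hparts]
  refine setIntegral_mono_on (integrableOn_ball (by fun_prop))
    (integrableOn_ball ?_) measurableSet_ball fun x hx => ?_
  · have : Continuous fun x : Euc d => ∑ i, x i * F i x :=
      continuous_finsetSum _ fun i _ => (contDiff_coord i).continuous.mul (hF i).continuous
    fun_prop
  · have h1 := mul_le_mul_of_nonneg_left (h x hx) (mul_nonneg (mul_nonneg zero_le_two
      (Nat.cast_nonneg n)) (smoothTransition_deriv_nonneg (n * rho x)))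
    rw [← hS'] at h1
    linarith

theorem integral_div_eq_zero (F : Fin d → Euc d → ℝ) (hF : ∀ i, ContDiff ℝ ∞ (F i)) (C : ℝ)
    (h : ∀ x ∈ ball (0 : Euc d) 1, |∑ i, x i * F i x| ≤ C * rho x) :
    ∫ x in ball (0 : Euc d) 1, ∑ i, pd i (F i) x = 0 := by
  have h1 := integral_div_nonneg F hF C fun x hx => by
    have := (abs_le.1 (h x hx)).1; linarith
  have h2 := integral_div_nonneg (fun i x => (-1) * F i x) (fun i => contDiff_const.mul (hF i)) C
    fun x hx => by
      have := (abs_le.1 (h x hx)).2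
      have e : ∑ i, x i * ((-1) * F i x) = -∑ i, x i * F i x := by
        rw [← Finset.sum_neg_distrib]; exact Finset.sum_congr rfl fun i _ => by ring
      rw [e]; linarith
  simp only [pd_const_mul _ _ (hF _), ← Finset.mul_sum] at h2
  rw [integral_const_mul] at h2
  linarith

end Divergence

section Energy

theorem sum_sum_eq_zero_of_antisymm {ι : Type*} [Fintype ι] (g : ι → ι → ℝ)
    (h : ∀ i j, g i j = -g j i) : ∑ i, ∑ j, g i j = 0 := by
  have h1 : ∑ i, ∑ j, g i j = ∑ i, ∑ j, g j i := Finset.sum_comm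
  have h2 : ∑ i, ∑ j, g i j = -∑ i, ∑ j, g j i := by
    simp only [← Finset.sum_neg_distrib, ← h]
  linarith

theorem contDiff_diagOp (a : Fin d → ℝ) {u : Euc d → ℝ} (hu : ContDiff ℝ ∞ u) :
    ContDiff ℝ ∞ (diagOp a u) :=
  ContDiff.sum fun i _ => contDiff_const.mul (contDiff_pd i (contDiff_pd i hu))

theorem pd_rho_mul (i : Fin d) {Q : Euc d → ℝ} (hQ : ContDiff ℝ ∞ Q) :
    pd i (fun x => rho x * Q x) = fun x => -2 * x i * Q x + rho x * pd i Q x := by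
  rw [pd_mul i contDiff_rho hQ, pd_rho]

theorem pd_pd_rho_mul (i j : Fin d) {Q : Euc d → ℝ} (hQ : ContDiff ℝ ∞ Q) :
    pd i (pd j (fun x => rho x * Q x)) = fun x => (if i = j then -2 * Q x else 0)
      - 2 * x j * pd i Q x - 2 * x i * pd j Q x + rho x * pd i (pd j Q) x := by
  have hx : ContDiff ℝ ∞ fun x : Euc d => -2 * x j := contDiff_const.mul (contDiff_coord j)
  rw [pd_rho_mul j hQ, pd_add i (hx.mul hQ) (contDiff_rho.mul (contDiff_pd j hQ)),
    pd_rho_mul i (contDiff_pd j hQ), pd_mul i hx hQ, pd_const_mul i _ (contDiff_coord j), pd_coord]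
  ext x
  split_ifs <;> ring

theorem exists_abs_le_on_ball {f : Euc d → ℝ} (hf : Continuous f) :
    ∃ C : ℝ, 0 ≤ C ∧ ∀ x ∈ closedBall (0 : Euc d) 1, |f x| ≤ C := by
  obtain ⟨C, hC⟩ := (isCompact_closedBall (0 : Euc d) 1).exists_bound_of_continuousOn
    hf.continuousOn
  exact ⟨C, (norm_nonneg _).trans (hC 0 (by simp)), hC⟩

/-- The global `L²` bound for second derivatives of functions vanishing on the unit sphere. -/
theorem integral_hessian_sq_le (a : Fin d → ℝ) (ha : ∀ i, 0 ≤ a i) {Q : Euc d → ℝ}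
    (hQ : ContDiff ℝ ∞ Q) :
    ∫ x in ball (0 : Euc d) 1, ∑ k, ∑ j, a k * a j * pd k (pd j fun y => rho y * Q y) x ^ 2 ≤
      ∫ x in ball (0 : Euc d) 1, diagOp a (fun y => rho y * Q y) x ^ 2 := by
  set v : Euc d → ℝ := fun y => rho y * Q y with hv
  have vs : ContDiff ℝ ∞ v := contDiff_rho.mul hQ
  have v1 := fun i => contDiff_pd i vs
  have v2 := fun i j => contDiff_pd i (v1 j)
  have v3 := fun i j k => contDiff_pd i (v2 j k)
  have q1 := fun i => contDiff_pd i hQ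
  have q2 := fun i j => contDiff_pd i (q1 j)
  let F : Fin d → Euc d → ℝ := fun k x => ∑ j, a k * a j *
    (pd k v x * pd j (pd j v) x - pd j v x * pd k (pd j v) x)
  have hFs : ∀ k j, ContDiff ℝ ∞ fun x => (pd k v x * pd j (pd j v) x -
      pd j v x * pd k (pd j v) x) := fun k j =>
    ((v1 k).mul (v2 j j)).sub ((v1 j).mul (v2 k j))
  have hF : ∀ k, ContDiff ℝ ∞ (F k) := fun k =>
    ContDiff.sum fun j _ => contDiff_const.mul (hFs k j)
  let B : Fin d → Fin d → Euc d → ℝ := fun i j x => (if i = j then -2 * Q x else 0)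
      - 2 * x j * pd i Q x - 2 * x i * pd j Q x
  have hB : ∀ i j, Continuous (B i j) := by
    intro i j
    have h0 := hQ.continuous
    have h1 := (q1 i).continuous
    have h2 := (q1 j).continuous
    dsimp only [B]
    split_ifs <;> fun_prop
  let R : Fin d → Fin d → Euc d → ℝ := fun k j x => x k *
    (pd k Q x * B j j x + -2 * x k * Q x * pd j (pd j Q) x + rho x * (pd k Q x * pd j (pd j Q) x)
      - pd j Q x * B k j x - -2 * x j * Q x * pd k (pd j Q) x
      - rho x * (pd j Q x * pd k (pd j Q) x))
  have hR : Continuous fun x => ∑ k, ∑ j, a k * a j * R k j x := by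
    refine continuous_finsetSum _ fun k _ => continuous_finsetSum _ fun j _ => ?_
    have h0 := hQ.continuous
    have h1 := (q1 k).continuous
    have h2 := (q1 j).continuous
    have h3 := (q2 j j).continuous
    have h4 := (q2 k j).continuous
    have h5 := hB j j
    have h6 := hB k j
    have h7 := (contDiff_rho (d := d)).continuous
    dsimp only [R]
    fun_prop
  obtain ⟨C, hC0, hC⟩ := exists_abs_le_on_ball hR
  have hdiv := integral_div_nonneg F hF C fun x hx => by
    have e : ∑ k, x k * F k x = ∑ k, ∑ j, a k * a j * (if k = j then 0 else 4 * x k ^ 2 * Q x ^ 2)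
        + ∑ k, ∑ j, a k * a j * (4 * x k * x j * Q x * (x k * pd j Q x - x j * pd k Q x))
        + rho x * ∑ k, ∑ j, a k * a j * R k j x := by
      have e1v : ∀ i, pd i v x = -2 * x i * Q x + rho x * pd i Q x :=
        fun i => congrFun (pd_rho_mul i hQ) x
      have e2v : ∀ i j, pd i (pd j v) x = (if i = j then -2 * Q x else 0)
          - 2 * x j * pd i Q x - 2 * x i * pd j Q x + rho x * pd i (pd j Q) x :=
        fun i j => congrFun (pd_pd_rho_mul i j hQ) x
      simp only [F, Finset.mul_sum, ← Finset.sum_add_distrib]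
      refine Finset.sum_congr rfl fun k _ => Finset.sum_congr rfl fun j _ => ?_
      simp only [e1v, e2v, R, B]
      by_cases hkj : k = j
      · subst hkj; simp only [if_true]; ring
      · simp only [hkj, if_false, if_true]; ring
    have hz : ∑ k, ∑ j, a k * a j *
        (4 * x k * x j * Q x * (x k * pd j Q x - x j * pd k Q x)) = 0 :=
      sum_sum_eq_zero_of_antisymm _ (fun i j => by ring)
    rw [e, hz]
    have h1 : 0 ≤ ∑ k, ∑ j, a k * a j * (if k = j then 0 else 4 * x k ^ 2 * Q x ^ 2) :=
      Finset.sum_nonneg fun k _ => Finset.sum_nonneg fun j _ =>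
        mul_nonneg (mul_nonneg (ha k) (ha j)) (by split_ifs <;> positivity)
    have h2 := (abs_le.1 (hC x (ball_subset_closedBall hx))).1
    have h3 := mul_le_mul_of_nonneg_left h2 (rho_pos_iff.2 hx).le
    linarith
  have hdivF : ∀ x, ∑ k, pd k (F k) x = diagOp a v x ^ 2
      - ∑ k, ∑ j, a k * a j * pd k (pd j v) x ^ 2 := by
    intro x
    have e1 : ∑ k, pd k (F k) x = ∑ k, ∑ j, a k * a j *
        (pd k (pd k v) x * pd j (pd j v) x - pd k (pd j v) x ^ 2) +
        ∑ k, ∑ j, a k * a j * (pd k v x * pd k (pd j (pd j v)) x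
          - pd j v x * pd k (pd k (pd j v)) x) := by
      simp only [F, ← Finset.sum_add_distrib]
      refine Finset.sum_congr rfl fun k _ => ?_
      rw [pd_sum _ _ fun j _ => contDiff_const.mul (hFs k j)]
      refine Finset.sum_congr rfl fun j _ => ?_
      rw [pd_const_mul _ _ (hFs k j), pd_sub _ ((v1 k).mul (v2 j j)) ((v1 j).mul (v2 k j)),
        pd_mul _ (v1 k) (v2 j j), pd_mul _ (v1 j) (v2 k j)]
      ring
    have e2 : diagOp a v x ^ 2 = ∑ k, ∑ j, a k * a j * (pd k (pd k v) x * pd j (pd j v) x) := by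
      rw [sq, diagOp, Finset.sum_mul_sum]
      exact Finset.sum_congr rfl fun k _ => Finset.sum_congr rfl fun j _ => by ring
    have hz : ∑ k, ∑ j, a k * a j * (pd k v x * pd k (pd j (pd j v)) x
          - pd j v x * pd k (pd k (pd j v)) x) = 0 := by
      refine sum_sum_eq_zero_of_antisymm _ fun k j => ?_
      have h1 : pd k (pd j (pd j v)) = pd j (pd j (pd k v)) := by
        rw [pd_comm k j (v1 j), pd_comm k j vs]
      have h2 : pd k (pd k (pd j v)) = pd j (pd k (pd k v)) := by
        rw [pd_comm j k (v1 k), pd_comm j k vs]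
      rw [h1, h2]; ring
    rw [e1, e2, hz, add_zero, ← Finset.sum_sub_distrib]
    refine Finset.sum_congr rfl fun k _ => ?_
    rw [← Finset.sum_sub_distrib]
    exact Finset.sum_congr rfl fun j _ => by ring
  simp only [hdivF] at hdiv
  have i1 : IntegrableOn (fun x => diagOp a v x ^ 2) (ball 0 1) :=
    integrableOn_ball ((contDiff_diagOp a vs).continuous.pow 2)
  have i2 : IntegrableOn (fun x => ∑ k, ∑ j, a k * a j * pd k (pd j v) x ^ 2) (ball 0 1) :=
    integrableOn_ball (continuous_finsetSum _ fun k _ => continuous_finsetSum _ fun j _ =>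
      continuous_const.mul ((v2 k j).continuous.pow 2))
  rw [integral_sub i1 i2] at hdiv
  linarith

/-- Local energy identity for functions vanishing on the unit sphere. -/
theorem integral_energy_eq (a : Fin d → ℝ) {q ζ : Euc d → ℝ} (hq : ContDiff ℝ ∞ q)
    (hζ : ContDiff ℝ ∞ ζ) :
    ∫ x in ball (0 : Euc d) 1, (2 * (ζ x * ∑ i, a i * pd i (fun y => rho y * q y) x ^ 2)
      + 2 * (ζ x * (rho x * q x) * diagOp a (fun y => rho y * q y) x)
      - (rho x * q x) ^ 2 * diagOp a ζ x) = 0 := by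
  set w : Euc d → ℝ := fun y => rho y * q y with hw
  have ws : ContDiff ℝ ∞ w := contDiff_rho.mul hq
  have w1 := fun i => contDiff_pd i ws
  have z1 := fun i => contDiff_pd i hζ
  have h2w : ContDiff ℝ ∞ fun x => 2 * ζ x * w x := (contDiff_const.mul hζ).mul ws
  let F : Fin d → Euc d → ℝ := fun i x => a i * (2 * ζ x * w x * pd i w x - w x * w x * pd i ζ x)
  have hFs : ∀ i, ContDiff ℝ ∞ fun x => 2 * ζ x * w x * pd i w x - w x * w x * pd i ζ x :=
    fun i => (h2w.mul (w1 i)).sub ((ws.mul ws).mul (z1 i))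
  have hG : Continuous fun x => ∑ i, x i * (a i * (2 * ζ x * q x * pd i w x -
      q x * w x * pd i ζ x)) := by
    refine continuous_finsetSum _ fun i _ => ?_
    have h0 := hq.continuous
    have h1 := hζ.continuous
    have h2 := ws.continuous
    have h3 := (w1 i).continuous
    have h4 := (z1 i).continuous
    fun_prop
  obtain ⟨C, hC0, hC⟩ := exists_abs_le_on_ball hG
  have := integral_div_eq_zero F (fun i => contDiff_const.mul (hFs i)) C fun x hx => by
    have e : ∑ i, x i * F i x = (∑ i, x i * (a i * (2 * ζ x * q x * pd i w x -
      q x * w x * pd i ζ x))) * rho x := by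
      rw [Finset.sum_mul]
      refine Finset.sum_congr rfl fun i _ => ?_
      simp only [F, hw]; ring
    rw [e, abs_mul, abs_of_pos (rho_pos_iff.2 hx)]
    exact mul_le_mul_of_nonneg_right (hC x (ball_subset_closedBall hx)) (rho_pos_iff.2 hx).le
  rw [← this]
  congr 1; ext x
  simp only [diagOp, Finset.mul_sum, ← Finset.sum_add_distrib, ← Finset.sum_sub_distrib]
  refine Finset.sum_congr rfl fun i _ => ?_
  rw [pd_const_mul i _ (hFs i), pd_sub i (h2w.mul (w1 i)) ((ws.mul ws).mul (z1 i)),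
    pd_mul i h2w (w1 i), pd_mul i (ws.mul ws) (z1 i), pd_mul i (contDiff_const.mul hζ) ws,
    pd_mul i ws ws, pd_const_mul i _ hζ]
  simp only [hw]
  ring

end Energy

section MaximumPrinciple

theorem hasDerivAt_line (i : Fin d) {w : Euc d → ℝ} {x : Euc d} {t : ℝ}
    (hw : DifferentiableAt ℝ w (x + t • EuclideanSpace.single i (1 : ℝ))) :
    HasDerivAt (fun s : ℝ => w (x + s • EuclideanSpace.single i (1 : ℝ)))
      (pd i w (x + t • EuclideanSpace.single i (1 : ℝ))) t := by
  have h : HasDerivAt (fun s : ℝ => x + s • (EuclideanSpace.single i (1 : ℝ) : Euc d))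
      (EuclideanSpace.single i (1 : ℝ)) t := by
    simpa using ((hasDerivAt_id t).smul_const (EuclideanSpace.single i (1 : ℝ) : Euc d)).const_add x
  exact hw.hasFDerivAt.comp_hasDerivAt t h

theorem pd_pd_nonpos_of_isLocalMax (i : Fin d) {w : Euc d → ℝ} {x : Euc d}
    (hw : ContDiffAt ℝ 2 w x) (h : IsLocalMax w x) : pd i (pd i w) x ≤ 0 := by
  by_contra! hpos
  set e : Euc d := EuclideanSpace.single i (1 : ℝ)
  have hcont : Continuous fun s : ℝ => x + s • e := by fun_prop
  have h0 : x + (0 : ℝ) • e = x := by simp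
  have htend : Tendsto (fun s : ℝ => x + s • e) (𝓝 0) (𝓝 x) := by
    simpa using hcont.tendsto 0
  let g : ℝ → ℝ := fun s => w (x + s • e)
  have hev : ∀ᶠ y in 𝓝 x, DifferentiableAt ℝ w y := by
    filter_upwards [hw.eventually (by simp)] with y hy
    exact hy.differentiableAt (by simp)
  have hg : deriv g =ᶠ[𝓝 0] fun s => pd i w (x + s • e) := by
    filter_upwards [htend.eventually hev] with s hs
    exact (hasDerivAt_line i hs).deriv
  have hd1 : DifferentiableAt ℝ (pd i w) (x + (0 : ℝ) • e) := by
    rw [h0]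
    exact (contDiffAt_pd (n := 1) i hw).differentiableAt (by simp)
  have hgg : deriv (deriv g) 0 = pd i (pd i w) x := by
    rw [hg.deriv_eq, (hasDerivAt_line i hd1).deriv, h0]
  have hmax : IsLocalMax g 0 := by
    filter_upwards [htend.eventually h] with s hs
    simpa [g, h0] using hs
  have hgd : deriv g 0 = 0 := hmax.deriv_eq_zero
  have hgc : ContinuousAt g 0 := by
    have : DifferentiableAt ℝ w (x + (0 : ℝ) • e) := by rw [h0]; exact hev.self_of_nhds
    exact (hasDerivAt_line i this).continuousAt
  have hmin : IsLocalMin g 0 := isLocalMin_of_deriv_deriv_pos (hgg ▸ hpos) hgd hgc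
  have hconst : g =ᶠ[𝓝 0] fun _ => g 0 := by
    filter_upwards [hmax, hmin] with s h1 h2
    exact le_antisymm h1 h2
  have : deriv (deriv g) 0 = 0 := by
    have h3 : deriv g =ᶠ[𝓝 0] fun _ => 0 := by
      have := hconst.deriv
      simpa using this
    rw [h3.deriv_eq]; simp
  linarith [hgg ▸ hpos]

theorem nonpos_of_diagOp_pos {a : Fin d → ℝ} (ha : ∀ i, 0 ≤ a i) {w : Euc d → ℝ}
    (hc : ContinuousOn w (closedBall 0 1)) (h2 : ∀ x ∈ ball (0 : Euc d) 1, ContDiffAt ℝ 2 w x)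
    (hb : ∀ x ∈ sphere (0 : Euc d) 1, w x ≤ 0)
    (hL : ∀ x ∈ ball (0 : Euc d) 1, 0 < w x → 0 < diagOp a w x) :
    ∀ x ∈ closedBall (0 : Euc d) 1, w x ≤ 0 := by
  obtain ⟨z, hz, hmax⟩ := (isCompact_closedBall (0 : Euc d) 1).exists_isMaxOn
    ⟨0, by simp⟩ hc
  intro x hx
  refine (hmax hx).trans ?_
  by_contra! hpos
  have hzb : z ∈ ball (0 : Euc d) 1 := by
    by_contra hn
    have : z ∈ sphere (0 : Euc d) 1 := by
      simp only [mem_closedBall, mem_ball, mem_sphere, not_lt] at *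
      exact le_antisymm hz hn
    exact absurd (hb z this) (not_le.2 hpos)
  have hlm : IsLocalMax w z := hmax.isLocalMax
    (Filter.mem_of_superset (isOpen_ball.mem_nhds hzb) ball_subset_closedBall)
  have := hL z hzb hpos
  have h3 : diagOp a w z ≤ 0 := Finset.sum_nonpos fun i _ =>
    mul_nonpos_of_nonneg_of_nonpos (ha i) (pd_pd_nonpos_of_isLocalMax i (h2 z hzb) hlm)
  linarith

theorem diagOp_rho (a : Fin d → ℝ) (x : Euc d) : diagOp a rho x = -2 * ∑ i, a i := by
  rw [diagOp, Finset.mul_sum]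
  refine Finset.sum_congr rfl fun i _ => ?_
  rw [pd_rho, pd_const_mul i _ (contDiff_coord i), pd_coord]
  simp; ring

theorem diagOp_sub_apply (a : Fin d → ℝ) {u v : Euc d → ℝ} {x : Euc d}
    (hu : ContDiffAt ℝ 2 u x) (hv : ContDiffAt ℝ 2 v x) :
    diagOp a (fun y => u y - v y) x = diagOp a u x - diagOp a v x := by
  simp only [diagOp, ← Finset.sum_sub_distrib]
  refine Finset.sum_congr rfl fun i _ => ?_
  have h1 : pd i (fun y => u y - v y) =ᶠ[𝓝 x] fun y => pd i u y - pd i v y := by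
    filter_upwards [hu.eventually (by simp), hv.eventually (by simp)] with y h1 h2
    exact pd_sub_apply i (h1.differentiableAt (by simp)) (h2.differentiableAt (by simp))
  rw [pd_congr i h1, pd_sub_apply i
    ((contDiffAt_pd (n := 1) i hu).differentiableAt (by simp))
    ((contDiffAt_pd (n := 1) i hv).differentiableAt (by simp)), mul_sub]

theorem diagOp_const_mul (a : Fin d → ℝ) (c : ℝ) {u : Euc d → ℝ} (hu : ContDiff ℝ ∞ u) (x : Euc d) :
    diagOp a (fun y => c * u y) x = c * diagOp a u x := by
  simp only [diagOp, Finset.mul_sum]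
  refine Finset.sum_congr rfl fun i _ => ?_
  rw [pd_const_mul i c hu, pd_const_mul i c (contDiff_pd i hu)]
  ring

theorem rho_le_one (x : Euc d) : rho x ≤ 1 := by
  unfold rho; nlinarith [norm_nonneg x]

/-- Quantitative maximum principle for `L - κ`. -/
theorem le_of_neg_le_diagOp_sub [NeZero d] {a : Fin d → ℝ} {lam κ ε : ℝ} (hlam : 0 < lam)
    (ha : ∀ i, lam ≤ a i) (hκ : 0 ≤ κ) (hε : 0 < ε) {w : Euc d → ℝ}
    (hc : ContinuousOn w (closedBall 0 1)) (h2 : ∀ x ∈ ball (0 : Euc d) 1, ContDiffAt ℝ 2 w x)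
    (hb : ∀ x ∈ sphere (0 : Euc d) 1, w x ≤ 0)
    (hL : ∀ x ∈ ball (0 : Euc d) 1, -ε ≤ diagOp a w x - κ * w x) :
    ∀ x ∈ closedBall (0 : Euc d) 1, w x ≤ ε / lam := by
  intro x hx
  have hcr : ContDiff ℝ ∞ fun y : Euc d => ε / lam * rho y := contDiff_const.mul contDiff_rho
  have hpos : 0 < ε / lam := div_pos hε hlam
  have key := nonpos_of_diagOp_pos (a := a) (w := fun y => w y - ε / lam * rho y)
    (fun i => hlam.le.trans (ha i)) (hc.sub hcr.continuous.continuousOn)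
    (fun y hy => (h2 y hy).sub (contDiff_infty.1 hcr 2).contDiffAt)
    (fun y hy => by simpa [rho_eq_zero_of_mem_sphere hy] using hb y hy)
    (fun y hy hwy => by
      rw [diagOp_sub_apply a (h2 y hy) (contDiff_infty.1 hcr 2).contDiffAt,
        diagOp_const_mul a _ contDiff_rho, diagOp_rho]
      have h1 := hL y hy
      have h3 : 0 ≤ ε / lam * rho y := mul_nonneg hpos.le (rho_pos_iff.2 hy).le
      have h4 : 0 ≤ κ * w y := mul_nonneg hκ (by linarith)
      have h5 : lam ≤ ∑ i, a i :=
        (ha 0).trans (Finset.single_le_sum (fun i _ => hlam.le.trans (ha i)) (Finset.mem_univ 0))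
      have h6 : ε ≤ ε / lam * ∑ i, a i := by
        calc ε = ε / lam * lam := by field_simp
          _ ≤ _ := by gcongr
      linarith) x hx
  have h7 : ε / lam * rho x ≤ ε / lam * 1 := by gcongr; exact rho_le_one x
  linarith

theorem abs_le_of_abs_diagOp_sub_le [NeZero d] {a : Fin d → ℝ} {lam κ ε : ℝ} (hlam : 0 < lam)
    (ha : ∀ i, lam ≤ a i) (hκ : 0 ≤ κ) (hε : 0 < ε) {w : Euc d → ℝ}
    (hc : ContinuousOn w (closedBall 0 1)) (h2 : ∀ x ∈ ball (0 : Euc d) 1, ContDiffAt ℝ 2 w x)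
    (hb : ∀ x ∈ sphere (0 : Euc d) 1, w x = 0)
    (hL : ∀ x ∈ ball (0 : Euc d) 1, |diagOp a w x - κ * w x| ≤ ε) :
    ∀ x ∈ closedBall (0 : Euc d) 1, |w x| ≤ ε / lam := by
  intro x hx
  have h1 := le_of_neg_le_diagOp_sub hlam ha hκ hε hc h2 (fun y hy => (hb y hy).le)
    (fun y hy => (abs_le.1 (hL y hy)).1) x hx
  have hneg : ∀ y ∈ ball (0 : Euc d) 1, diagOp a (fun z => 0 - w z) y = - diagOp a w y := by
    intro y hy
    rw [diagOp_sub_apply a contDiffAt_const (h2 y hy)]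
    simp [diagOp, pd_const]
  have h3 := le_of_neg_le_diagOp_sub (w := fun z => 0 - w z) hlam ha hκ hε
    (continuousOn_const.sub hc) (fun y hy => contDiffAt_const.sub (h2 y hy))
    (fun y hy => by simp [hb y hy])
    (fun y hy => by rw [hneg y hy]; linarith [(abs_le.1 (hL y hy)).2]) x hx
  exact abs_le.2 ⟨by linarith, h1⟩

end MaximumPrinciple

section Existence

/-- The function on Euclidean space defined by a polynomial. -/
noncomputable def polyFun (p : MvPolynomial (Fin d) ℝ) (x : Euc d) : ℝ :=
  MvPolynomial.eval (fun i => x i) p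

theorem polyFun_add (p q : MvPolynomial (Fin d) ℝ) :
    polyFun (p + q) = fun x => polyFun p x + polyFun q x := by
  ext x; simp [polyFun]

theorem polyFun_mul (p q : MvPolynomial (Fin d) ℝ) :
    polyFun (p * q) = fun x => polyFun p x * polyFun q x := by
  ext x; simp [polyFun]

theorem polyFun_C (c : ℝ) : polyFun (MvPolynomial.C c : MvPolynomial (Fin d) ℝ) = fun _ => c := by
  ext x; simp [polyFun]

theorem polyFun_X (i : Fin d) : polyFun (MvPolynomial.X i) = fun x => x i := by
  ext x; simp [polyFun]

theorem contDiff_polyFun (p : MvPolynomial (Fin d) ℝ) : ContDiff ℝ ∞ (polyFun p) := by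
  induction p using MvPolynomial.induction_on with
  | C c => rw [polyFun_C]; exact contDiff_const
  | add p q hp hq => rw [polyFun_add]; exact hp.add hq
  | mul_X p i hp => rw [polyFun_mul, polyFun_X]; exact hp.mul (contDiff_coord i)

theorem pd_polyFun (i : Fin d) (p : MvPolynomial (Fin d) ℝ) :
    pd i (polyFun p) = polyFun (MvPolynomial.pderiv i p) := by
  induction p using MvPolynomial.induction_on with
  | C c => rw [polyFun_C, pd_const]; ext x; simp [polyFun]
  | add p q hp hq =>
    rw [polyFun_add, pd_add i (contDiff_polyFun p) (contDiff_polyFun q), hp, hq, map_add,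
      polyFun_add]
  | mul_X p j hp =>
    rw [polyFun_mul, polyFun_X, pd_mul i (contDiff_polyFun p) (contDiff_coord j), hp, pd_coord]
    ext x
    by_cases h : i = j
    · subst h; simp [polyFun]; ring
    · simp [polyFun, h, MvPolynomial.pderiv_X_of_ne (Ne.symm h)]; ring

theorem totalDegree_pderiv_le (i : Fin d) {p : MvPolynomial (Fin d) ℝ} {n : ℕ}
    (hp : p.totalDegree ≤ n + 1) : (MvPolynomial.pderiv i p).totalDegree ≤ n := by
  conv_lhs => rw [p.as_sum, map_sum]
  refine MvPolynomial.totalDegree_finsetSum_le fun s hs => ?_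
  rw [MvPolynomial.pderiv_monomial]
  have h1 := (MvPolynomial.le_totalDegree hs).trans hp
  by_cases h : s i = 0
  · simp [h]
  · refine (MvPolynomial.totalDegree_monomial_le _ _).trans ?_
    have h2 : (s - Finsupp.single i 1) + Finsupp.single i 1 = s := by
      refine tsub_add_cancel_of_le ?_
      rw [Finsupp.single_le_iff]; omega
    have h3 : (s.sum fun _ e => e) = ((s - Finsupp.single i 1).sum fun _ e => e) + 1 := by
      conv_lhs => rw [← h2]
      rw [Finsupp.sum_add_index' (by simp) (by simp)]
      simp
    change ((s - Finsupp.single i 1).sum fun _ e => e) ≤ n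
    omega

/-- The polynomial `1 - |x|²`. -/
noncomputable def rhoPoly (d : ℕ) : MvPolynomial (Fin d) ℝ := 1 - ∑ i, MvPolynomial.X i * MvPolynomial.X i

theorem polyFun_rhoPoly : polyFun (rhoPoly d) = rho := by
  ext x; simp [polyFun, rhoPoly, rho_eq]

theorem totalDegree_rhoPoly_le : (rhoPoly d).totalDegree ≤ 2 := by
  refine (MvPolynomial.totalDegree_sub _ _).trans (max_le (by simp) ?_)
  refine MvPolynomial.totalDegree_finsetSum_le fun i _ => ?_
  exact (MvPolynomial.totalDegree_mul _ _).trans (by simp)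

/-- The linear map `q ↦ L((1 - |x|²) q)` on polynomials. -/
noncomputable def polyOp (a : Fin d → ℝ) : MvPolynomial (Fin d) ℝ →ₗ[ℝ] MvPolynomial (Fin d) ℝ where
  toFun q := ∑ i, MvPolynomial.C (a i) *
    MvPolynomial.pderiv i (MvPolynomial.pderiv i (rhoPoly d * q))
  map_add' p q := by simp only [mul_add, map_add, Finset.sum_add_distrib]
  map_smul' c p := by
    simp only [mul_smul_comm, Finset.smul_sum, RingHom.id_apply, Derivation.map_smul]

theorem polyFun_sum {ι : Type*} (s : Finset ι) (p : ι → MvPolynomial (Fin d) ℝ) (x : Euc d) :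
    polyFun (∑ i ∈ s, p i) x = ∑ i ∈ s, polyFun (p i) x := by
  simp [polyFun]

theorem polyFun_polyOp (a : Fin d → ℝ) (q : MvPolynomial (Fin d) ℝ) :
    polyFun (polyOp a q) = diagOp a fun x => rho x * polyFun q x := by
  ext x
  change polyFun (∑ i, MvPolynomial.C (a i) *
    MvPolynomial.pderiv i (MvPolynomial.pderiv i (rhoPoly d * q))) x = _
  rw [polyFun_sum, diagOp]
  refine Finset.sum_congr rfl fun i _ => ?_
  rw [← polyFun_rhoPoly, ← polyFun_mul, pd_polyFun, pd_polyFun, polyFun_mul, polyFun_C]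

theorem totalDegree_polyOp_le (a : Fin d → ℝ) {q : MvPolynomial (Fin d) ℝ} {n : ℕ}
    (hq : q.totalDegree ≤ n) : (polyOp a q).totalDegree ≤ n := by
  refine MvPolynomial.totalDegree_finsetSum_le fun i _ => ?_
  refine (MvPolynomial.totalDegree_mul _ _).trans ?_
  rw [MvPolynomial.totalDegree_C, zero_add]
  refine totalDegree_pderiv_le i (totalDegree_pderiv_le i ?_)
  refine (MvPolynomial.totalDegree_mul _ _).trans ?_
  have := totalDegree_rhoPoly_le (d := d)
  omega

theorem eq_zero_of_polyFun_eq_zero_on_ball {p : MvPolynomial (Fin d) ℝ}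
    (hp : ∀ x ∈ ball (0 : Euc d) 1, polyFun p x = 0) : p = 0 := by
  refine MvPolynomial.funext_set (fun _ => Ioo 0 (1 / ((d : ℝ) + 1)))
    (fun _ => Ioo_infinite (by positivity)) fun y hy => ?_
  have hb : WithLp.toLp 2 y ∈ ball (0 : Euc d) 1 := by
    rw [← rho_pos_iff, rho_eq]
    have h1 : ∀ i, y i * y i ≤ 1 / ((d : ℝ) + 1) := by
      intro i
      obtain ⟨h2, h3⟩ := hy i (mem_univ i)
      have h4 : 1 / ((d : ℝ) + 1) ≤ 1 := by rw [div_le_one (by positivity)]; linarith [(Nat.cast_nonneg d : (0:ℝ) ≤ d)]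
      nlinarith
    have h2 : ∑ i, y i * y i ≤ ∑ _i : Fin d, 1 / ((d : ℝ) + 1) := Finset.sum_le_sum fun i _ => h1 i
    have h3 : ∑ _i : Fin d, 1 / ((d : ℝ) + 1) < 1 := by
      simp only [Finset.sum_const, Finset.card_univ, Fintype.card_fin, nsmul_eq_mul]
      rw [mul_one_div, div_lt_one (by positivity)]; linarith
    simp only
    linarith
  simpa [polyFun] using hp _ hb

theorem exists_polyFun_near (h : Euc d → ℝ) (hh : Continuous h) {ε : ℝ} (hε : 0 < ε) :
    ∃ p : MvPolynomial (Fin d) ℝ, ∀ x ∈ closedBall (0 : Euc d) 1, |polyFun p x - h x| < ε := by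
  let c : Fin d → C(Euc d, ℝ) := fun i => ⟨fun x => x i, (contDiff_coord i).continuous⟩
  have hc : ∀ (p : MvPolynomial (Fin d) ℝ) (x : Euc d), MvPolynomial.aeval c p x = polyFun p x := by
    intro p x
    induction p using MvPolynomial.induction_on with
    | C r => simp [polyFun]
    | add p q hp hq => simp [polyFun_add, hp, hq]
    | mul_X p i hp => simp [polyFun_mul, polyFun_X, hp, c]
  have hsep : (MvPolynomial.aeval c : MvPolynomial (Fin d) ℝ →ₐ[ℝ] _).range.SeparatesPoints := by
    intro x y hxy
    have : ∃ i, x i ≠ y i := by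
      by_contra! hn
      exact hxy (by ext i; exact hn i)
    obtain ⟨i, hi⟩ := this
    exact ⟨_, ⟨_, ⟨MvPolynomial.X i, rfl⟩, rfl⟩, by simpa [c] using hi⟩
  obtain ⟨g, ⟨p, hp⟩, hg⟩ :=
    ContinuousMap.exists_mem_subalgebra_near_continuous_of_isCompact_of_separatesPoints hsep
      ⟨h, hh⟩ (isCompact_closedBall (0 : Euc d) 1) hε
  refine ⟨p, fun x hx => ?_⟩
  have := hg x hx
  rw [← hp] at this
  simpa [hc] using this

theorem diagOp_add_apply (a : Fin d → ℝ) {u v : Euc d → ℝ} (hu : ContDiff ℝ ∞ u)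
    (hv : ContDiff ℝ ∞ v) (x : Euc d) :
    diagOp a (fun y => u y + v y) x = diagOp a u x + diagOp a v x := by
  simp only [diagOp, ← Finset.sum_add_distrib]
  refine Finset.sum_congr rfl fun i _ => ?_
  rw [pd_add i hu hv, pd_add i (contDiff_pd i hu) (contDiff_pd i hv), mul_add]

variable [NeZero d] {a : Fin d → ℝ} {lam : ℝ}

theorem polyOp_injective (hlam : 0 < lam) (ha : ∀ i, lam ≤ a i) :
    Function.Injective (polyOp a) := by
  rw [injective_iff_map_eq_zero]
  intro q hq
  refine eq_zero_of_polyFun_eq_zero_on_ball fun x hx => ?_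
  have hs : ContDiff ℝ ∞ fun y => rho y * polyFun q y := contDiff_rho.mul (contDiff_polyFun q)
  have h0 : ∀ y, diagOp a (fun x => rho x * polyFun q x) y = 0 := by
    intro y
    rw [← polyFun_polyOp, hq]; simp [polyFun]
  have hz : ∀ ε > 0, |rho x * polyFun q x| ≤ ε := by
    intro ε hε
    have := abs_le_of_abs_diagOp_sub_le (κ := 0) hlam ha le_rfl (mul_pos hε hlam)
      hs.continuous.continuousOn (fun y _ => (contDiff_infty.1 hs 2).contDiffAt)
      (fun y hy => by simp [rho_eq_zero_of_mem_sphere hy])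
      (fun y _ => by rw [h0 y]; simpa using (mul_pos hε hlam).le) x (ball_subset_closedBall hx)
    rwa [mul_div_cancel_right₀ _ hlam.ne'] at this
  have h1 : rho x * polyFun q x = 0 := by
    by_contra h
    have := hz _ (half_pos (abs_pos.2 h))
    linarith [abs_pos.2 h]
  exact (mul_eq_zero.1 h1).resolve_left (rho_pos_iff.2 hx).ne'

theorem polyOp_surjective (hlam : 0 < lam) (ha : ∀ i, lam ≤ a i) :
    Function.Surjective (polyOp a) := by
  intro p
  let V := MvPolynomial.restrictTotalDegree (Fin d) ℝ p.totalDegree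
  let T : V →ₗ[ℝ] V := (polyOp a).restrict fun q hq => by
    rw [MvPolynomial.mem_restrictTotalDegree] at hq ⊢
    exact totalDegree_polyOp_le a hq
  have hT : Function.Injective T := fun q₁ q₂ h =>
    Subtype.ext (polyOp_injective hlam ha (congrArg Subtype.val h))
  obtain ⟨q, hq⟩ := LinearMap.injective_iff_surjective.1 hT
    ⟨p, (MvPolynomial.mem_restrictTotalDegree _ _ _).2 le_rfl⟩
  exact ⟨q, congrArg Subtype.val hq⟩

theorem exists_diagOp_near (hlam : 0 < lam) (ha : ∀ i, lam ≤ a i) (h : Euc d → ℝ)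
    (hh : Continuous h) {ε : ℝ} (hε : 0 < ε) :
    ∃ q : Euc d → ℝ, ContDiff ℝ ∞ q ∧ ∀ x ∈ closedBall (0 : Euc d) 1,
      |diagOp a (fun y => rho y * q y) x - h x| ≤ ε := by
  obtain ⟨p, hp⟩ := exists_polyFun_near h hh hε
  obtain ⟨q, rfl⟩ := polyOp_surjective hlam ha p
  refine ⟨polyFun q, contDiff_polyFun q, fun x hx => ?_⟩
  rw [← polyFun_polyOp]
  exact (hp x hx).le

/-- Approximate solvability of `(L - κ) w = h` with `w` vanishing on the unit sphere. -/
theorem exists_diagOp_sub_near (hlam : 0 < lam) (ha : ∀ i, lam ≤ a i) {κ : ℝ} (hκ : 0 ≤ κ)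
    (h : Euc d → ℝ) (hh : Continuous h) {ε : ℝ} (hε : 0 < ε) :
    ∃ q : Euc d → ℝ, ContDiff ℝ ∞ q ∧ ∀ x ∈ closedBall (0 : Euc d) 1,
      |diagOp a (fun y => rho y * q y) x - κ * (rho x * q x) - h x| ≤ ε := by
  obtain ⟨n, hn⟩ := exists_nat_ge (κ / (lam / 4))
  rw [div_le_iff₀ (by positivity)] at hn
  induction n generalizing κ h ε with
  | zero =>
    have : κ = 0 := le_antisymm (by simpa using hn) hκ
    subst this
    simpa using exists_diagOp_near hlam ha h hh hε
  | succ n ih =>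
    set κ' : ℝ := max (κ - lam / 4) 0 with hκ'
    have hk0 : 0 ≤ κ' := le_max_right _ _
    have hkn : κ' ≤ n * (lam / 4) := by
      refine max_le ?_ (by positivity)
      push_cast at hn; linarith
    have hkk : κ' ≤ κ := max_le (by linarith) hκ
    have hkd : κ - κ' ≤ lam / 4 := by linarith [le_max_left (κ - lam / 4) 0]
    have step : ∀ (g : Euc d → ℝ), Continuous g → ∀ M : ℝ, 0 < M →
        (∀ x ∈ closedBall (0 : Euc d) 1, |g x| ≤ M) →
        ∃ q : Euc d → ℝ, ContDiff ℝ ∞ q ∧ ∀ x ∈ closedBall (0 : Euc d) 1,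
          |diagOp a (fun y => rho y * q y) x - κ * (rho x * q x) - g x| ≤ M * (3 / 4) := by
      intro g hg M hM hgM
      obtain ⟨q, hq, hqe⟩ := ih hk0 g hg (ε := M / 4) (by positivity) hkn
      refine ⟨q, hq, fun x hx => ?_⟩
      have hs : ContDiff ℝ ∞ fun y => rho y * q y := contDiff_rho.mul hq
      have hw := abs_le_of_abs_diagOp_sub_le (ε := M * (5 / 4)) hlam ha hk0 (by positivity)
        hs.continuous.continuousOn (fun y _ => (contDiff_infty.1 hs 2).contDiffAt)
        (fun y hy => by simp [rho_eq_zero_of_mem_sphere hy])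
        (fun y hy => by
          have h1 := abs_le.1 (hqe y (ball_subset_closedBall hy))
          have h2 := abs_le.1 (hgM y (ball_subset_closedBall hy))
          exact abs_le.2 ⟨by linarith, by linarith⟩) x hx
      have h1 : |(κ - κ') * (rho x * q x)| ≤ M * (5 / 16) := by
        rw [abs_mul, abs_of_nonneg (by linarith)]
        calc (κ - κ') * |rho x * q x| ≤ lam / 4 * (M * (5 / 4) / lam) := by gcongr
          _ = M * (5 / 16) := by field_simp; ring
      have h2 := abs_le.1 (hqe x hx)
      have h3 := abs_le.1 h1
      exact abs_le.2 ⟨by linarith, by linarith⟩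
    obtain ⟨M, hM0, hM⟩ := exists_abs_le_on_ball hh
    have iter : ∀ m : ℕ, ∃ q : Euc d → ℝ, ContDiff ℝ ∞ q ∧ ∀ x ∈ closedBall (0 : Euc d) 1,
          |diagOp a (fun y => rho y * q y) x - κ * (rho x * q x) - h x| ≤ (M + 1) * (3 / 4) ^ m := by
      intro m
      induction m with
      | zero =>
        refine ⟨fun _ => 0, contDiff_const, fun x hx => ?_⟩
        have := hM x hx
        simp [diagOp, pd_const]
        linarith
      | succ m ihm =>
        obtain ⟨q, hq, hqe⟩ := ihm
        have hs : ContDiff ℝ ∞ fun y => rho y * q y := contDiff_rho.mul hq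
        have hg : Continuous fun x => h x -
            (diagOp a (fun y => rho y * q y) x - κ * (rho x * q x)) :=
          hh.sub ((contDiff_diagOp a hs).continuous.sub (continuous_const.mul hs.continuous))
        obtain ⟨q', hq', hqe'⟩ := step _ hg ((M + 1) * (3 / 4) ^ m) (by positivity)
          (fun x hx => by rw [abs_sub_comm]; exact hqe x hx)
        refine ⟨fun x => q x + q' x, hq.add hq', fun x hx => ?_⟩
        have hs' : ContDiff ℝ ∞ fun y => rho y * q' y := contDiff_rho.mul hq'
        have h1 := hqe' x hx
        simp only [mul_add]
        rw [diagOp_add_apply a hs hs']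
        refine le_of_eq_of_le ?_ (h1.trans_eq (by ring))
        congr 1; ring
    have htend : Tendsto (fun m : ℕ => (M + 1) * (3 / 4 : ℝ) ^ m) atTop (𝓝 0) := by
      simpa using (tendsto_pow_atTop_nhds_zero_of_lt_one (r := (3 / 4 : ℝ)) (by norm_num)
        (by norm_num)).const_mul (M + 1)
    obtain ⟨m, hm⟩ := (htend.eventually (eventually_le_nhds hε)).exists
    obtain ⟨q, hq, hqe⟩ := iter m
    exact ⟨q, hq, fun x hx => (hqe x hx).trans hm⟩

end Existence

section Covering

theorem volume_real_closedBall (x : Euc d) {r : ℝ} (hr : 0 ≤ r) :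
    volume.real (closedBall x r) = r ^ d * volume.real (ball (0 : Euc d) 1) := by
  rw [measureReal_def, Measure.addHaar_closedBall _ _ hr, ENNReal.toReal_mul,
    ENNReal.toReal_ofReal (by positivity), finrank_euclideanSpace_fin, measureReal_def]

theorem volume_real_ball_pos : 0 < volume.real (ball (0 : Euc d) 1) :=
  ENNReal.toReal_pos (measure_ball_pos _ _ one_pos).ne' volume_ball_lt_top.ne

theorem sum_pow_le_of_disjoint_subset (J : Finset (Euc d)) (s : Euc d → ℝ) (hs : ∀ x ∈ J, 0 ≤ s x)
    (hJ : (J : Set (Euc d)).PairwiseDisjoint fun x => closedBall x (s x)) {z : Euc d} {R : ℝ}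
    (hR : 0 ≤ R) (hsub : ∀ x ∈ J, closedBall x (s x) ⊆ closedBall z R) :
    ∑ x ∈ J, s x ^ d ≤ R ^ d := by
  have h1 : volume.real (⋃ x ∈ J, closedBall x (s x)) = ∑ x ∈ J, volume.real (closedBall x (s x)) :=
    measureReal_biUnion_finset hJ (fun x _ => measurableSet_closedBall)
      (fun x _ => measure_closedBall_lt_top.ne)
  have h2 : volume.real (⋃ x ∈ J, closedBall x (s x)) ≤ volume.real (closedBall z R) :=
    measureReal_mono (iUnion₂_subset hsub) measure_closedBall_lt_top.ne
  rw [h1, volume_real_closedBall z hR,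
    Finset.sum_congr rfl fun x hx => volume_real_closedBall x (hs x hx), ← Finset.sum_mul] at h2
  exact le_of_mul_le_mul_right h2 volume_real_ball_pos

/-- A Whitney type covering by balls of slowly varying radii. -/
theorem exists_finset_cover {t : Euc d → ℝ} {δ R : ℝ} (hδ : 0 < δ) (htδ : ∀ x, δ ≤ t x)
    (htR : ∀ x, t x ≤ R) (hL : ∀ x y, |t x - t y| ≤ dist x y / 12) :
    ∃ I : Finset (Euc d), (∀ x ∈ I, x ∈ closedBall (0 : Euc d) 1) ∧
      (closedBall (0 : Euc d) 1 ⊆ ⋃ x ∈ I, ball x (t x)) ∧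
      ((I : Set (Euc d)).PairwiseDisjoint fun x => closedBall x (t x / 6)) ∧
      ∀ z, ((I.filter fun x => dist z x ≤ 6 * t x).card : ℝ) ≤ 117 ^ d := by
  obtain ⟨u, hu, hdisj, hcov⟩ := Vitali.exists_disjoint_subfamily_covering_enlargement_closedBall
    (closedBall (0 : Euc d) 1) id (fun x => t x / 6) (R / 6)
    (fun x _ => by have := htR x; linarith) 5 (by norm_num)
  have hpos : ∀ x, 0 < t x := fun x => hδ.trans_le (htδ x)
  have hcov' : closedBall (0 : Euc d) 1 ⊆ ⋃ x ∈ u, ball x (t x) := by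
    intro y hy
    obtain ⟨b, hb, hsub⟩ := hcov y hy
    have h1 : y ∈ closedBall b (5 * (t b / 6)) :=
      hsub (mem_closedBall_self (by have := hpos y; positivity))
    refine mem_iUnion₂.2 ⟨b, hb, ?_⟩
    rw [mem_closedBall] at h1
    rw [mem_ball]
    linarith [hpos b]
  obtain ⟨I', hI', hfin, hIcov⟩ := (isCompact_closedBall (0 : Euc d) 1).elim_finite_subcover_image
    (fun x _ => isOpen_ball) hcov'
  lift I' to Finset (Euc d) using hfin
  refine ⟨I', fun x hx => hu (hI' hx), hIcov, hdisj.subset hI', fun z => ?_⟩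
  set J := I'.filter fun x => dist z x ≤ 6 * t x
  have hJ : ∀ x ∈ J, dist z x ≤ 6 * t x ∧ t x ≤ 2 * t z ∧ t z ≤ 3 / 2 * t x := by
    intro x hx
    have h1 := (Finset.mem_filter.1 hx).2
    have h2 := abs_le.1 (hL z x)
    exact ⟨h1, by linarith, by linarith⟩
  have key := sum_pow_le_of_disjoint_subset J (fun _ => t z / 9)
    (fun _ _ => by have := hpos z; positivity)
    (by
      intro x hx y hy hxy
      refine (hdisj (hI' (Finset.mem_filter.1 hx).1) (hI' (Finset.mem_filter.1 hy).1) hxy).mono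
        (closedBall_subset_closedBall ?_) (closedBall_subset_closedBall ?_)
      · linarith [(hJ x hx).2.2]
      · linarith [(hJ y hy).2.2])
    (z := z) (R := 117 * (t z / 9)) (by have := hpos z; positivity)
    (fun x hx => by
      refine closedBall_subset_closedBall' ?_
      rw [dist_comm]
      linarith [hJ x hx, hpos z])
  rw [Finset.sum_const, nsmul_eq_mul, mul_pow] at key
  exact le_of_mul_le_mul_right key (pow_pos (by have := hpos z; positivity) _)

end Covering

section Barrier

/-- The quadratic form `∑ zᵢ² / aᵢ`. -/
noncomputable def quad (a : Fin d → ℝ) (z : Euc d) : ℝ := ∑ i, (a i)⁻¹ * (z i * z i)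

theorem contDiff_quad (a : Fin d → ℝ) : ContDiff ℝ ∞ (quad a) :=
  ContDiff.sum fun i _ => contDiff_const.mul ((contDiff_coord i).mul (contDiff_coord i))

theorem pd_quad (a : Fin d → ℝ) (i : Fin d) : pd i (quad a) = fun z => 2 * ((a i)⁻¹ * z i) := by
  unfold quad
  rw [pd_sum _ _ fun j _ => contDiff_const.mul ((contDiff_coord j).mul (contDiff_coord j))]
  ext z
  have h : ∀ j, pd i (fun z : Euc d => (a j)⁻¹ * (z j * z j)) z =
      if i = j then 2 * ((a j)⁻¹ * z j) else 0 := by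
    intro j
    rw [pd_const_mul _ _ ((contDiff_coord j).mul (contDiff_coord j)),
      pd_mul _ (contDiff_coord j) (contDiff_coord j), pd_coord]
    split_ifs <;> ring
  simp [h]

theorem quad_nonneg {a : Fin d → ℝ} (ha : ∀ i, 0 < a i) (z : Euc d) : 0 ≤ quad a z :=
  Finset.sum_nonneg fun i _ => mul_nonneg (inv_nonneg.2 (ha i).le) (mul_self_nonneg _)

theorem norm_sq_eq (z : Euc d) : ‖z‖ ^ 2 = ∑ i, z i * z i := by
  have := rho_eq z
  unfold rho at this; linarith

theorem quad_le {a : Fin d → ℝ} {lam : ℝ} (hlam : 0 < lam) (ha : ∀ i, lam ≤ a i) (z : Euc d) :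
    quad a z ≤ lam⁻¹ * ‖z‖ ^ 2 := by
  rw [norm_sq_eq, Finset.mul_sum]
  exact Finset.sum_le_sum fun i _ => mul_le_mul_of_nonneg_right
    (inv_anti₀ hlam (ha i)) (mul_self_nonneg _)

theorem le_quad {a : Fin d → ℝ} {Lam : ℝ} (h0 : ∀ i, 0 < a i) (ha : ∀ i, a i ≤ Lam) (z : Euc d) :
    Lam⁻¹ * ‖z‖ ^ 2 ≤ quad a z := by
  rw [norm_sq_eq, Finset.mul_sum]
  exact Finset.sum_le_sum fun i _ => mul_le_mul_of_nonneg_right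
    (inv_anti₀ (h0 i) (ha i)) (mul_self_nonneg _)

theorem pd_comp_scalar {F : ℝ → ℝ} {F' : ℝ} {u : Euc d → ℝ} {z : Euc d}
    (hF : HasDerivAt F F' (u z)) (hu : DifferentiableAt ℝ u z) (i : Fin d) :
    pd i (fun y => F (u y)) z = F' * pd i u z := by
  have h : HasFDerivAt (fun y => F (u y)) (F' • fderiv ℝ u z) z :=
    hF.comp_hasFDerivAt z hu.hasFDerivAt
  simp only [pd, h.fderiv]; simp

theorem diagOp_comp_quad {a : Fin d → ℝ} (ha : ∀ i, 0 < a i) {F F' F'' : ℝ → ℝ}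
    (hF : ∀ σ, 0 ≤ σ → HasDerivAt F (F' σ) σ) (hF' : ∀ σ, 0 ≤ σ → HasDerivAt F' (F'' σ) σ)
    (z : Euc d) : diagOp a (fun y => F (quad a y)) z =
      4 * F'' (quad a z) * quad a z + 2 * d * F' (quad a z) := by
  have hq := smooth_differentiable (contDiff_quad a)
  have h1 : ∀ i, pd i (fun y => F (quad a y)) =
      fun y => F' (quad a y) * (2 * ((a i)⁻¹ * y i)) := by
    intro i; ext y
    rw [pd_comp_scalar (hF _ (quad_nonneg ha y)) (hq y), pd_quad]
  have hc : ∀ i, ContDiff ℝ ∞ fun y : Euc d => 2 * ((a i)⁻¹ * y i) := fun i =>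
    contDiff_const.mul (contDiff_const.mul (contDiff_coord i))
  have hd1 : DifferentiableAt ℝ (fun y => F' (quad a y)) z :=
    ((hF' _ (quad_nonneg ha z)).differentiableAt).comp z (hq z)
  have h2 : ∀ i, pd i (pd i (fun y => F (quad a y))) z =
      4 * F'' (quad a z) * ((a i)⁻¹ * (a i)⁻¹ * (z i * z i)) + 2 * F' (quad a z) * (a i)⁻¹ := by
    intro i
    rw [h1, pd_mul_apply i hd1 (smooth_differentiable (hc i) z),
      pd_comp_scalar (hF' _ (quad_nonneg ha z)) (hq z), pd_quad,
      pd_const_mul i _ (contDiff_const.mul (contDiff_coord i)),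
      pd_const_mul i _ (contDiff_coord i), pd_coord]
    simp; ring
  simp only [diagOp, h2]
  have h3 : ∀ i, a i * (4 * F'' (quad a z) * ((a i)⁻¹ * (a i)⁻¹ * (z i * z i)) +
      2 * F' (quad a z) * (a i)⁻¹) =
      4 * F'' (quad a z) * ((a i)⁻¹ * (z i * z i)) + 2 * F' (quad a z) := by
    intro i
    have := (ha i).ne'
    field_simp
  have hqz : ∑ i, (a i)⁻¹ * (z i * z i) = quad a z := rfl
  simp only [h3, Finset.sum_add_distrib, ← Finset.mul_sum, Finset.sum_const, Finset.card_univ,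
    Fintype.card_fin, nsmul_eq_mul, hqz]
  ring

theorem log_one_add_sq_le {t : ℝ} (ht : 0 ≤ t) : Real.log (1 + t) ^ 2 ≤ 16 * √t := by
  set v := √(√t)
  have hv : 0 ≤ v := Real.sqrt_nonneg _
  have hv2 : v ^ 2 = √t := Real.sq_sqrt (Real.sqrt_nonneg _)
  have hv4 : v ^ 4 = t := by
    rw [show v ^ 4 = (v ^ 2) ^ 2 by ring, hv2, Real.sq_sqrt ht]
  have h1 : Real.log (1 + t) ≤ 4 * v := by
    calc Real.log (1 + t) ≤ Real.log ((1 + v) ^ 4) := by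
          refine Real.log_le_log (by positivity) ?_
          rw [← hv4]; nlinarith [pow_nonneg hv 2, pow_nonneg hv 3]
      _ = 4 * Real.log (1 + v) := by rw [Real.log_pow]; norm_num
      _ ≤ 4 * v := by
          have := Real.log_le_sub_one_of_pos (show 0 < 1 + v by positivity)
          linarith
  have h0 : 0 ≤ Real.log (1 + t) := Real.log_nonneg (by linarith)
  rw [← hv2]
  nlinarith

theorem setIntegral_inv_norm {R : ℝ} (hR : 0 < R) :
    IntegrableOn (fun z : Euc 2 => ‖z‖⁻¹) (closedBall 0 R) ∧
    ∫ z in closedBall (0 : Euc 2) R, ‖z‖⁻¹ = 2 * volume.real (ball (0 : Euc 2) 1) * R := by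
  let g : ℝ → ℝ := indicator (Iic R) fun s => s⁻¹
  have hg : indicator (closedBall (0 : Euc 2) R) (fun z => ‖z‖⁻¹) = fun z => g ‖z‖ := by
    ext z
    by_cases h : ‖z‖ ≤ R
    · simp [g, h]
    · simp [g, h]
  have hfin : Module.finrank ℝ (Euc 2) = 2 := by simp
  have hs : EqOn (fun y : ℝ => y ^ (Module.finrank ℝ (Euc 2) - 1) • g y)
      (indicator (Ioc 0 R) fun _ => (1 : ℝ)) (Ioi 0) := by
    intro y hy
    have hy0 : y ≠ 0 := (mem_Ioi.1 hy).ne'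
    by_cases h : y ≤ R
    · simp [hfin, g, h, hy0, mem_Ioi.1 hy]
    · simp [g, h]
  constructor
  · rw [← integrable_indicator_iff measurableSet_closedBall, hg, integrable_fun_norm_addHaar,
      integrableOn_congr_fun hs measurableSet_Ioi]
    rw [IntegrableOn, integrable_indicator_iff measurableSet_Ioc]
    exact (integrableOn_const (by simp)).mono_measure Measure.restrict_le_self
  · rw [← integral_indicator measurableSet_closedBall, hg, integral_fun_norm_addHaar,
      setIntegral_congr_fun measurableSet_Ioi hs, hfin, setIntegral_indicator measurableSet_Ioc,
      inter_eq_right.2 Ioc_subset_Ioi_self]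
    simp [hR.le]
    ring

end Barrier

section BarrierExistence

/-- `Φ` is a smooth approximation at scale `δ` of a multiple of the fundamental solution of
`L - κ` at scale `r`, with constant `C`. -/
structure IsBarrier (C : ℝ) (a : Fin d → ℝ) (r κ δ : ℝ) (Φ : Euc d → ℝ) : Prop where
  contDiff : ContDiff ℝ ∞ Φ
  nonneg : ∀ z, 0 ≤ Φ z
  supersolution : ∀ z, 0 ≤ κ * Φ z - diagOp a Φ z
  one_le : ∀ z, ‖z‖ ≤ δ → 1 ≤ C * δ ^ d * (κ * Φ z - diagOp a Φ z)
  le_of_le_norm : ∀ z, r ≤ ‖z‖ → Φ z * r ^ d ≤ C * r ^ 2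
  integral_sq_le : κ ^ 2 * r ^ d * ∫ z in closedBall 0 (8 * r), Φ z ^ 2 ≤ C

theorem quad_shift_bounds {a : Fin d → ℝ} {lam Lam : ℝ} (δ : ℝ) (hlam : 0 < lam)
    (h1 : ∀ i, lam ≤ a i) (h2 : ∀ i, a i ≤ Lam)
    (z : Euc d) :
    0 ≤ quad a z ∧ (‖z‖ ≤ δ → δ ^ 2 + quad a z ≤ δ ^ 2 * (1 + lam⁻¹)) ∧
      Lam⁻¹ * ‖z‖ ^ 2 ≤ δ ^ 2 + quad a z := by
  have h0 : ∀ i, 0 < a i := fun i => hlam.trans_le (h1 i)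
  refine ⟨quad_nonneg h0 z, fun hz => ?_, ?_⟩
  · have h3 := quad_le hlam h1 z
    have h4 : lam⁻¹ * ‖z‖ ^ 2 ≤ lam⁻¹ * δ ^ 2 := by gcongr
    linarith
  · have := le_quad h0 h2 z
    have := sq_nonneg δ
    linarith

theorem exists_barrier_of_three_le (hd : 3 ≤ d) {lam Lam : ℝ} (hlam : 0 < lam) (hLam : 0 < Lam) :
    ∃ C : ℝ, 0 < C ∧ ∀ a : Fin d → ℝ, (∀ i, lam ≤ a i) → (∀ i, a i ≤ Lam) →
      ∀ r : ℝ, 0 < r → ∃ κ : ℝ, 0 ≤ κ ∧ ∀ δ : ℝ, 0 < δ → ∃ Φ : Euc d → ℝ,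
        IsBarrier C a r κ δ Φ := by
  set p : ℝ := ((d : ℝ) - 2) / 2 with hp
  have hd3 : (3 : ℝ) ≤ d := by exact_mod_cast hd
  have hp0 : 0 < p := by rw [hp]; linarith
  have hdp : (d : ℝ) = 2 * p + 2 := by rw [hp]; ring
  set m : ℝ := 1 + lam⁻¹ with hm
  have hm0 : 0 < m := by positivity
  set c : ℝ := 2 * d * p * m ^ (-p - 2) with hc
  have hc0 : 0 < c := by positivity
  refine ⟨c⁻¹ + Lam⁻¹ ^ (-p), by positivity, fun a h1 h2 r hr => ⟨0, le_rfl, fun δ hδ => ?_⟩⟩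
  have h0 : ∀ i, 0 < a i := fun i => hlam.trans_le (h1 i)
  have hX : ∀ σ : ℝ, 0 ≤ σ → 0 < δ ^ 2 + σ := fun σ hσ => by positivity
  have hder : ∀ (e σ : ℝ), 0 ≤ σ →
      HasDerivAt (fun τ => (δ ^ 2 + τ) ^ e) (e * (δ ^ 2 + σ) ^ (e - 1)) σ := by
    intro e σ hσ
    have := ((hasDerivAt_id σ).const_add (δ ^ 2)).rpow_const (p := e) (Or.inl (hX σ hσ).ne')
    simpa using this
  have hL : ∀ z, diagOp a (fun y => (δ ^ 2 + quad a y) ^ (-p)) z =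
      -(2 * d * p * δ ^ 2 * (δ ^ 2 + quad a z) ^ (-p - 2)) := by
    intro z
    have hq := quad_nonneg h0 z
    rw [diagOp_comp_quad h0 (F' := fun σ => -p * (δ ^ 2 + σ) ^ (-p - 1))
      (F'' := fun σ => -p * ((-p - 1) * (δ ^ 2 + σ) ^ (-p - 1 - 1))) (fun σ hσ => hder _ _ hσ)
      (fun σ hσ => (hder (-p - 1) σ hσ).const_mul _)]
    have e1 : (δ ^ 2 + quad a z) ^ (-p - 1) =
        (δ ^ 2 + quad a z) ^ (-p - 2) * (δ ^ 2 + quad a z) := by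
      rw [← Real.rpow_add_one (hX _ hq).ne']; congr 1; ring
    have e2 : -p - 1 - 1 = -p - 2 := by ring
    rw [e1, e2, hdp]
    ring
  refine ⟨fun z => (δ ^ 2 + quad a z) ^ (-p), ⟨?_, ?_, ?_, ?_, ?_, ?_⟩⟩
  · exact (contDiff_const.add (contDiff_quad a)).rpow_const_of_ne
      fun z => (hX _ (quad_nonneg h0 z)).ne'
  · exact fun z => Real.rpow_nonneg (hX _ (quad_nonneg h0 z)).le _
  · intro z
    rw [hL]
    have := Real.rpow_nonneg (hX _ (quad_nonneg h0 z)).le (-p - 2)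
    have : 0 ≤ 2 * d * p * δ ^ 2 * (δ ^ 2 + quad a z) ^ (-p - 2) := by positivity
    linarith
  · intro z hz
    obtain ⟨hq, hb, -⟩ := quad_shift_bounds δ hlam h1 h2 z
    rw [hL]
    have e1 : (δ ^ 2 * m) ^ (-p - 2) ≤ (δ ^ 2 + quad a z) ^ (-p - 2) :=
      Real.rpow_le_rpow_of_nonpos (hX _ hq) (hb hz) (by linarith)
    have e2 : (δ ^ 2 * m) ^ (-p - 2) * δ ^ 2 * δ ^ d = m ^ (-p - 2) := by
      rw [Real.mul_rpow (by positivity) hm0.le]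
      have : (δ ^ 2) ^ (-p - 2) * δ ^ 2 * δ ^ d = 1 := by
        rw [← Real.rpow_natCast δ d, ← Real.rpow_natCast δ 2, ← Real.rpow_mul hδ.le,
          ← Real.rpow_add hδ, ← Real.rpow_add hδ, hdp]
        convert Real.rpow_zero δ using 2
        push_cast; ring
      calc _ = (δ ^ 2) ^ (-p - 2) * δ ^ 2 * δ ^ d * m ^ (-p - 2) := by ring
        _ = _ := by rw [this, one_mul]
    have e3 : c ≤ δ ^ d * (2 * d * p * δ ^ 2 * (δ ^ 2 + quad a z) ^ (-p - 2)) := by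
      calc c = 2 * d * p * ((δ ^ 2 * m) ^ (-p - 2) * δ ^ 2 * δ ^ d) := by rw [e2]
        _ = δ ^ d * (2 * d * p * δ ^ 2 * (δ ^ 2 * m) ^ (-p - 2)) := by ring
        _ ≤ _ := by gcongr
    have e4 : 0 ≤ Lam⁻¹ ^ (-p) := by positivity
    calc 1 = c⁻¹ * c := by field_simp
      _ ≤ (c⁻¹ + Lam⁻¹ ^ (-p)) * (δ ^ d * (2 * d * p * δ ^ 2 * (δ ^ 2 + quad a z) ^ (-p - 2))) := by
        gcongr; linarith
      _ = _ := by ring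
  · intro z hz
    obtain ⟨hq, -, hb⟩ := quad_shift_bounds δ hlam h1 h2 z
    have e0 : Lam⁻¹ * r ^ 2 ≤ δ ^ 2 + quad a z := le_trans (by gcongr) hb
    have e1 : (δ ^ 2 + quad a z) ^ (-p) ≤ (Lam⁻¹ * r ^ 2) ^ (-p) :=
      Real.rpow_le_rpow_of_nonpos (by positivity) e0 (by linarith)
    have e2 : (Lam⁻¹ * r ^ 2) ^ (-p) * r ^ d = Lam⁻¹ ^ (-p) * r ^ 2 := by
      rw [Real.mul_rpow (by positivity) (by positivity), mul_assoc]
      congr 1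
      rw [← Real.rpow_natCast r d, ← Real.rpow_natCast r 2, ← Real.rpow_mul hr.le,
          ← Real.rpow_add hr, hdp]
      congr 1; push_cast; ring
    calc _ ≤ (Lam⁻¹ * r ^ 2) ^ (-p) * r ^ d := by gcongr
      _ = Lam⁻¹ ^ (-p) * r ^ 2 := e2
      _ ≤ _ := by gcongr; linarith [inv_pos.2 hc0]
  · simp; positivity

theorem exists_barrier_of_two {lam Lam : ℝ} (hlam : 0 < lam) (hLam : 0 < Lam) :
    ∃ C : ℝ, 0 < C ∧ ∀ a : Fin 2 → ℝ, (∀ i, lam ≤ a i) → (∀ i, a i ≤ Lam) →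
      ∀ r : ℝ, 0 < r → ∃ κ : ℝ, 0 ≤ κ ∧ ∀ δ : ℝ, 0 < δ → ∃ Φ : Euc 2 → ℝ,
        IsBarrier C a r κ δ Φ := by
  set m : ℝ := 1 + lam⁻¹ with hm
  have hm0 : 0 < m := by positivity
  set V := volume.real (ball (0 : Euc 2) 1) with hV
  have hV0 : 0 < V := volume_real_ball_pos
  refine ⟨m ^ 2 + Lam + 16 * 16 * √Lam * (2 * V * 8), by positivity,
    fun a h1 h2 r hr => ⟨4 / r ^ 2, by positivity, fun δ hδ => ?_⟩⟩
  have h0 : ∀ i, 0 < a i := fun i => hlam.trans_le (h1 i)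
  have hX : ∀ σ : ℝ, 0 ≤ σ → 0 < δ ^ 2 + σ := fun σ hσ => by positivity
  have hY : ∀ σ : ℝ, 0 ≤ σ → 0 < δ ^ 2 + r ^ 2 + σ := fun σ hσ => by positivity
  have hlog : ∀ A σ : ℝ, 0 < A + σ → HasDerivAt (fun τ => Real.log (A + τ)) ((A + σ)⁻¹) σ := by
    intro A σ h
    have := ((hasDerivAt_id σ).const_add A).log h.ne'
    simpa using this
  have hinv : ∀ A σ : ℝ, 0 < A + σ → HasDerivAt (fun τ => (A + τ)⁻¹) (-((A + σ) ^ 2)⁻¹) σ := by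
    intro A σ h
    have := ((hasDerivAt_id σ).const_add A).fun_inv h.ne'
    simpa [neg_div] using this
  let Φ : Euc 2 → ℝ := fun z => Real.log (δ ^ 2 + r ^ 2 + quad a z) - Real.log (δ ^ 2 + quad a z)
  have hΦ : ∀ z, Φ z = Real.log (1 + r ^ 2 / (δ ^ 2 + quad a z)) := by
    intro z
    have hx := hX _ (quad_nonneg h0 z)
    have hy := hY _ (quad_nonneg h0 z)
    change Real.log (δ ^ 2 + r ^ 2 + quad a z) - Real.log (δ ^ 2 + quad a z) = _
    rw [← Real.log_div hy.ne' hx.ne']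
    congr 1; field_simp; ring
  have hL : ∀ z, diagOp a Φ z = 4 * (δ ^ 2 + r ^ 2) / (δ ^ 2 + r ^ 2 + quad a z) ^ 2
      - 4 * δ ^ 2 / (δ ^ 2 + quad a z) ^ 2 := by
    intro z
    have hx := hX _ (quad_nonneg h0 z)
    have hy := hY _ (quad_nonneg h0 z)
    rw [diagOp_comp_quad h0
      (F := fun σ => Real.log (δ ^ 2 + r ^ 2 + σ) - Real.log (δ ^ 2 + σ))
      (F' := fun σ => (δ ^ 2 + r ^ 2 + σ)⁻¹ - (δ ^ 2 + σ)⁻¹)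
      (F'' := fun σ => -((δ ^ 2 + r ^ 2 + σ) ^ 2)⁻¹ - -((δ ^ 2 + σ) ^ 2)⁻¹)
      (fun σ hσ => (hlog _ _ (hY σ hσ)).sub (hlog _ _ (hX σ hσ)))
      (fun σ hσ => (hinv _ _ (hY σ hσ)).sub (hinv _ _ (hX σ hσ)))]
    field_simp
    push_cast
    ring
  have hsup : ∀ z, 4 * δ ^ 2 / (δ ^ 2 + quad a z) ^ 2 ≤ 4 / r ^ 2 * Φ z - diagOp a Φ z := by
    intro z
    have hq := quad_nonneg h0 z
    have hx := hX _ hq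
    have hy := hY _ hq
    rw [hL]
    have e1 : r ^ 2 / (δ ^ 2 + r ^ 2 + quad a z) ≤ Φ z := by
      have h3 : 0 < 1 + r ^ 2 / (δ ^ 2 + quad a z) := by positivity
      have := Real.one_sub_inv_le_log_of_pos h3
      rw [hΦ]
      refine le_trans (le_of_eq ?_) this
      field_simp; ring
    have e2 : 4 * (δ ^ 2 + r ^ 2) / (δ ^ 2 + r ^ 2 + quad a z) ^ 2 ≤
        4 / r ^ 2 * (r ^ 2 / (δ ^ 2 + r ^ 2 + quad a z)) := by
      rw [div_mul_div_cancel₀ (by positivity), div_le_div_iff₀ (by positivity) hy]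
      nlinarith [mul_nonneg hq hy.le]
    have e3 : 4 / r ^ 2 * (r ^ 2 / (δ ^ 2 + r ^ 2 + quad a z)) ≤ 4 / r ^ 2 * Φ z := by gcongr
    linarith
  have hnn : ∀ z, 0 ≤ Φ z := fun z => by
    rw [hΦ]; exact Real.log_nonneg (by have := hX _ (quad_nonneg h0 z); simp; positivity)
  have hCge1 : m ^ 2 ≤ m ^ 2 + Lam + 16 * 16 * √Lam * (2 * V * 8) := by
    have : 0 ≤ 16 * 16 * √Lam * (2 * V * 8) := by positivity
    linarith
  have hsm : ContDiff ℝ ∞ Φ :=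
    ((contDiff_const.add (contDiff_quad a)).log fun z => (hY _ (quad_nonneg h0 z)).ne').sub
      ((contDiff_const.add (contDiff_quad a)).log fun z => (hX _ (quad_nonneg h0 z)).ne')
  refine ⟨Φ, hsm, hnn, fun z => le_trans ?_ (hsup z), fun z hz => ?_, fun z hz => ?_, ?_⟩
  · have := hX _ (quad_nonneg h0 z); positivity
  · obtain ⟨hq, hb, -⟩ := quad_shift_bounds δ hlam h1 h2 z
    have hx := hX _ hq
    have e1 : (δ ^ 2 + quad a z) ^ 2 ≤ (δ ^ 2 * m) ^ 2 := by gcongr; exact hb hz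
    have e2 : 1 ≤ m ^ 2 * δ ^ 2 * (4 * δ ^ 2 / (δ ^ 2 + quad a z) ^ 2) := by
      rw [mul_div_assoc', one_le_div (by positivity)]
      nlinarith [show 0 ≤ (δ ^ 2 * m) ^ 2 by positivity]
    refine e2.trans ?_
    have h3 : 0 ≤ 4 * δ ^ 2 / (δ ^ 2 + quad a z) ^ 2 := by positivity
    gcongr
    exact hsup z
  · obtain ⟨hq, -, hb⟩ := quad_shift_bounds δ hlam h1 h2 z
    have hx := hX _ hq
    have e0 : Lam⁻¹ * r ^ 2 ≤ δ ^ 2 + quad a z := le_trans (by gcongr) hb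
    have e1 : Φ z ≤ Lam := by
      rw [hΦ]
      have h3 : 0 < 1 + r ^ 2 / (δ ^ 2 + quad a z) := by positivity
      have h4 := Real.log_le_sub_one_of_pos h3
      have h5 : r ^ 2 / (δ ^ 2 + quad a z) ≤ Lam := by
        rw [div_le_iff₀ hx]
        calc r ^ 2 = Lam * (Lam⁻¹ * r ^ 2) := by field_simp
          _ ≤ _ := by gcongr
      linarith
    gcongr
    have : 0 ≤ 16 * 16 * √Lam * (2 * V * 8) := by positivity
    nlinarith [sq_nonneg m]
  · obtain ⟨hi, hv⟩ := setIntegral_inv_norm (R := 8 * r) (by positivity)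
    have e1 : ∀ z : Euc 2, z ≠ 0 → Φ z ^ 2 ≤ 16 * (√Lam * r) * ‖z‖⁻¹ := by
      intro z hz0
      obtain ⟨hq, -, hb⟩ := quad_shift_bounds δ hlam h1 h2 z
      have hx := hX _ hq
      have hzn : 0 < ‖z‖ := norm_pos_iff.2 hz0
      rw [hΦ]
      refine (log_one_add_sq_le (by positivity)).trans ?_
      have h5 : √(r ^ 2 / (δ ^ 2 + quad a z)) ≤ √Lam * (r * ‖z‖⁻¹) := by
        rw [← Real.sqrt_sq (show 0 ≤ r * ‖z‖⁻¹ by positivity), ← Real.sqrt_mul hLam.le]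
        refine Real.sqrt_le_sqrt ?_
        rw [div_le_iff₀ hx]
        calc r ^ 2 = Lam * (r * ‖z‖⁻¹) ^ 2 * (Lam⁻¹ * ‖z‖ ^ 2) := by field_simp
          _ ≤ _ := by gcongr
      calc _ ≤ 16 * (√Lam * (r * ‖z‖⁻¹)) := by gcongr
        _ = _ := by ring
    have e2 : ∫ z in closedBall (0 : Euc 2) (8 * r), Φ z ^ 2 ≤
        ∫ z in closedBall (0 : Euc 2) (8 * r), 16 * (√Lam * r) * ‖z‖⁻¹ := by
      refine integral_mono_ae ((hsm.continuous.pow 2).continuousOn.integrableOn_compact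
        (isCompact_closedBall _ _)) (hi.const_mul _) ?_
      have : ∀ᵐ z ∂(volume.restrict (closedBall (0 : Euc 2) (8 * r))), z ≠ 0 := by
        refine ae_restrict_of_ae ?_
        simp [ae_iff]
      filter_upwards [this] with z hz using e1 z hz
    rw [integral_const_mul, hv] at e2
    calc _ ≤ (4 / r ^ 2) ^ 2 * r ^ 2 * (16 * (√Lam * r) * (2 * V * (8 * r))) := by gcongr
      _ = 16 * 16 * √Lam * (2 * V * 8) := by field_simp; ring
      _ ≤ _ := by nlinarith [sq_nonneg m]

theorem exists_barrier (hd : 2 ≤ d) {lam Lam : ℝ} (hlam : 0 < lam) (hLam : 0 < Lam) :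
    ∃ C : ℝ, 0 < C ∧ ∀ a : Fin d → ℝ, (∀ i, lam ≤ a i) → (∀ i, a i ≤ Lam) →
      ∀ r : ℝ, 0 < r → ∃ κ : ℝ, 0 ≤ κ ∧ ∀ δ : ℝ, 0 < δ → ∃ Φ : Euc d → ℝ,
        IsBarrier C a r κ δ Φ := by
  rcases hd.eq_or_lt with rfl | h
  · exact exists_barrier_of_two hlam hLam
  · exact exists_barrier_of_three_le h hlam hLam

end BarrierExistence

section Potential

theorem pd_translate (i : Fin d) (u : Euc d → ℝ) (y : Euc d) :
    pd i (fun x => u (x - y)) = fun x => pd i u (x - y) := by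
  ext x
  simp only [pd]
  rw [fderiv_comp_sub]

theorem diagOp_translate (a : Fin d → ℝ) (u : Euc d → ℝ) (y x : Euc d) :
    diagOp a (fun z => u (z - y)) x = diagOp a u (x - y) := by
  simp only [diagOp, pd_translate]

theorem diagOp_finset_sum (a : Fin d → ℝ) {ι : Type*} (s : Finset ι) {f : ι → Euc d → ℝ}
    (hf : ∀ k ∈ s, ContDiff ℝ ∞ (f k)) (x : Euc d) :
    diagOp a (fun y => ∑ k ∈ s, f k y) x = ∑ k ∈ s, diagOp a (f k) x := by
  have h : ∀ i, pd i (pd i fun y => ∑ k ∈ s, f k y) x = ∑ k ∈ s, pd i (pd i (f k)) x := by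
    intro i
    rw [pd_sum s i hf, pd_sum s i fun k hk => contDiff_pd i (hf k hk)]
  simp only [diagOp, h, Finset.mul_sum]
  exact Finset.sum_comm

theorem exists_modulus {f : Euc d → ℝ} (hf : Continuous f) {η R : ℝ} (hη : 0 < η) (hR : 0 < R) :
    ∃ δ : ℝ, 0 < δ ∧ δ ≤ R ∧ δ ≤ 1 ∧ ∀ x ∈ closedBall (0 : Euc d) 1,
      ∀ z ∈ closedBall (0 : Euc d) 1, dist x z ≤ 2 * δ → |f x - f z| ≤ η := by
  have h := (isCompact_closedBall (0 : Euc d) 1).uniformContinuousOn_of_continuous hf.continuousOn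
  obtain ⟨δ, hδ, hd⟩ := Metric.uniformContinuousOn_iff.1 h η hη
  refine ⟨min (δ / 3) (min R 1), by positivity, (min_le_right _ _).trans (min_le_left _ _),
    (min_le_right _ _).trans (min_le_right _ _), fun x hx z hz hxz => ?_⟩
  refine (hd x hx z hz ?_).le
  have := min_le_left (δ / 3) (min R 1)
  linarith

theorem le_volume_real_ball_inter {y : Euc d} (hy : y ∈ closedBall (0 : Euc d) 1) {δ : ℝ}
    (hδ : 0 < δ) (hδ1 : δ ≤ 1) : (δ / 2) ^ d * volume.real (ball (0 : Euc d) 1) ≤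
      volume.real (ball (0 : Euc d) 1 ∩ ball y δ) := by
  have hy' : ‖y‖ ≤ 1 := by simpa using hy
  have h1 : volume.real (ball ((1 - δ / 2) • y) (δ / 2)) =
      (δ / 2) ^ d * volume.real (ball (0 : Euc d) 1) := by
    rw [measureReal_def, Measure.addHaar_ball_of_pos _ _ (by positivity), ENNReal.toReal_mul,
      ENNReal.toReal_ofReal (by positivity), finrank_euclideanSpace_fin, measureReal_def]
  rw [← h1]
  refine measureReal_mono (subset_inter ?_ ?_)
    (ne_top_of_le_ne_top volume_ball_lt_top.ne (measure_mono inter_subset_left))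
  · refine ball_subset_ball' ?_
    rw [dist_zero_right, norm_smul, Real.norm_of_nonneg (by linarith)]
    nlinarith
  · refine ball_subset_ball' ?_
    rw [dist_eq_norm, show (1 - δ / 2) • y - y = (-(δ / 2)) • y by module, norm_smul, norm_neg,
      Real.norm_of_nonneg (by linarith)]
    nlinarith

theorem sum_setIntegral_le {ι : Type*} (I : Finset ι) {S : ι → Set (Euc d)} {B : Set (Euc d)}
    (hS : ∀ i, MeasurableSet (S i)) {g : Euc d → ℝ} (hg : IntegrableOn g B)
    (hg0 : ∀ x, 0 ≤ g x) {N : ℝ}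
    (hN : ∀ x, ∑ i ∈ I, (S i).indicator (fun _ => (1 : ℝ)) x ≤ N) :
    ∑ i ∈ I, ∫ x in B ∩ S i, g x ≤ N * ∫ x in B, g x := by
  have h1 : ∀ i, ∫ x in B ∩ S i, g x = ∫ x in B, (S i).indicator g x := fun i =>
    (setIntegral_indicator (hS i)).symm
  simp only [h1]
  rw [← integral_finsetSum _ fun i _ => hg.indicator (hS i), ← integral_const_mul]
  refine integral_mono (integrable_finsetSum _ fun i _ => hg.indicator (hS i)) (hg.const_mul N) ?_
  intro x
  have : ∀ i, (S i).indicator g x = (S i).indicator (fun _ => (1 : ℝ)) x * g x := by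
    intro i
    by_cases h : x ∈ S i <;> simp [h]
  simp only [this, ← Finset.sum_mul]
  exact mul_le_mul_of_nonneg_right (hN x) (hg0 x)

theorem sum_indicator_le_card {ι : Type*} (I : Finset ι) (S : ι → Set (Euc d)) (x : Euc d)
    (p : ι → Prop) [DecidablePred p] (hp : ∀ i ∈ I, x ∈ S i → p i) :
    ∑ i ∈ I, (S i).indicator (fun _ => (1 : ℝ)) x ≤ ((I.filter p).card : ℝ) := by
  rw [Finset.card_filter]
  push_cast
  refine Finset.sum_le_sum fun i hi => ?_
  by_cases h : x ∈ S i
  · simp [h, hp i hi h]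
  · simp only [indicator_of_notMem h]; positivity

/-- Approximate solution of `(L - κ) w = h` together with an `L¹`-controlled pointwise majorant,
for a source concentrated in a ball of radius `r`. -/
theorem exists_potential (hd : 2 ≤ d) {lam Lam : ℝ} (hlam : 0 < lam) (hLam : 0 < Lam) :
    ∃ C : ℝ, 0 < C ∧ ∀ a : Fin d → ℝ, (∀ i, lam ≤ a i) → (∀ i, a i ≤ Lam) →
      ∀ r : ℝ, 0 < r → ∃ κ : ℝ, 0 ≤ κ ∧ ∀ h : Euc d → ℝ, Continuous h →
      ∀ y : Euc d, (∀ x, x ∉ closedBall y r → h x = 0) → ∀ ε : ℝ, 0 < ε →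
      ∃ q U : Euc d → ℝ, ContDiff ℝ ∞ q ∧ Continuous U ∧
        (∀ x ∈ closedBall (0 : Euc d) 1,
          |diagOp a (fun z => rho z * q z) x - κ * (rho x * q x) - h x| ≤ ε) ∧
        (∀ x ∈ closedBall (0 : Euc d) 1, |rho x * q x| ≤ U x + ε) ∧
        (∀ x, 0 ≤ U x) ∧
        (∀ x, 3 * r ≤ dist x y → U x * r ^ d ≤ C * r ^ 2 * ∫ x in ball (0 : Euc d) 1, |h x|) ∧
        κ ^ 2 * r ^ d * ∫ x in closedBall y (5 * r), U x ^ 2 ≤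
          C * (∫ x in ball (0 : Euc d) 1, |h x|) ^ 2 := by
  obtain ⟨C, hC, hbar⟩ := exists_barrier hd hlam hLam
  have : NeZero d := ⟨by omega⟩
  set V := volume.real (ball (0 : Euc d) 1) with hV
  have hV0 : 0 < V := volume_real_ball_pos
  set N : ℝ := 117 ^ d with hN
  have hN0 : 0 < N := by positivity
  set C₁ : ℝ := C * 2 ^ d / V with hC₁
  have hC₁0 : 0 < C₁ := by positivity
  refine ⟨C₁ * C * N + C₁ ^ 2 * C * N ^ 2, by positivity, fun a h1 h2 r hr => ?_⟩
  obtain ⟨κ, hκ, hbar⟩ := hbar a h1 h2 r hr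
  refine ⟨κ, hκ, fun h hh y hsupp ε hε => ?_⟩
  set H := ∫ x in ball (0 : Euc d) 1, |h x| with hH
  have hH0 : 0 ≤ H := integral_nonneg fun x => abs_nonneg _
  have hfint : IntegrableOn (fun x => |h x|) (ball (0 : Euc d) 1) := integrableOn_ball hh.abs
  set η : ℝ := min ε (ε * lam / 2) with hη
  have hη0 : 0 < η := by positivity
  obtain ⟨δ, hδ, hδr, hδ1, hmod⟩ := exists_modulus hh hη0 hr
  obtain ⟨Φ, hΦ⟩ := hbar δ hδ
  obtain ⟨q, hq, hqe⟩ := exists_diagOp_sub_near hlam h1 hκ h hh hη0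
  obtain ⟨I, hI, hcov, -, hover⟩ := exists_finset_cover (d := d) (t := fun _ => δ) hδ
    (fun _ => le_rfl) (fun _ => le_rfl) (fun x y => by simp; positivity)
  let c : Euc d → ℝ := fun j => ∫ x in ball (0 : Euc d) 1 ∩ ball j δ, |h x|
  have hc0 : ∀ j, 0 ≤ c j := fun j => integral_nonneg fun x => abs_nonneg _
  have hcsum : ∑ j ∈ I, c j ≤ N * H := by
    refine sum_setIntegral_le I (fun j => measurableSet_ball) hfint (fun x => abs_nonneg _)
      fun x => (sum_indicator_le_card I _ x (fun j => dist x j ≤ 6 * δ) fun j _ hx => ?_).trans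
        (hover x)
    rw [mem_ball] at hx; linarith
  have hcfar : ∀ j, 2 * r < dist j y → c j = 0 := by
    intro j hj
    refine setIntegral_eq_zero_of_forall_eq_zero fun x hx => ?_
    rw [hsupp x, abs_zero]
    intro hxy
    have h3 := mem_ball.1 hx.2
    have h4 := mem_closedBall.1 hxy
    have := dist_triangle_left j y x
    linarith
  have hΦt : ∀ j, ContDiff ℝ ∞ fun x => Φ (x - j) := fun j =>
    hΦ.contDiff.comp (contDiff_id.sub contDiff_const)
  have hterm : ∀ j, ContDiff ℝ ∞ fun x => C₁ * c j * Φ (x - j) := fun j =>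
    contDiff_const.mul (hΦt j)
  let U : Euc d → ℝ := fun x => ∑ j ∈ I, C₁ * c j * Φ (x - j)
  have hU : ContDiff ℝ ∞ U := ContDiff.sum fun j _ => hterm j
  have hU0 : ∀ x, 0 ≤ U x := fun x => Finset.sum_nonneg fun j _ =>
    mul_nonneg (mul_nonneg hC₁0.le (hc0 j)) (hΦ.nonneg _)
  have hLU : ∀ x, κ * U x - diagOp a U x =
      ∑ j ∈ I, C₁ * c j * (κ * Φ (x - j) - diagOp a Φ (x - j)) := by
    intro x
    rw [diagOp_finset_sum a I fun j _ => hterm j, Finset.mul_sum, ← Finset.sum_sub_distrib]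
    refine Finset.sum_congr rfl fun j _ => ?_
    rw [diagOp_const_mul a _ (hΦt j), diagOp_translate]
    ring
  have hsuper : ∀ x ∈ closedBall (0 : Euc d) 1, |h x| - η ≤ κ * U x - diagOp a U x := by
    intro x hx
    rw [hLU]
    have hnn : ∀ j ∈ I, 0 ≤ C₁ * c j * (κ * Φ (x - j) - diagOp a Φ (x - j)) := fun j _ =>
      mul_nonneg (mul_nonneg hC₁0.le (hc0 j)) (hΦ.supersolution _)
    rcases le_or_gt (|h x|) η with hle | hlt
    · exact (by linarith : |h x| - η ≤ 0).trans (Finset.sum_nonneg hnn)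
    obtain ⟨j, hj, hxj⟩ := mem_iUnion₂.1 (hcov hx)
    refine le_trans ?_ (Finset.single_le_sum hnn hj)
    have hone := hΦ.one_le (x - j) (by rw [← dist_eq_norm]; exact (mem_ball.1 hxj).le)
    have hcj : (|h x| - η) * ((δ / 2) ^ d * V) ≤ c j := by
      calc (|h x| - η) * ((δ / 2) ^ d * V)
          ≤ (|h x| - η) * volume.real (ball (0 : Euc d) 1 ∩ ball j δ) :=
            mul_le_mul_of_nonneg_left (le_volume_real_ball_inter (hI j hj) hδ hδ1) (by linarith)
        _ = ∫ z in ball (0 : Euc d) 1 ∩ ball j δ, (|h x| - η) := by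
            rw [setIntegral_const, smul_eq_mul, mul_comm]
        _ ≤ c j := by
            refine setIntegral_mono_on (integrableOn_const (ne_top_of_le_ne_top
              volume_ball_lt_top.ne (measure_mono inter_subset_left)))
              (hfint.mono_set inter_subset_left)
              (measurableSet_ball.inter measurableSet_ball) fun z hz => ?_
            have h3 := hmod x hx z (ball_subset_closedBall hz.1) (by
              have := dist_triangle_right x z j
              have := mem_ball.1 hxj
              have := mem_ball.1 hz.2
              linarith)
            have := abs_sub_abs_le_abs_sub (h x) (h z)
            linarith
    set K := κ * Φ (x - j) - diagOp a Φ (x - j) with hK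
    have hK0 : 0 ≤ K := hΦ.supersolution _
    calc |h x| - η = (|h x| - η) * 1 := (mul_one _).symm
      _ ≤ (|h x| - η) * (C * δ ^ d * K) := mul_le_mul_of_nonneg_left hone (by linarith)
      _ = C₁ * ((|h x| - η) * ((δ / 2) ^ d * V)) * K := by
          rw [hC₁, div_pow]; field_simp
      _ ≤ C₁ * c j * K := by gcongr
  have hw : ContDiff ℝ ∞ fun x => rho x * q x := contDiff_rho.mul hq
  have hηε : η ≤ ε := min_le_left _ _
  have hηl : (2 * η) / lam ≤ ε := by
    rw [div_le_iff₀ hlam]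
    linarith [min_le_right ε (ε * lam / 2)]
  have hcd : ∀ {v : Euc d → ℝ}, ContDiff ℝ ∞ v → ∀ x, ContDiffAt ℝ 2 v x := fun hv x =>
    (contDiff_infty.1 hv 2).contDiffAt
  have hnegw : ContDiff ℝ ∞ fun x => (-1 : ℝ) * (rho x * q x) := contDiff_const.mul hw
  refine ⟨q, U, hq, hU.continuous, fun x hx => (hqe x hx).trans hηε, fun x hx => ?_, hU0,
    fun x hx => ?_, ?_⟩
  · have up := le_of_neg_le_diagOp_sub (w := fun z => rho z * q z - U z) hlam h1 hκ
      (by positivity : 0 < 2 * η) (hw.sub hU).continuous.continuousOn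
      (fun z _ => hcd (hw.sub hU) z)
      (fun z hz => by simp [rho_eq_zero_of_mem_sphere hz, hU0])
      (fun z hz => by
        rw [diagOp_sub_apply a (hcd hw z) (hcd hU z)]
        have h3 := hsuper z (ball_subset_closedBall hz)
        have h4 := abs_le.1 (hqe z (ball_subset_closedBall hz))
        have := neg_abs_le (h z)
        linarith) x hx
    have low := le_of_neg_le_diagOp_sub (w := fun z => (-1 : ℝ) * (rho z * q z) - U z) hlam h1 hκ
      (by positivity : 0 < 2 * η) (hnegw.sub hU).continuous.continuousOn
      (fun z _ => hcd (hnegw.sub hU) z)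
      (fun z hz => by simp [rho_eq_zero_of_mem_sphere hz, hU0])
      (fun z hz => by
        rw [diagOp_sub_apply a (hcd hnegw z) (hcd hU z), diagOp_const_mul a _ hw]
        have h3 := hsuper z (ball_subset_closedBall hz)
        have h4 := abs_le.1 (hqe z (ball_subset_closedBall hz))
        have := le_abs_self (h z)
        linarith) x hx
    exact abs_le.2 ⟨by linarith, by linarith⟩
  · have h3 : ∀ j ∈ I, C₁ * c j * Φ (x - j) * r ^ d ≤ C₁ * c j * (C * r ^ 2) := by
      intro j _
      rcases le_or_gt (dist j y) (2 * r) with hj | hj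
      · have := hΦ.le_of_le_norm (x - j) (by
          rw [← dist_eq_norm]
          have := dist_triangle x j y
          linarith)
        rw [mul_assoc]
        exact mul_le_mul_of_nonneg_left this (mul_nonneg hC₁0.le (hc0 j))
      · simp [hcfar j hj]
    calc U x * r ^ d = ∑ j ∈ I, C₁ * c j * Φ (x - j) * r ^ d := Finset.sum_mul _ _ _
      _ ≤ ∑ j ∈ I, C₁ * c j * (C * r ^ 2) := Finset.sum_le_sum h3
      _ = C₁ * (C * r ^ 2) * ∑ j ∈ I, c j := by
        rw [Finset.mul_sum]; exact Finset.sum_congr rfl fun j _ => by ring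
      _ ≤ C₁ * (C * r ^ 2) * (N * H) := by gcongr
      _ = C₁ * C * N * (r ^ 2 * H) := by ring
      _ ≤ (C₁ * C * N + C₁ ^ 2 * C * N ^ 2) * (r ^ 2 * H) := by
        gcongr
        have : 0 ≤ C₁ ^ 2 * C * N ^ 2 := by positivity
        linarith
      _ = _ := by ring
  · have hcs : ∀ x, U x ^ 2 ≤ C₁ ^ 2 * (N * H) * ∑ j ∈ I, c j * Φ (x - j) ^ 2 := by
      intro x
      have h3 : (∑ j ∈ I, c j * Φ (x - j)) ^ 2 ≤ (∑ j ∈ I, c j) * ∑ j ∈ I, c j * Φ (x - j) ^ 2 :=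
        Finset.sum_sq_le_sum_mul_sum_of_sq_le_mul I (fun j _ => hc0 j)
          (fun j _ => mul_nonneg (hc0 j) (sq_nonneg _)) fun j _ => le_of_eq (by ring)
      have h4 : U x = C₁ * ∑ j ∈ I, c j * Φ (x - j) := by
        rw [Finset.mul_sum]; exact Finset.sum_congr rfl fun j _ => by ring
      have h5 : 0 ≤ ∑ j ∈ I, c j * Φ (x - j) ^ 2 :=
        Finset.sum_nonneg fun j _ => mul_nonneg (hc0 j) (sq_nonneg _)
      calc U x ^ 2 = C₁ ^ 2 * (∑ j ∈ I, c j * Φ (x - j)) ^ 2 := by rw [h4]; ring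
        _ ≤ C₁ ^ 2 * ((N * H) * ∑ j ∈ I, c j * Φ (x - j) ^ 2) := by
          gcongr; exact h3.trans (by gcongr)
        _ = _ := by ring
    have hic : ∀ {g : Euc d → ℝ} {s : Set (Euc d)}, Continuous g → IsCompact s → IntegrableOn g s :=
      fun hg hs => hg.continuousOn.integrableOn_compact hs
    have hj : ∀ j ∈ I, κ ^ 2 * r ^ d * ∫ x in closedBall y (5 * r), c j * Φ (x - j) ^ 2 ≤ c j * C := by
      intro j _
      rcases le_or_gt (dist j y) (2 * r) with hj | hj
      · have hsub : closedBall y (5 * r) ⊆ (fun x => x - j) ⁻¹' closedBall 0 (8 * r) := by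
          intro x hx
          rw [mem_preimage, mem_closedBall, dist_zero_right, ← dist_eq_norm]
          have := dist_triangle_right x j y
          have := mem_closedBall.1 hx
          linarith
        have hpre : (fun x : Euc d => x - j) ⁻¹' closedBall 0 (8 * r) = closedBall j (8 * r) := by
          ext x; simp [dist_eq_norm]
        have h3 : ∫ x in closedBall y (5 * r), Φ (x - j) ^ 2 ≤
            ∫ x in closedBall 0 (8 * r), Φ x ^ 2 := by
          rw [← (measurePreserving_sub_right volume j).setIntegral_preimage_emb
            (MeasurableEquiv.subRight j).measurableEmbedding (fun x => Φ x ^ 2)]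
          refine setIntegral_mono_set ?_ (ae_of_all _ fun x => sq_nonneg _)
            (LE.le.eventuallyLE hsub)
          rw [hpre]
          exact hic ((hΦt j).continuous.pow 2) (isCompact_closedBall _ _)
        rw [integral_const_mul]
        calc _ = c j * (κ ^ 2 * r ^ d * ∫ x in closedBall y (5 * r), Φ (x - j) ^ 2) := by ring
          _ ≤ c j * (κ ^ 2 * r ^ d * ∫ x in closedBall 0 (8 * r), Φ x ^ 2) := by
            have := hc0 j; gcongr
          _ ≤ c j * C := mul_le_mul_of_nonneg_left hΦ.integral_sq_le (hc0 j)
      · simp [hcfar j hj]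
    have hci : ∀ j ∈ I, IntegrableOn (fun x => c j * Φ (x - j) ^ 2) (closedBall y (5 * r)) :=
      fun j _ => hic (continuous_const.mul ((hΦt j).continuous.pow 2)) (isCompact_closedBall _ _)
    have h3 : ∫ x in closedBall y (5 * r), U x ^ 2 ≤
        C₁ ^ 2 * (N * H) * ∑ j ∈ I, ∫ x in closedBall y (5 * r), c j * Φ (x - j) ^ 2 := by
      rw [← integral_finsetSum _ hci, ← integral_const_mul]
      exact integral_mono (hic (hU.continuous.pow 2) (isCompact_closedBall _ _))
        ((integrable_finsetSum _ hci).const_mul _) hcs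
    calc _ ≤ κ ^ 2 * r ^ d * (C₁ ^ 2 * (N * H) *
          ∑ j ∈ I, ∫ x in closedBall y (5 * r), c j * Φ (x - j) ^ 2) := by gcongr
      _ = C₁ ^ 2 * (N * H) *
          ∑ j ∈ I, κ ^ 2 * r ^ d * ∫ x in closedBall y (5 * r), c j * Φ (x - j) ^ 2 := by
        rw [← Finset.mul_sum]; ring
      _ ≤ C₁ ^ 2 * (N * H) * ∑ j ∈ I, c j * C :=
        mul_le_mul_of_nonneg_left (Finset.sum_le_sum hj) (by positivity)
      _ = C₁ ^ 2 * (N * H) * C * ∑ j ∈ I, c j := by rw [← Finset.sum_mul]; ring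
      _ ≤ C₁ ^ 2 * (N * H) * C * (N * H) := by gcongr
      _ = C₁ ^ 2 * C * N ^ 2 * H ^ 2 := by ring
      _ ≤ _ := by
        gcongr
        have : 0 ≤ C₁ * C * N := by positivity
        linarith

end Potential

section Cutoff

theorem pd_dilate (i : Fin d) (u : Euc d → ℝ) (c : ℝ) (y : Euc d) :
    pd i (fun x => u (c • (x - y))) = fun x => c * pd i u (c • (x - y)) := by
  rw [pd_translate i (fun x => u (c • x)) y]
  ext x
  simp only [pd]
  rw [fderiv_comp_smul]
  rfl

theorem pd_pd_dilate (i : Fin d) {u : Euc d → ℝ} (hu : ContDiff ℝ ∞ u) (c : ℝ) (y : Euc d) :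
    pd i (pd i (fun x => u (c • (x - y)))) =
      fun x => c ^ 2 * pd i (pd i u) (c • (x - y)) := by
  have h : ContDiff ℝ ∞ fun x => pd i u (c • (x - y)) :=
    (contDiff_pd i hu).comp ((contDiff_id.sub contDiff_const).const_smul c)
  rw [pd_dilate, pd_const_mul i c h, pd_dilate]
  ext x; ring

theorem pd_eq_zero_of_eqOn {f : Euc d → ℝ} {s : Set (Euc d)} (hs : IsOpen s) {c : ℝ}
    (hf : ∀ x ∈ s, f x = c) (i : Fin d) {x : Euc d} (hx : x ∈ s) : pd i f x = 0 := by
  have : f =ᶠ[𝓝 x] fun _ => c := eventually_of_mem (hs.mem_nhds hx) hf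
  rw [pd_congr i this, pd_const]

theorem exists_bound_pd_pd {f : Euc d → ℝ} (hf : ContDiff ℝ ∞ f) (hc : HasCompactSupport f) :
    ∃ M : ℝ, 0 < M ∧ ∀ i x, |pd i f x| ≤ M ∧ |pd i (pd i f) x| ≤ M := by
  have h1 : ∀ i, ∃ M, ∀ x, ‖pd i f x‖ ≤ M := fun i =>
    HasCompactSupport.exists_bound_of_continuous (hc.fderiv_apply ℝ _) (contDiff_pd i hf).continuous
  have h2 : ∀ i, ∃ M, ∀ x, ‖pd i (pd i f) x‖ ≤ M := fun i =>
    HasCompactSupport.exists_bound_of_continuous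
      (HasCompactSupport.fderiv_apply ℝ (hc.fderiv_apply ℝ _) _)
      (contDiff_pd i (contDiff_pd i hf)).continuous
  choose M₁ hM₁ using h1
  choose M₂ hM₂ using h2
  have p1 : ∀ i, 0 ≤ M₁ i := fun i => (norm_nonneg _).trans (hM₁ i 0)
  have p2 : ∀ i, 0 ≤ M₂ i := fun i => (norm_nonneg _).trans (hM₂ i 0)
  have q1 := fun i => Finset.single_le_sum (f := M₁) (fun j _ => p1 j) (Finset.mem_univ i)
  have q2 := fun i => Finset.single_le_sum (f := M₂) (fun j _ => p2 j) (Finset.mem_univ i)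
  have s1 : 0 ≤ ∑ i, M₁ i := Finset.sum_nonneg fun j _ => p1 j
  have s2 : 0 ≤ ∑ i, M₂ i := Finset.sum_nonneg fun j _ => p2 j
  refine ⟨∑ i, M₁ i + ∑ i, M₂ i + 1, by positivity, fun i x => ⟨?_, ?_⟩⟩
  · have := hM₁ i x
    rw [Real.norm_eq_abs] at this
    linarith [q1 i]
  · have := hM₂ i x
    rw [Real.norm_eq_abs] at this
    linarith [q2 i]

/-- A ball cutoff `η` and an annular cutoff `ζ` dominating the gradient of `η`, at scale `r`. -/
structure IsCutoff (M : ℝ) (y : Euc d) (r : ℝ) (η ζ : Euc d → ℝ) : Prop where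
  smooth : ContDiff ℝ ∞ η
  smooth' : ContDiff ℝ ∞ ζ
  nonneg : ∀ x, 0 ≤ η x
  le_one : ∀ x, η x ≤ 1
  nonneg' : ∀ x, 0 ≤ ζ x
  le_one' : ∀ x, ζ x ≤ 1
  eq_one : ∀ x, dist x y ≤ 4 * r → η x = 1
  eq_zero : ∀ x, 5 * r ≤ dist x y → η x = 0
  eq_zero_inner : ∀ x, dist x y ≤ 3 * r → ζ x = 0
  eq_zero_outer : ∀ x, 6 * r ≤ dist x y → ζ x = 0
  sq_pd_le : ∀ i x, r ^ 2 * pd i η x ^ 2 ≤ M ^ 2 * ζ x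
  abs_pd_pd_le : ∀ i x, r ^ 2 * |pd i (pd i η) x| ≤ M
  abs_pd_pd_le' : ∀ i x, r ^ 2 * |pd i (pd i ζ) x| ≤ M
  pd_pd_eq_zero : ∀ i x, dist x y < 3 * r ∨ 6 * r < dist x y → pd i (pd i η) x = 0
  pd_pd_eq_zero' : ∀ i x, dist x y < 3 * r ∨ 6 * r < dist x y → pd i (pd i ζ) x = 0

theorem exists_cutoff : ∃ M : ℝ, 0 < M ∧ ∀ (y : Euc d) (r : ℝ), 0 < r →
    ∃ η ζ : Euc d → ℝ, IsCutoff M y r η ζ := by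
  let b₃ : ContDiffBump (0 : Euc d) := ⟨3, 4, by norm_num, by norm_num⟩
  let b₄ : ContDiffBump (0 : Euc d) := ⟨4, 5, by norm_num, by norm_num⟩
  let b₅ : ContDiffBump (0 : Euc d) := ⟨5, 6, by norm_num, by norm_num⟩
  let g : Euc d → ℝ := fun x => b₅ x * (1 - b₃ x)
  have hg : ContDiff ℝ ∞ g := b₅.contDiff.mul (contDiff_const.sub b₃.contDiff)
  obtain ⟨M₁, hM₁, hb₁⟩ := exists_bound_pd_pd (f := b₄) b₄.contDiff b₄.hasCompactSupport
  obtain ⟨M₂, hM₂, hb₂⟩ := exists_bound_pd_pd hg b₅.hasCompactSupport.mul_right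
  refine ⟨M₁ + M₂, by positivity, fun y r hr => ?_⟩
  let T : Euc d → Euc d := fun x => r⁻¹ • (x - y)
  have hT : ContDiff ℝ ∞ T := (contDiff_id.sub contDiff_const).const_smul r⁻¹
  have hTd : ∀ x, dist (T x) 0 = dist x y / r := by
    intro x
    simp only [T]
    rw [dist_zero_right, norm_smul, Real.norm_of_nonneg (by positivity), dist_eq_norm]
    field_simp
  have hlo : ∀ x c, dist x y ≤ c * r → dist (T x) 0 ≤ c := fun x c h => by
    rw [hTd]; exact (div_le_iff₀ hr).2 h
  have hhi : ∀ x c, c * r ≤ dist x y → c ≤ dist (T x) 0 := fun x c h => by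
    rw [hTd]; exact (le_div_iff₀ hr).2 h
  have ho1 : IsOpen {x : Euc d | dist x y < 3 * r} := isOpen_lt (by fun_prop) (by fun_prop)
  have ho2 : IsOpen {x : Euc d | 6 * r < dist x y} := isOpen_lt (by fun_prop) (by fun_prop)
  have ho3 : IsOpen {x : Euc d | dist x y < 4 * r} := isOpen_lt (by fun_prop) (by fun_prop)
  have ho4 : IsOpen {x : Euc d | 5 * r < dist x y} := isOpen_lt (by fun_prop) (by fun_prop)
  have e1 : ∀ x, dist x y ≤ 4 * r → b₄ (T x) = 1 := fun x hx =>
    b₄.one_of_mem_closedBall (mem_closedBall.2 (hlo x 4 hx))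
  have e2 : ∀ x, 5 * r ≤ dist x y → b₄ (T x) = 0 := fun x hx => b₄.zero_of_le_dist (hhi x 5 hx)
  have e3 : ∀ x, dist x y ≤ 3 * r → g (T x) = 0 := fun x hx => by
    simp only [g]
    rw [b₃.one_of_mem_closedBall (mem_closedBall.2 (hlo x 3 hx))]; ring
  have e4 : ∀ x, 6 * r ≤ dist x y → g (T x) = 0 := fun x hx => by
    simp only [g]
    rw [b₅.zero_of_le_dist (hhi x 6 hx)]; ring
  have e5 : ∀ x, 4 * r ≤ dist x y → dist x y ≤ 5 * r → g (T x) = 1 := fun x hx hx' => by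
    simp only [g]
    rw [b₃.zero_of_le_dist (hhi x 4 hx), b₅.one_of_mem_closedBall (mem_closedBall.2 (hlo x 5 hx'))]
    ring
  have g0 : ∀ x, 0 ≤ g x := fun x => mul_nonneg b₅.nonneg (by linarith [b₃.le_one (x := x)])
  have g1 : ∀ x, g x ≤ 1 := fun x => by
    have := b₃.nonneg (x := x)
    have := b₃.le_one (x := x)
    have := b₅.nonneg (x := x)
    have := b₅.le_one (x := x)
    simp only [g]
    nlinarith
  have hz : ∀ {f : Euc d → ℝ} {s : Set (Euc d)}, IsOpen s → ∀ {c : ℝ}, (∀ x ∈ s, f x = c) →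
      ∀ i, ∀ x ∈ s, pd i (pd i f) x = 0 := fun hs _ hf i x hx =>
    pd_eq_zero_of_eqOn hs (fun z hz => pd_eq_zero_of_eqOn hs hf i hz) i hx
  refine ⟨fun x => b₄ (T x), fun x => g (T x), b₄.contDiff.comp hT, hg.comp hT,
    fun x => b₄.nonneg, fun x => b₄.le_one, fun x => g0 _, fun x => g1 _, e1, e2, e3, e4,
    fun i x => ?_, fun i x => ?_, fun i x => ?_, fun i x hx => ?_, fun i x hx => ?_⟩
  · by_cases h : 4 * r ≤ dist x y ∧ dist x y ≤ 5 * r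
    · have h3 := (hb₁ i (T x)).1
      rw [e5 x h.1 h.2, pd_dilate i b₄, mul_one, mul_pow, ← mul_assoc, ← mul_pow,
        mul_inv_cancel₀ hr.ne', one_pow, one_mul]
      exact sq_le_sq' (by linarith [(abs_le.1 h3).1]) (by linarith [(abs_le.1 h3).2])
    · have h3 : pd i (fun x => b₄ (T x)) x = 0 := by
        rw [not_and_or, not_le, not_le] at h
        rcases h with h | h
        · exact pd_eq_zero_of_eqOn ho3 (fun z hz => e1 z (le_of_lt hz)) i h
        · exact pd_eq_zero_of_eqOn ho4 (fun z hz => e2 z (le_of_lt hz)) i h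
      rw [h3]
      have := g0 (T x)
      simp only [ne_eq, OfNat.ofNat_ne_zero, not_false_eq_true, zero_pow, mul_zero]
      positivity
  · rw [pd_pd_dilate i b₄.contDiff, abs_mul, abs_of_nonneg (by positivity), ← mul_assoc, ← mul_pow,
      mul_inv_cancel₀ hr.ne', one_pow, one_mul]
    exact (hb₁ i _).2.trans (by linarith)
  · rw [pd_pd_dilate i hg, abs_mul, abs_of_nonneg (by positivity), ← mul_assoc, ← mul_pow,
      mul_inv_cancel₀ hr.ne', one_pow, one_mul]
    exact (hb₂ i _).2.trans (by linarith)
  · rcases hx with hx | hx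
    · exact hz ho1 (fun z hz => e1 z (by linarith [show dist z y < 3 * r from hz])) i x hx
    · exact hz ho2 (fun z hz => e2 z (by linarith [show 6 * r < dist z y from hz])) i x hx
  · rcases hx with hx | hx
    · exact hz ho1 (fun z hz => e3 z (le_of_lt hz)) i x hx
    · exact hz ho2 (fun z hz => e4 z (le_of_lt hz)) i x hx

end Cutoff

section LocalCorrector

theorem diagOp_mul (a : Fin d → ℝ) {u v : Euc d → ℝ} (hu : ContDiff ℝ ∞ u) (hv : ContDiff ℝ ∞ v)
    (x : Euc d) : diagOp a (fun y => u y * v y) x =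
      u x * diagOp a v x + 2 * ∑ i, a i * (pd i u x * pd i v x) + v x * diagOp a u x := by
  have h : ∀ i, pd i (pd i fun y => u y * v y) x =
      u x * pd i (pd i v) x + 2 * (pd i u x * pd i v x) + v x * pd i (pd i u) x := by
    intro i
    rw [pd_mul i hu hv, pd_add i ((contDiff_pd i hu).mul hv) (hu.mul (contDiff_pd i hv)),
      pd_mul i (contDiff_pd i hu) hv, pd_mul i hu (contDiff_pd i hv)]
    ring
  simp only [diagOp, h, Finset.mul_sum, ← Finset.sum_add_distrib]
  exact Finset.sum_congr rfl fun i _ => by ring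

theorem abs_diagOp_le {a : Fin d → ℝ} {Lam : ℝ} (ha : ∀ i, 0 ≤ a i) (ha' : ∀ i, a i ≤ Lam)
    {u : Euc d → ℝ} {x : Euc d} {M : ℝ} (hM : ∀ i, |pd i (pd i u) x| ≤ M) :
    |diagOp a u x| ≤ d * Lam * M := by
  calc |diagOp a u x| ≤ ∑ i, |a i * pd i (pd i u) x| := Finset.abs_sum_le_sum_abs _ _
    _ ≤ ∑ _i : Fin d, Lam * M := by
      refine Finset.sum_le_sum fun i _ => ?_
      rw [abs_mul, abs_of_nonneg (ha i)]
      exact mul_le_mul (ha' i) (hM i) (abs_nonneg _) ((ha i).trans (ha' i))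
    _ = d * Lam * M := by simp [mul_assoc]

theorem sq_neg_sub_sub_sub_le (p q s t : ℝ) : (-p - q - 2 * s - t) ^ 2 ≤
    4 * p ^ 2 + 4 * q ^ 2 + 16 * s ^ 2 + 4 * t ^ 2 := by
  have h1 : (p + q) ^ 2 ≤ 2 * p ^ 2 + 2 * q ^ 2 := by linarith [sq_nonneg (p - q)]
  have h2 : (2 * s + t) ^ 2 ≤ 8 * s ^ 2 + 2 * t ^ 2 := by linarith [sq_nonneg (2 * s - t)]
  linarith [sq_nonneg (p + q - (2 * s + t))]

set_option maxHeartbeats 1000000 in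
/-- A source concentrated in a ball of radius `r` is matched by a smooth function supported in the
enlarged ball, up to an error controlled in `L²` by the `L¹` norm of the source. -/
theorem exists_local_corrector (hd : 2 ≤ d) {lam Lam : ℝ} (hlam : 0 < lam) (hLam : 0 < Lam) :
    ∃ C : ℝ, 0 < C ∧ ∀ a : Fin d → ℝ, (∀ i, lam ≤ a i) → (∀ i, a i ≤ Lam) →
      ∀ r : ℝ, 0 < r → ∀ h : Euc d → ℝ, Continuous h →
      ∀ y : Euc d, (∀ x, x ∉ closedBall y r → h x = 0) →
      ∃ Q : Euc d → ℝ, ContDiff ℝ ∞ Q ∧ (∀ x, 5 * r ≤ dist x y → Q x = 0) ∧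
        r ^ d * ∫ x in ball (0 : Euc d) 1, (h x - diagOp a (fun z => rho z * Q z) x) ^ 2 ≤
          C * (∫ x in ball (0 : Euc d) 1, |h x|) ^ 2 := by
  obtain ⟨C₁, hC₁, hpot⟩ := exists_potential hd hlam hLam
  obtain ⟨M, hM, hcut⟩ := exists_cutoff (d := d)
  set V := volume.real (ball (0 : Euc d) 1) with hV
  have hV0 : 0 < V := volume_real_ball_pos
  set D : ℝ := d * Lam * M with hD
  have hd0 : (0 : ℝ) < d := by exact_mod_cast (by omega : 0 < d)
  have hD0 : 0 < D := by positivity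
  refine ⟨4 * (2 * C₁ + 2 * V + 4 * D * M * (2 * C₁ ^ 2 * (D + 1) * 6 ^ d * V) +
    4 * D ^ 2 * C₁ ^ 2 * 6 ^ d * V), by positivity, fun a h1 h2 r hr h hh y hsupp => ?_⟩
  have ha0 : ∀ i, 0 ≤ a i := fun i => hlam.le.trans (h1 i)
  obtain ⟨κ, hκ, hpot⟩ := hpot a h1 h2 r hr
  set H := ∫ x in ball (0 : Euc d) 1, |h x| with hH
  have hH0 : 0 ≤ H := integral_nonneg fun x => abs_nonneg _
  rcases hH0.eq_or_lt with hHz | hHpos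
  · refine ⟨fun _ => 0, contDiff_const, fun _ _ => rfl, ?_⟩
    have h3 : ∫ x in ball (0 : Euc d) 1, (h x - diagOp a (fun z => rho z * 0) x) ^ 2 = 0 := by
      have h4 := (setIntegral_eq_zero_iff_of_nonneg_ae (ae_of_all _ fun x => abs_nonneg (h x))
        (integrableOn_ball hh.abs)).1 hHz.symm
      refine integral_eq_zero_of_ae ?_
      filter_upwards [h4] with x hx
      have h5 : h x = 0 := by simpa using hx
      simp [h5, diagOp, pd_const]
    rw [h3]
    simp only [mul_zero]
    positivity
  set S : ℝ := C₁ * r ^ 2 * H / r ^ d with hS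
  have hS0 : 0 < S := by positivity
  obtain ⟨ε, hε, hε1, hε2, hε3⟩ : ∃ ε : ℝ, 0 < ε ∧ ε ≤ S ∧ ε * r ^ 2 ≤ S ∧
      ε ^ 2 * (1 + κ ^ 2) * r ^ d ≤ H ^ 2 := by
    set T : ℝ := (1 + κ ^ 2) * r ^ d + 1 with hT
    have hT1 : 1 ≤ T := by
      have : 0 ≤ (1 + κ ^ 2) * r ^ d := by positivity
      linarith
    have hT0 : 0 < T := by linarith
    refine ⟨min (min S (S / r ^ 2)) (H / T), by positivity,
      (min_le_left _ _).trans (min_le_left _ _), ?_, ?_⟩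
    · rw [← le_div_iff₀ (by positivity)]
      exact (min_le_left _ _).trans (min_le_right _ _)
    · calc _ ≤ (H / T) ^ 2 * T := by
            rw [mul_assoc]
            gcongr
            · exact min_le_right _ _
            · linarith
        _ = H ^ 2 / T := by field_simp
        _ ≤ H ^ 2 := div_le_self (by positivity) hT1
  obtain ⟨q, U, hq, hU, heq, hwU, hU0, hUfar, hUint⟩ := hpot h hh y hsupp ε hε
  obtain ⟨η, ζ, hc⟩ := hcut y r hr
  have hw : ContDiff ℝ ∞ fun z => rho z * q z := contDiff_rho.mul hq
  set w : Euc d → ℝ := fun z => rho z * q z with hwdef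
  have hηq := hc.smooth.mul hq
  refine ⟨fun x => η x * q x, hηq, fun x hx => by simp [hc.eq_zero x hx], ?_⟩
  have hk : (fun z => rho z * (η z * q z)) = fun z => η z * w z := by
    ext z; simp only [hwdef]; ring
  rw [hk]
  set W : Euc d → ℝ := fun x => ∑ i, a i * pd i w x ^ 2 with hW
  have hWs : Continuous W := continuous_finsetSum _ fun i _ =>
    continuous_const.mul ((contDiff_pd i hw).continuous.pow 2)
  have hW0 : ∀ x, 0 ≤ W x := fun x => Finset.sum_nonneg fun i _ => mul_nonneg (ha0 i) (sq_nonneg _)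
  let Z : Set (Euc d) := closedBall y (6 * r)
  let Y : Set (Euc d) := closedBall y (5 * r)
  let oneZ : Euc d → ℝ := Z.indicator fun _ => 1
  have hwfar : ∀ x ∈ ball (0 : Euc d) 1, 3 * r ≤ dist x y → |w x| ≤ 2 * S := by
    intro x hx hxy
    have h3 := hwU x (ball_subset_closedBall hx)
    have h4 : U x ≤ S := (le_div_iff₀ (by positivity)).2 (hUfar x hxy)
    linarith
  have hLbd : ∀ φ : Euc d → ℝ, (∀ i x, r ^ 2 * |pd i (pd i φ) x| ≤ M) →
      (∀ i x, dist x y < 3 * r ∨ 6 * r < dist x y → pd i (pd i φ) x = 0) →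
      ∀ x ∈ ball (0 : Euc d) 1, r ^ 2 * |w x * diagOp a φ x| ≤ 2 * S * D * oneZ x := by
    intro φ hφ hφ0 x hx
    by_cases hxy : dist x y < 3 * r ∨ 6 * r < dist x y
    · have : diagOp a φ x = 0 := Finset.sum_eq_zero fun i _ => by rw [hφ0 i x hxy, mul_zero]
      rw [this]
      simp only [mul_zero, abs_zero]
      exact mul_nonneg (by positivity) (indicator_nonneg (fun _ _ => zero_le_one) _)
    · rw [not_or, not_lt, not_lt] at hxy
      have hxZ : oneZ x = 1 := indicator_of_mem (mem_closedBall.2 hxy.2) _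
      have h3 : |diagOp a φ x| ≤ d * Lam * (M / r ^ 2) := abs_diagOp_le ha0 h2 fun i => by
        rw [le_div_iff₀ (by positivity), mul_comm]; exact hφ i x
      rw [hxZ, mul_one, abs_mul]
      calc r ^ 2 * (|w x| * |diagOp a φ x|) ≤ r ^ 2 * (2 * S * (d * Lam * (M / r ^ 2))) := by
            gcongr
            exact hwfar x hx hxy.1
        _ = 2 * S * D := by rw [hD]; field_simp
  have hZint : ∫ x in ball (0 : Euc d) 1, oneZ x ≤ (6 * r) ^ d * V := by
    rw [setIntegral_indicator measurableSet_closedBall, setIntegral_const, smul_eq_mul, mul_one,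
      ← volume_real_closedBall y (by positivity)]
    exact measureReal_mono inter_subset_right measure_closedBall_lt_top.ne
  have hoi : IntegrableOn oneZ (ball (0 : Euc d) 1) :=
    (integrableOn_const volume_ball_lt_top.ne).indicator measurableSet_closedBall
  have hYi : IntegrableOn (Y.indicator fun x => U x ^ 2) (ball (0 : Euc d) 1) :=
    (integrableOn_ball (hU.pow 2)).indicator measurableSet_closedBall
  have hYint : ∫ x in ball (0 : Euc d) 1, Y.indicator (fun x => U x ^ 2) x ≤
      ∫ x in closedBall y (5 * r), U x ^ 2 := by
    rw [setIntegral_indicator measurableSet_closedBall]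
    exact setIntegral_mono_set ((hU.pow 2).continuousOn.integrableOn_compact
      (isCompact_closedBall _ _)) (ae_of_all _ fun x => sq_nonneg _)
      (LE.le.eventuallyLE inter_subset_right)
  have hζWc : Continuous fun x => ζ x * W x := hc.smooth'.continuous.mul hWs
  have hLw := (contDiff_diagOp a hw).continuous
  have hζh : ∀ x, ζ x * h x = 0 := by
    intro x
    by_cases hx : x ∈ closedBall y r
    · rw [hc.eq_zero_inner x (by linarith [mem_closedBall.1 hx]), zero_mul]
    · rw [hsupp x hx, mul_zero]
  have hηh : ∀ x, η x * h x = h x := by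
    intro x
    by_cases hx : x ∈ closedBall y r
    · rw [hc.eq_one x (by linarith [mem_closedBall.1 hx]), one_mul]
    · rw [hsupp x hx, mul_zero]
  have henergy : r ^ 2 * ∫ x in ball (0 : Euc d) 1, ζ x * W x ≤
      2 * S ^ 2 * (D + 1) * ((6 * r) ^ d * V) := by
    have h3 := integral_energy_eq a hq hc.smooth'
    set G : Euc d → ℝ := fun x => 2 * (ζ x * ∑ i, a i * pd i w x ^ 2)
      + 2 * (ζ x * (rho x * q x) * diagOp a w x) - (rho x * q x) ^ 2 * diagOp a ζ x with hG
    have hGc : Continuous G := by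
      refine ((continuous_const.mul hζWc).add (continuous_const.mul
        ((hc.smooth'.continuous.mul hw.continuous).mul hLw))).sub
        ((hw.continuous.pow 2).mul (contDiff_diagOp a hc.smooth').continuous)
    have hpt : ∀ x ∈ ball (0 : Euc d) 1, 2 * r ^ 2 * (ζ x * W x) ≤
        r ^ 2 * G x + 4 * S ^ 2 * (D + 1) * oneZ x := by
      intro x hx
      have hxc := ball_subset_closedBall hx
      have e1 := hLbd ζ hc.abs_pd_pd_le' hc.pd_pd_eq_zero' x hx
      have one0 : 0 ≤ oneZ x := indicator_nonneg (fun _ _ => zero_le_one) _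
      have e2 : r ^ 2 * (w x ^ 2 * diagOp a ζ x) ≤ 4 * S ^ 2 * D * oneZ x := by
        by_cases hxy : dist x y < 3 * r ∨ 6 * r < dist x y
        · have : diagOp a ζ x = 0 :=
            Finset.sum_eq_zero fun i _ => by rw [hc.pd_pd_eq_zero' i x hxy, mul_zero]
          rw [this, mul_zero, mul_zero]
          positivity
        · rw [not_or, not_lt, not_lt] at hxy
          calc r ^ 2 * (w x ^ 2 * diagOp a ζ x) ≤ |r ^ 2 * (w x ^ 2 * diagOp a ζ x)| := le_abs_self _
            _ = |w x| * (r ^ 2 * |w x * diagOp a ζ x|) := by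
              rw [show r ^ 2 * (w x ^ 2 * diagOp a ζ x) = w x * (r ^ 2 * (w x * diagOp a ζ x)) by ring,
                abs_mul (w x), abs_mul (r ^ 2), abs_of_nonneg (sq_nonneg r)]
            _ ≤ 2 * S * (2 * S * D * oneZ x) := by
              gcongr
              exact hwfar x hx hxy.1
            _ = _ := by ring
      have e3 : -(r ^ 2 * (ζ x * w x * diagOp a w x)) ≤ 2 * S ^ 2 * oneZ x := by
        set e := diagOp a w x - κ * w x - h x with he
        have h4 : diagOp a w x = κ * w x + h x + e := by rw [he]; ring
        have h5 : |e| ≤ ε := heq x hxc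
        have h6 : -(ζ x * w x * e) ≤ 2 * S * ε * oneZ x := by
          rcases le_or_gt (dist x y) (3 * r) with hxy | hxy
          · rw [hc.eq_zero_inner x hxy]; simp only [zero_mul, neg_zero]; positivity
          rcases lt_or_ge (6 * r) (dist x y) with hxy' | hxy'
          · rw [hc.eq_zero_outer x hxy'.le]; simp only [zero_mul, neg_zero]; positivity
          have hxZ : oneZ x = 1 := indicator_of_mem (mem_closedBall.2 hxy') _
          rw [hxZ, mul_one]
          calc -(ζ x * w x * e) ≤ |ζ x * w x * e| := neg_le_abs _
            _ = ζ x * (|w x| * |e|) := by rw [mul_assoc, abs_mul (ζ x), abs_mul (w x), abs_of_nonneg (hc.nonneg' x)]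
            _ ≤ 1 * (2 * S * ε) := by
              gcongr
              · exact hc.le_one' x
              · exact hwfar x hx hxy.le
            _ = _ := by ring
        have h7 : 0 ≤ r ^ 2 * (ζ x * (κ * w x ^ 2)) := by
          have := hc.nonneg' x
          positivity
        calc -(r ^ 2 * (ζ x * w x * diagOp a w x))
            = -(r ^ 2 * (ζ x * (κ * w x ^ 2))) - r ^ 2 * (w x * (ζ x * h x)) +
              r ^ 2 * (-(ζ x * w x * e)) := by rw [h4]; ring
          _ ≤ r ^ 2 * (2 * S * ε * oneZ x) := by
            rw [hζh x]
            have := mul_le_mul_of_nonneg_left h6 (by positivity : 0 ≤ r ^ 2)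
            linarith
          _ = 2 * S * oneZ x * (ε * r ^ 2) := by ring
          _ ≤ 2 * S * oneZ x * S := by gcongr
          _ = _ := by ring
      have h8 : G x = 2 * (ζ x * W x) + 2 * (ζ x * w x * diagOp a w x) - w x ^ 2 * diagOp a ζ x :=
        rfl
      rw [h8]
      nlinarith [e2, e3]
    have h4 := setIntegral_mono_on ((integrableOn_ball hζWc).const_mul _)
      (((integrableOn_ball hGc).const_mul _).add (hoi.const_mul _)) measurableSet_ball hpt
    simp only [Pi.add_apply] at h4
    rw [integral_add ((integrableOn_ball hGc).const_mul _) (hoi.const_mul _), integral_const_mul,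
      integral_const_mul, integral_const_mul, h3, mul_zero, zero_add] at h4
    have h5 := mul_le_mul_of_nonneg_left hZint (by positivity : 0 ≤ 4 * S ^ 2 * (D + 1))
    linarith
  have hη2 : ∀ x, η x ^ 2 ≤ 1 := fun x => pow_le_one₀ (hc.nonneg x) (hc.le_one x)
  have hEpt : ∀ x ∈ ball (0 : Euc d) 1, (h x - diagOp a (fun z => η z * w z) x) ^ 2 ≤
      8 * κ ^ 2 * Y.indicator (fun x => U x ^ 2) x + (8 * ε ^ 2 * (1 + κ ^ 2)) +
      16 * D * M / r ^ 2 * (ζ x * W x) + 16 * S ^ 2 * D ^ 2 / r ^ 4 * oneZ x := by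
    intro x hx
    have hxc := ball_subset_closedBall hx
    set e := diagOp a w x - κ * w x - h x with he
    have h4 : diagOp a w x = κ * w x + h x + e := by rw [he]; ring
    have h5 : e ^ 2 ≤ ε ^ 2 := sq_le_sq' (abs_le.1 (heq x hxc)).1 (abs_le.1 (heq x hxc)).2
    set G := ∑ i, a i * (pd i η x * pd i w x) with hG
    have t1 : (κ * (η x * w x)) ^ 2 ≤
        2 * κ ^ 2 * Y.indicator (fun x => U x ^ 2) x + 2 * κ ^ 2 * ε ^ 2 := by
      by_cases hxy : x ∈ Y
      · rw [indicator_of_mem hxy]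
        have h6 : w x ^ 2 ≤ (U x + ε) ^ 2 := sq_le_sq' (by linarith [(abs_le.1 (hwU x hxc)).1])
          (abs_le.1 (hwU x hxc)).2
        have h7 : w x ^ 2 ≤ 2 * U x ^ 2 + 2 * ε ^ 2 := by nlinarith [sq_nonneg (U x - ε)]
        calc (κ * (η x * w x)) ^ 2 = κ ^ 2 * (η x ^ 2 * w x ^ 2) := by ring
          _ ≤ κ ^ 2 * (1 * (2 * U x ^ 2 + 2 * ε ^ 2)) := by gcongr; exact hη2 x
          _ = _ := by ring
      · rw [indicator_of_notMem hxy, hc.eq_zero x (by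
          rw [mem_closedBall, not_le] at hxy; exact hxy.le)]
        simp only [zero_mul, mul_zero, ne_eq, OfNat.ofNat_ne_zero, not_false_eq_true, zero_pow]
        positivity
    have t2 : (η x * e) ^ 2 ≤ ε ^ 2 := by
      rw [mul_pow]
      calc _ ≤ 1 * ε ^ 2 := by gcongr; exact hη2 x
        _ = _ := one_mul _
    have t3 : G ^ 2 ≤ D * M / r ^ 2 * (ζ x * W x) := by
      have h6 : G ^ 2 ≤ (∑ i, a i * pd i η x ^ 2) * W x :=
        Finset.sum_sq_le_sum_mul_sum_of_sq_le_mul _ (fun i _ => mul_nonneg (ha0 i) (sq_nonneg _))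
          (fun i _ => mul_nonneg (ha0 i) (sq_nonneg _)) fun i _ => le_of_eq (by ring)
      have h7 : ∑ i, a i * pd i η x ^ 2 ≤ ∑ _i : Fin d, Lam * (M ^ 2 * ζ x / r ^ 2) := by
        refine Finset.sum_le_sum fun i _ => mul_le_mul (h2 i) ?_ (sq_nonneg _) hLam.le
        rw [le_div_iff₀ (by positivity), mul_comm]
        exact hc.sq_pd_le i x
      calc G ^ 2 ≤ (∑ i, a i * pd i η x ^ 2) * W x := h6
        _ ≤ (∑ _i : Fin d, Lam * (M ^ 2 * ζ x / r ^ 2)) * W x :=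
          mul_le_mul_of_nonneg_right h7 (hW0 x)
        _ = _ := by
          rw [Finset.sum_const, Finset.card_univ, Fintype.card_fin, nsmul_eq_mul, hD]; ring
    have t4 : (w x * diagOp a η x) ^ 2 ≤ 4 * S ^ 2 * D ^ 2 / r ^ 4 * oneZ x := by
      have h6 := hLbd η hc.abs_pd_pd_le hc.pd_pd_eq_zero x hx
      have h7 : oneZ x ^ 2 = oneZ x := by
        by_cases hxZ : x ∈ Z <;> simp [oneZ, hxZ]
      have h8 : (r ^ 2 * |w x * diagOp a η x|) ^ 2 ≤ (2 * S * D * oneZ x) ^ 2 := by gcongr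
      rw [mul_pow, sq_abs, mul_pow _ (oneZ x), h7] at h8
      rw [div_mul_eq_mul_div, le_div_iff₀ (by positivity)]
      calc _ = (r ^ 2) ^ 2 * (w x * diagOp a η x) ^ 2 := by ring
        _ ≤ _ := h8
        _ = _ := by ring
    have h9 : h x - diagOp a (fun z => η z * w z) x =
        -(κ * (η x * w x)) - η x * e - 2 * G - w x * diagOp a η x := by
      rw [diagOp_mul a hc.smooth hw x, h4]
      linear_combination -(hηh x)
    rw [h9]
    refine (sq_neg_sub_sub_sub_le _ _ _ _).trans ?_
    have h11 : 0 ≤ ε ^ 2 := sq_nonneg ε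
    calc _ ≤ 4 * (2 * κ ^ 2 * Y.indicator (fun x => U x ^ 2) x + 2 * κ ^ 2 * ε ^ 2) + 4 * ε ^ 2 +
          16 * (D * M / r ^ 2 * (ζ x * W x)) + 4 * (4 * S ^ 2 * D ^ 2 / r ^ 4 * oneZ x) := by
            linarith
      _ ≤ 4 * (2 * κ ^ 2 * Y.indicator (fun x => U x ^ 2) x + 2 * κ ^ 2 * ε ^ 2) + 8 * ε ^ 2 +
          16 * (D * M / r ^ 2 * (ζ x * W x)) + 4 * (4 * S ^ 2 * D ^ 2 / r ^ 4 * oneZ x) := by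
            linarith
      _ = _ := by ring
  have hEc : Continuous fun x => (h x - diagOp a (fun z => η z * w z) x) ^ 2 :=
    (hh.sub (contDiff_diagOp a (hc.smooth.mul hw)).continuous).pow 2
  have i1 := hYi.const_mul (8 * κ ^ 2)
  have i2 : IntegrableOn (fun _ : Euc d => 8 * ε ^ 2 * (1 + κ ^ 2)) (ball (0 : Euc d) 1) :=
    integrableOn_const volume_ball_lt_top.ne
  have i3 := (integrableOn_ball hζWc).const_mul (16 * D * M / r ^ 2)
  have i4 := hoi.const_mul (16 * S ^ 2 * D ^ 2 / r ^ 4)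
  have i12 : IntegrableOn (fun x => 8 * κ ^ 2 * Y.indicator (fun x => U x ^ 2) x +
      8 * ε ^ 2 * (1 + κ ^ 2)) (ball (0 : Euc d) 1) := i1.add i2
  have i123 : IntegrableOn (fun x => 8 * κ ^ 2 * Y.indicator (fun x => U x ^ 2) x +
      8 * ε ^ 2 * (1 + κ ^ 2) + 16 * D * M / r ^ 2 * (ζ x * W x)) (ball (0 : Euc d) 1) := i12.add i3
  have hfin := setIntegral_mono_on (integrableOn_ball hEc) (i123.add i4) measurableSet_ball hEpt
  simp only [Pi.add_apply] at hfin
  rw [integral_add i123 i4, integral_add i12 i3, integral_add i1 i2,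
    setIntegral_const, smul_eq_mul, integral_const_mul, integral_const_mul, integral_const_mul]
    at hfin
  have hSr : S * r ^ d = C₁ * r ^ 2 * H := by rw [hS]; field_simp
  have b1 : r ^ d * (8 * κ ^ 2 * ∫ x in ball (0 : Euc d) 1, Y.indicator (fun x => U x ^ 2) x) ≤
      8 * (C₁ * H ^ 2) := by
    calc _ = 8 * (κ ^ 2 * r ^ d * ∫ x in ball (0 : Euc d) 1, Y.indicator (fun x => U x ^ 2) x) := by
          ring
      _ ≤ 8 * (κ ^ 2 * r ^ d * ∫ x in closedBall y (5 * r), U x ^ 2) := by gcongr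
      _ ≤ _ := by gcongr
  have b2 : r ^ d * (V * (8 * ε ^ 2 * (1 + κ ^ 2))) ≤ 8 * V * H ^ 2 := by
    calc _ = 8 * V * (ε ^ 2 * (1 + κ ^ 2) * r ^ d) := by ring
      _ ≤ _ := by gcongr
  have b3 : r ^ d * (16 * D * M / r ^ 2 * ∫ x in ball (0 : Euc d) 1, ζ x * W x) ≤
      16 * D * M * (2 * C₁ ^ 2 * (D + 1) * 6 ^ d * V) * H ^ 2 := by
    calc _ = 16 * D * M * r ^ d / r ^ 4 * (r ^ 2 * ∫ x in ball (0 : Euc d) 1, ζ x * W x) := by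
          field_simp
      _ ≤ 16 * D * M * r ^ d / r ^ 4 * (2 * S ^ 2 * (D + 1) * ((6 * r) ^ d * V)) := by gcongr
      _ = 16 * D * M * (2 * (D + 1) * 6 ^ d * V) * (S * r ^ d) ^ 2 / r ^ 4 := by
        rw [mul_pow 6 r]; ring
      _ = _ := by rw [hSr]; field_simp
  have b4 : r ^ d * (16 * S ^ 2 * D ^ 2 / r ^ 4 * ∫ x in ball (0 : Euc d) 1, oneZ x) ≤
      16 * D ^ 2 * C₁ ^ 2 * 6 ^ d * V * H ^ 2 := by
    calc _ ≤ r ^ d * (16 * S ^ 2 * D ^ 2 / r ^ 4 * ((6 * r) ^ d * V)) := by gcongr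
      _ = 16 * D ^ 2 * 6 ^ d * V * (S * r ^ d) ^ 2 / r ^ 4 := by
        rw [mul_pow 6 r]; ring
      _ = _ := by rw [hSr]; field_simp
  calc _ ≤ r ^ d * _ := mul_le_mul_of_nonneg_left hfin (by positivity)
    _ ≤ 8 * (C₁ * H ^ 2) + 8 * V * H ^ 2 +
        16 * D * M * (2 * C₁ ^ 2 * (D + 1) * 6 ^ d * V) * H ^ 2 +
        16 * D ^ 2 * C₁ ^ 2 * 6 ^ d * V * H ^ 2 := by
      rw [mul_add, mul_add, mul_add]
      exact add_le_add (add_le_add (add_le_add b1 b2) b3) b4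
    _ = _ := by ring

end LocalCorrector

section Stopping

theorem exists_stopping_radius (hd : 1 ≤ d) : ∃ A : ℝ, 0 < A ∧ ∀ f : Euc d → ℝ, Continuous f →
    ∀ α : ℝ, 0 < α → ∃ (δ R : ℝ) (T : Euc d → ℝ), 0 < δ ∧ (∀ x, δ ≤ T x) ∧ (∀ x, T x ≤ R) ∧
      (∀ x y, |T x - T y| ≤ dist x y / 12) ∧
      (∀ x, ∫ z in ball (0 : Euc d) 1 ∩ ball x (T x), |f z| ≤ α * (2 * T x) ^ d) ∧
      (∀ x ∈ closedBall (0 : Euc d) 1, T x = δ → ∀ z ∈ closedBall (0 : Euc d) 1, dist z x ≤ δ →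
        |f z| ≤ A * α) ∧
      ∀ x, δ < T x → ∃ y s, 0 < s ∧
        α * s ^ d < ∫ z in ball (0 : Euc d) 1 ∩ ball y s, |f z| ∧
        T x < 2 * s ∧ dist x y < 12 * s := by
  set V := volume.real (ball (0 : Euc d) 1) with hV
  have hV0 : 0 < V := volume_real_ball_pos
  refine ⟨1 + 4 ^ d / V, by positivity, fun f hf α hα => ?_⟩
  have hfint : IntegrableOn (fun x => |f x|) (ball (0 : Euc d) 1) := integrableOn_ball hf.abs
  set m : Euc d → ℝ → ℝ := fun y s => ∫ z in ball (0 : Euc d) 1 ∩ ball y s, |f z| with hm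
  set F := ∫ z in ball (0 : Euc d) 1, |f z| with hF
  have hmF : ∀ y s, m y s ≤ F := fun y s => setIntegral_mono_set hfint
    (ae_of_all _ fun x => abs_nonneg _) (LE.le.eventuallyLE inter_subset_left)
  have hmm : ∀ y s s', s ≤ s' → m y s ≤ m y s' := fun y s s' h =>
    setIntegral_mono_set (hfint.mono_set inter_subset_left) (ae_of_all _ fun x => abs_nonneg _)
      (LE.le.eventuallyLE (inter_subset_inter_right _ (ball_subset_ball h)))
  obtain ⟨δ, hδ, -, hδ1, hmod⟩ := exists_modulus hf hα one_pos
  let P : Set (Euc d × ℝ) := {p | δ ≤ p.2 ∧ α * p.2 ^ d < m p.1 p.2}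
  set R : ℝ := max 1 (F / α) with hR
  have hPR : ∀ p ∈ P, p.2 ≤ R := by
    rintro ⟨y, s⟩ ⟨h1, h2⟩
    simp only at h1 h2
    rcases le_or_gt s 1 with hs | hs
    · exact hs.trans (le_max_left _ _)
    · refine le_trans ?_ (le_max_right _ _)
      rw [le_div_iff₀ hα]
      have h3 : s ^ 1 ≤ s ^ d := pow_le_pow_right₀ hs.le hd
      have h4 := hmF y s
      nlinarith
  let S : Euc d → Set ℝ := fun x => insert δ ((fun p : Euc d × ℝ => p.2 - dist x p.1 / 12) '' P)
  have hSR : ∀ x, ∀ b ∈ S x, b ≤ R := by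
    rintro x b (rfl | ⟨p, hp, rfl⟩)
    · exact hδ1.trans (le_max_left _ _)
    · have := hPR p hp
      have : 0 ≤ dist x p.1 := dist_nonneg
      simp only
      linarith
  have hbdd : ∀ x, BddAbove (S x) := fun x => ⟨R, fun b hb => hSR x b hb⟩
  have hne : ∀ x, (S x).Nonempty := fun x => ⟨δ, mem_insert _ _⟩
  let T : Euc d → ℝ := fun x => sSup (S x)
  have hTδ : ∀ x, δ ≤ T x := fun x => le_csSup (hbdd x) (mem_insert _ _)
  have hTP : ∀ x, ∀ p ∈ P, p.2 - dist x p.1 / 12 ≤ T x := fun x p hp =>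
    le_csSup (hbdd x) (mem_insert_of_mem _ ⟨p, hp, rfl⟩)
  have hTlip : ∀ x y, T x ≤ T y + dist x y / 12 := by
    intro x y
    refine csSup_le (hne x) ?_
    rintro b (rfl | ⟨p, hp, rfl⟩)
    · have := hTδ y
      have : 0 ≤ dist x y := dist_nonneg
      linarith
    · have h1 := hTP y p hp
      have h2 := dist_triangle_left y p.1 x
      simp only
      linarith
  have hm2 : ∀ x, m x (2 * T x) ≤ α * (2 * T x) ^ d := by
    intro x
    by_contra! h
    have h1 := hTP x (x, 2 * T x) ⟨by have := hTδ x; simp only; linarith, h⟩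
    simp only [dist_self, zero_div, sub_zero] at h1
    linarith [hTδ x]
  refine ⟨δ, R, T, hδ, hTδ, fun x => csSup_le (hne x) (hSR x), fun x y => ?_, fun x => ?_,
    fun x hx hxT z hz hzx => ?_, fun x hx => ?_⟩
  · have h1 := hTlip x y
    have h2 := hTlip y x
    rw [dist_comm] at h2
    exact abs_le.2 ⟨by linarith, by linarith⟩
  · exact (hmm x _ _ (by linarith [hTδ x])).trans (hm2 x)
  · have h1 : m x δ ≤ α * (2 * δ) ^ d := by
      have := (hmm x δ (2 * δ) (by linarith)).trans (hxT ▸ hm2 x)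
      exact this
    have h2 := le_volume_real_ball_inter hx hδ hδ1
    rcases le_or_gt (|f z|) α with h3 | h3
    · have : 0 ≤ 4 ^ d / V * α := by positivity
      linarith
    have h4 : (|f z| - α) * volume.real (ball (0 : Euc d) 1 ∩ ball x δ) ≤ m x δ := by
      rw [mul_comm, ← smul_eq_mul, ← setIntegral_const]
      refine setIntegral_mono_on (integrableOn_const (ne_top_of_le_ne_top
        volume_ball_lt_top.ne (measure_mono inter_subset_left)))
        (hfint.mono_set inter_subset_left) (measurableSet_ball.inter measurableSet_ball)
        fun y hy => ?_
      have h5 := hmod z hz y (ball_subset_closedBall hy.1) (by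
        have := dist_triangle_right z y x
        have := mem_ball.1 hy.2
        linarith)
      have := abs_sub_abs_le_abs_sub (f z) (f y)
      linarith
    have h5 : (|f z| - α) * ((δ / 2) ^ d * V) ≤ α * (2 * δ) ^ d :=
      ((mul_le_mul_of_nonneg_left h2 (by linarith)).trans h4).trans h1
    have h6 : (2 * δ) ^ d = 4 ^ d * (δ / 2) ^ d := by rw [← mul_pow]; ring
    have h7 : 0 < (δ / 2) ^ d := by positivity
    have h8 : (|f z| - α) * V ≤ α * 4 ^ d := by
      refine le_of_mul_le_mul_right ?_ h7
      rw [h6] at h5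
      linarith
    have h9 : |f z| - α ≤ α * 4 ^ d / V := (le_div_iff₀ hV0).2 h8
    calc |f z| ≤ α + α * 4 ^ d / V := by linarith
      _ = _ := by ring
  · obtain ⟨b, hb, hlt⟩ := exists_lt_of_lt_csSup (hne x)
      (show max δ (T x / 2) < T x from max_lt hx (by linarith [hTδ x]))
    have h1 := (le_max_left _ _).trans_lt hlt
    have h2 := (le_max_right _ _).trans_lt hlt
    rcases hb with rfl | ⟨⟨y, s⟩, hp, rfl⟩
    · exact absurd h1 (lt_irrefl _)
    · simp only at h1 h2
      have h3 : 0 ≤ dist x y := dist_nonneg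
      exact ⟨y, s, hδ.trans_le hp.1, hp.2, by linarith, by linarith⟩

theorem sum_pow_le_of_stopping {g : Euc d → ℝ} (hg : IntegrableOn g (ball (0 : Euc d) 1))
    (hg0 : ∀ x, 0 ≤ g x) {α : ℝ} (hα : 0 < α) (J : Finset (Euc d)) {T s : Euc d → ℝ}
    {y : Euc d → Euc d}
    (hT : ∀ x ∈ J, 0 < T x)
    (hJ : (J : Set (Euc d)).PairwiseDisjoint fun x => closedBall x (T x / 6))
    (hs : ∀ x ∈ J, 0 < s x)
    (hm : ∀ x ∈ J, α * s x ^ d < ∫ z in ball (0 : Euc d) 1 ∩ ball (y x) (s x), g z)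
    (hTs : ∀ x ∈ J, T x < 2 * s x) (hxy : ∀ x ∈ J, dist x (y x) < 12 * s x) :
    ∑ x ∈ J, T x ^ d ≤ 312 ^ d / α * ∫ z in ball (0 : Euc d) 1, g z := by
  classical
  obtain ⟨u, hu, hdisj, hcov⟩ := Vitali.exists_disjoint_subfamily_covering_enlargement_closedBall
    (J : Set (Euc d)) y (fun x => 13 * s x) (∑ x ∈ J, 13 * s x)
    (fun x hx => Finset.single_le_sum (f := fun x => 13 * s x)
      (fun z hz => by have := hs z hz; positivity) hx) 4 (by norm_num)
  choose! b hb hsub using hcov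
  have hufin : u.Finite := J.finite_toSet.subset hu
  let K : Finset (Euc d) := hufin.toFinset
  have hK : ∀ x, x ∈ K ↔ x ∈ u := fun x => hufin.mem_toFinset
  have huJ : ∀ x ∈ K, x ∈ J := fun x hx => hu ((hK x).1 hx)
  have h1 : ∑ x ∈ J, (T x / 6) ^ d = ∑ k ∈ K, ∑ x ∈ J.filter fun x => b x = k, (T x / 6) ^ d :=
    (Finset.sum_fiberwise_of_maps_to (fun x hx => (hK _).2 (hb x hx)) _).symm
  have h2 : ∀ k ∈ K, ∑ x ∈ J.filter fun x => b x = k, (T x / 6) ^ d ≤ (52 * s k) ^ d := by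
    intro k hk
    refine sum_pow_le_of_disjoint_subset (z := y k) _ (fun x => T x / 6) (fun x hx => ?_)
      (hJ.subset fun x hx => ?_) (by have := hs k (huJ k hk); positivity) fun x hx => ?_
    · have := hT x (Finset.mem_filter.1 hx).1
      positivity
    · exact (Finset.mem_filter.1 (Finset.mem_coe.1 hx)).1
    · obtain ⟨hxJ, hbx⟩ := Finset.mem_filter.1 hx
      refine (closedBall_subset_closedBall' ?_).trans ((hsub x hxJ).trans ?_)
      · have := hTs x hxJ
        have := hxy x hxJ
        have := hs x hxJ
        linarith
      · rw [hbx]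
        exact closedBall_subset_closedBall (by linarith)
  have h3 : ∑ k ∈ K, ∫ z in ball (0 : Euc d) 1 ∩ ball (y k) (s k), g z ≤
      1 * ∫ z in ball (0 : Euc d) 1, g z := by
    refine sum_setIntegral_le K (fun k => measurableSet_ball) hg hg0 fun x => ?_
    by_cases hx : ∃ k ∈ K, x ∈ ball (y k) (s k)
    · obtain ⟨k, hk, hxk⟩ := hx
      rw [Finset.sum_eq_single_of_mem k hk]
      · simp [hxk]
      · intro l hl hlk
        refine indicator_of_notMem (fun hxl => ?_) _
        have h4 := hdisj ((hK l).1 hl) ((hK k).1 hk) hlk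
        refine (disjoint_left.1 h4 : ∀ ⦃a⦄, _ → _) (mem_closedBall.2 (?_ : dist x _ ≤ _))
          (mem_closedBall.2 ?_)
        · have := mem_ball.1 hxl
          have := hs l (huJ l hl)
          linarith
        · have := mem_ball.1 hxk
          have := hs k (huJ k hk)
          linarith
    · push Not at hx
      rw [Finset.sum_eq_zero fun k hk => indicator_of_notMem (hx k hk) _]
      exact zero_le_one
  have h4 : α * ∑ x ∈ J, (T x / 6) ^ d ≤ 52 ^ d * ∫ z in ball (0 : Euc d) 1, g z := by
    calc α * ∑ x ∈ J, (T x / 6) ^ d ≤ α * ∑ k ∈ K, (52 * s k) ^ d := by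
          rw [h1]; exact mul_le_mul_of_nonneg_left (Finset.sum_le_sum h2) hα.le
      _ = 52 ^ d * ∑ k ∈ K, α * s k ^ d := by
          rw [Finset.mul_sum, Finset.mul_sum]
          exact Finset.sum_congr rfl fun k _ => by rw [mul_pow]; ring
      _ ≤ 52 ^ d * ∑ k ∈ K, ∫ z in ball (0 : Euc d) 1 ∩ ball (y k) (s k), g z := by
          gcongr with k hk
          exact (hm k (huJ k hk)).le
      _ ≤ _ := by
          rw [one_mul] at h3
          gcongr
  have h5 : ∑ x ∈ J, T x ^ d = 6 ^ d * ∑ x ∈ J, (T x / 6) ^ d := by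
    rw [Finset.mul_sum]
    exact Finset.sum_congr rfl fun x _ => by rw [← mul_pow]; congr 1; ring
  rw [h5, div_mul_eq_mul_div, le_div_iff₀ hα, show (312 : ℝ) = 6 * 52 by norm_num, mul_pow]
  have := mul_le_mul_of_nonneg_left h4 (by positivity : (0 : ℝ) ≤ 6 ^ d)
  linarith

theorem exists_partition (I : Finset (Euc d)) {T : Euc d → ℝ}
    (hcov : closedBall (0 : Euc d) 1 ⊆ ⋃ x ∈ I, ball x (T x)) :
    ∃ χ : Euc d → Euc d → ℝ, (∀ i, Continuous (χ i)) ∧ (∀ i x, 0 ≤ χ i x) ∧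
      (∀ i x, χ i x ≤ 1) ∧ (∀ i x, T i ≤ dist x i → χ i x = 0) ∧
      (∀ x ∈ closedBall (0 : Euc d) 1, ∑ i ∈ I, χ i x = 1) := by
  classical
  let U : Euc d → Set (Euc d) := fun i => if i ∈ I then ball i (T i) else ∅
  have hUo : ∀ i, IsOpen (U i) := fun i => by
    by_cases h : i ∈ I <;> simp [U, h]
  have hUs : ∀ i, U i ⊆ ball i (T i) := fun i => by
    by_cases h : i ∈ I <;> simp [U, h]
  obtain ⟨f, hf⟩ := PartitionOfUnity.exists_isSubordinate (isClosed_closedBall) U hUo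
    (fun x hx => by
      obtain ⟨i, hi, hxi⟩ := mem_iUnion₂.1 (hcov hx)
      exact mem_iUnion.2 ⟨i, by simpa [U, hi] using hxi⟩)
  have hz : ∀ i x, x ∉ U i → f i x = 0 := fun i x hx => by
    by_contra h
    exact hx (hf i (subset_tsupport _ h))
  refine ⟨fun i => f i, fun i => (f i).continuous, fun i x => f.nonneg i x, fun i x => f.le_one i x,
    fun i x hx => hz i x fun h => ?_, fun x hx => ?_⟩
  · have := mem_ball.1 (hUs i h)
    linarith
  · refine (finsum_eq_sum_of_support_subset (fun i => f i x) fun i hi => ?_).symm.trans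
      (f.sum_eq_one hx)
    by_contra h
    exact hi (hz i x (by simp [U, show i ∉ I from h]))

end Stopping

section WeakTypeSmooth

theorem volume_real_lt_abs_le {g : Euc d → ℝ} (hg : Continuous g) {α : ℝ} (hα : 0 < α) :
    volume.real {x ∈ ball (0 : Euc d) 1 | α < |g x|} ≤
      (∫ x in ball (0 : Euc d) 1, g x ^ 2) / α ^ 2 := by
  rw [le_div_iff₀ (by positivity), mul_comm]
  have h1 := mul_meas_ge_le_integral_of_nonneg (μ := volume.restrict (ball (0 : Euc d) 1))
    (f := fun x => g x ^ 2) (ae_of_all _ fun x => sq_nonneg _) (integrableOn_ball (hg.pow 2))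
    (α ^ 2)
  refine le_trans (mul_le_mul_of_nonneg_left ?_ (by positivity)) h1
  rw [measureReal_restrict_apply' measurableSet_ball]
  refine measureReal_mono (fun x hx => ⟨?_, hx.1⟩)
    (ne_top_of_le_ne_top volume_ball_lt_top.ne (measure_mono inter_subset_right))
  have h2 := hx.2
  rw [mem_ofPred_eq, ← sq_abs (g x)]
  gcongr

theorem integral_pd_pd_sq_le {a : Fin d → ℝ} {lam : ℝ} (hlam : 0 < lam) (ha : ∀ i, lam ≤ a i)
    {Q : Euc d → ℝ} (hQ : ContDiff ℝ ∞ Q) (i j : Fin d) :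
    lam ^ 2 * ∫ x in ball (0 : Euc d) 1, pd i (pd j fun y => rho y * Q y) x ^ 2 ≤
      ∫ x in ball (0 : Euc d) 1, diagOp a (fun y => rho y * Q y) x ^ 2 := by
  have ha0 : ∀ i, 0 ≤ a i := fun i => hlam.le.trans (ha i)
  refine le_trans ?_ (integral_hessian_sq_le a ha0 hQ)
  have hv := contDiff_rho.mul hQ
  have hc : ∀ k l, Continuous (pd k (pd l fun y => rho y * Q y)) := fun k l =>
    (contDiff_pd k (contDiff_pd l hv)).continuous
  rw [← integral_const_mul]
  refine setIntegral_mono_on ((integrableOn_ball ((hc i j).pow 2)).const_mul _)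
    (integrableOn_ball (continuous_finsetSum _ fun k _ => continuous_finsetSum _ fun l _ =>
      continuous_const.mul ((hc k l).pow 2))) measurableSet_ball fun x _ => ?_
  have hnn : ∀ k l, 0 ≤ a k * a l * pd k (pd l fun y => rho y * Q y) x ^ 2 := fun k l =>
    mul_nonneg (mul_nonneg (ha0 k) (ha0 l)) (sq_nonneg _)
  calc lam ^ 2 * pd i (pd j fun y => rho y * Q y) x ^ 2
      ≤ a i * a j * pd i (pd j fun y => rho y * Q y) x ^ 2 := by
        rw [sq lam]
        gcongr
        · exact ha0 i
        · exact ha i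
        · exact ha j
    _ ≤ ∑ l, a i * a l * pd i (pd l fun y => rho y * Q y) x ^ 2 :=
        Finset.single_le_sum (f := fun l => a i * a l * pd i (pd l fun y => rho y * Q y) x ^ 2)
          (fun l _ => hnn i l) (Finset.mem_univ j)
    _ ≤ _ := Finset.single_le_sum
        (f := fun k => ∑ l, a k * a l * pd k (pd l fun y => rho y * Q y) x ^ 2)
          (fun k _ => Finset.sum_nonneg fun l _ => hnn k l) (Finset.mem_univ i)

set_option maxHeartbeats 1000000 in
/-- The weak type `(1,1)` Hessian bound for smooth functions of the form `(1 - |x|²) Q`. -/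
theorem weak_type_smooth (hd : 2 ≤ d) {lam Lam : ℝ} (hlam : 0 < lam) (hLam : 0 < Lam) :
    ∃ C : ℝ, 0 < C ∧ ∀ a : Fin d → ℝ, (∀ i, lam ≤ a i) → (∀ i, a i ≤ Lam) →
      ∀ Q : Euc d → ℝ, ContDiff ℝ ∞ Q → ∀ α : ℝ, 0 < α → ∀ i j : Fin d,
        volume.real {x ∈ ball (0 : Euc d) 1 | α < |pd i (pd j fun y => rho y * Q y) x|} ≤
          C / α * ∫ x in ball (0 : Euc d) 1, |diagOp a (fun y => rho y * Q y) x| := by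
  classical
  obtain ⟨CK, hCK, hlocal⟩ := exists_local_corrector hd hlam hLam
  obtain ⟨A, hA, hradius⟩ := exists_stopping_radius (d := d) (by omega)
  set V := volume.real (ball (0 : Euc d) 1) with hV
  have hV0 : 0 < V := volume_real_ball_pos
  set N : ℝ := 117 ^ d with hN
  have hN0 : 0 < N := by positivity
  set C₂ : ℝ := 2 * A + 2 * N * (CK * 4 ^ d * 312 ^ d) with hC₂
  have hC₂0 : 0 < C₂ := by positivity
  refine ⟨C₂ / lam ^ 2 + 6 ^ d * 312 ^ d * V, by positivity, fun a h1 h2 Q hQ α hα i j => ?_⟩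
  have hu : ContDiff ℝ ∞ fun y => rho y * Q y := contDiff_rho.mul hQ
  set f : Euc d → ℝ := diagOp a fun y => rho y * Q y with hfdef
  have hf : Continuous f := (contDiff_diagOp a hu).continuous
  set F := ∫ x in ball (0 : Euc d) 1, |f x| with hF
  have hF0 : 0 ≤ F := integral_nonneg fun x => abs_nonneg _
  have hfint : IntegrableOn (fun x => |f x|) (ball (0 : Euc d) 1) := integrableOn_ball hf.abs
  obtain ⟨δ, R, T, hδ, hTδ, hTR, hTlip, hTm, hTgood, hTbad⟩ := hradius f hf α hα
  have hT0 : ∀ x, 0 < T x := fun x => hδ.trans_le (hTδ x)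
  obtain ⟨I, hIB, hIcov, hIdisj, hIcard⟩ := exists_finset_cover hδ hTδ hTR hTlip
  obtain ⟨χ, hχc, hχ0, hχ1, hχT, hχsum⟩ := exists_partition I hIcov
  set J := I.filter fun x => δ < T x with hJ
  have hJI : ∀ x ∈ J, x ∈ I := fun x hx => (Finset.mem_filter.1 hx).1
  choose! y s hs using hTbad
  have hJsum : ∑ x ∈ J, T x ^ d ≤ 312 ^ d / α * F := by
    have hJT : ∀ x ∈ J, δ < T x := fun x hx => (Finset.mem_filter.1 hx).2
    exact sum_pow_le_of_stopping hfint (fun x => abs_nonneg _) hα J (fun x _ => hT0 x)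
      (hIdisj.subset fun x hx => hJI x hx) (fun x hx => (hs x (hJT x hx)).1)
      (fun x hx => (hs x (hJT x hx)).2.1) (fun x hx => (hs x (hJT x hx)).2.2.1)
      fun x hx => (hs x (hJT x hx)).2.2.2
  have hloc : ∀ k, ∃ q : Euc d → ℝ, ContDiff ℝ ∞ q ∧ (∀ x, 5 * T k ≤ dist x k → q x = 0) ∧
      T k ^ d * ∫ x in ball (0 : Euc d) 1,
        (f x * χ k x - diagOp a (fun z => rho z * q z) x) ^ 2 ≤
          CK * (∫ x in ball (0 : Euc d) 1, |f x * χ k x|) ^ 2 := fun k =>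
    hlocal a h1 h2 (T k) (hT0 k) (fun x => f x * χ k x) (hf.mul (hχc k)) k fun x hx => by
      rw [mem_closedBall, not_le] at hx
      rw [hχT k x hx.le, mul_zero]
  choose q hq hqz hqe using hloc
  have hk : ∀ k, ContDiff ℝ ∞ fun z => rho z * q k z := fun k => contDiff_rho.mul (hq k)
  let e : Euc d → Euc d → ℝ := fun k x => f x * χ k x - diagOp a (fun z => rho z * q k z) x
  have hec : ∀ k, Continuous (e k) := fun k =>
    (hf.mul (hχc k)).sub (contDiff_diagOp a (hk k)).continuous
  have hopen : ∀ k, IsOpen {x : Euc d | 5 * T k < dist x k} := fun k =>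
    isOpen_lt (by fun_prop) (by fun_prop)
  have hkz : ∀ k x, 5 * T k < dist x k → ∀ i j, pd i (pd j fun z => rho z * q k z) x = 0 := by
    intro k x hx i j
    refine pd_eq_zero_of_eqOn (hopen k) (fun z hz => pd_eq_zero_of_eqOn (hopen k)
      (c := 0) (fun w hw => ?_) j hz) i hx
    rw [hqz k w (le_of_lt hw), mul_zero]
  have hez : ∀ k x, 6 * T k < dist x k → e k x = 0 := by
    intro k x hx
    have := hT0 k
    have h3 : diagOp a (fun z => rho z * q k z) x = 0 :=
      Finset.sum_eq_zero fun l _ => by rw [hkz k x (by linarith), mul_zero]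
    simp only [e]
    rw [hχT k x (by linarith), h3, mul_zero, sub_zero]
  have heint : ∀ k, ∫ x in ball (0 : Euc d) 1, e k x ^ 2 ≤ CK * 4 ^ d * α ^ 2 * T k ^ d := by
    intro k
    have hTd : 0 < T k ^ d := pow_pos (hT0 k) d
    have h3 : ∫ x in ball (0 : Euc d) 1, |f x * χ k x| ≤ α * (2 * T k) ^ d := by
      refine le_trans ?_ (hTm k)
      rw [← setIntegral_indicator measurableSet_ball]
      refine setIntegral_mono_on (integrableOn_ball (hf.mul (hχc k)).abs)
        (hfint.indicator measurableSet_ball) measurableSet_ball fun x _ => ?_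
      by_cases hx : x ∈ ball k (T k)
      · rw [indicator_of_mem hx, abs_mul, abs_of_nonneg (hχ0 k x)]
        exact mul_le_of_le_one_right (abs_nonneg _) (hχ1 k x)
      · rw [indicator_of_notMem hx, hχT k x (not_lt.1 fun h => hx (mem_ball.2 h)), mul_zero, abs_zero]
    refine le_of_mul_le_mul_left ((hqe k).trans ?_) hTd
    calc CK * (∫ x in ball (0 : Euc d) 1, |f x * χ k x|) ^ 2 ≤ CK * (α * (2 * T k) ^ d) ^ 2 := by
          gcongr
      _ = T k ^ d * (CK * 4 ^ d * α ^ 2 * T k ^ d) := by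
          have h4d : (4 : ℝ) ^ d = 2 ^ d * 2 ^ d := by rw [← mul_pow]; norm_num
          rw [mul_pow 2 (T k), h4d]; ring
  set Qv : Euc d → ℝ := fun x => Q x - ∑ k ∈ J, q k x with hQv
  have hQvs : ContDiff ℝ ∞ Qv := hQ.sub (ContDiff.sum fun k _ => hq k)
  have hv : (fun z => rho z * Qv z) = fun z => rho z * Q z - ∑ k ∈ J, rho z * q k z := by
    ext z
    simp only [hQv, mul_sub, Finset.mul_sum]
  have hsum : ContDiff ℝ ∞ fun z => ∑ k ∈ J, rho z * q k z := ContDiff.sum fun k _ => hk k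
  have hLv : ∀ x, diagOp a (fun z => rho z * Qv z) x =
      f x - ∑ k ∈ J, diagOp a (fun z => rho z * q k z) x := by
    intro x
    rw [hv, diagOp_sub_apply a (contDiff_infty.1 hu 2).contDiffAt
      (contDiff_infty.1 hsum 2).contDiffAt, diagOp_finset_sum a J fun k _ => hk k]
  have hgood : ∀ x ∈ closedBall (0 : Euc d) 1,
      (f x * (1 - ∑ k ∈ J, χ k x)) ^ 2 ≤ A * α * |f x| := by
    intro x hx
    have h3 : 1 - ∑ k ∈ J, χ k x = ∑ k ∈ I.filter fun x => ¬ δ < T x, χ k x := by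
      rw [← hχsum x hx, ← Finset.sum_filter_add_sum_filter_not I fun x => δ < T x]
      ring
    have h4 : 0 ≤ 1 - ∑ k ∈ J, χ k x := h3 ▸ Finset.sum_nonneg fun k _ => hχ0 k x
    have h5 : 1 - ∑ k ∈ J, χ k x ≤ 1 := by
      have : 0 ≤ ∑ k ∈ J, χ k x := Finset.sum_nonneg fun k _ => hχ0 k x
      linarith
    by_cases h6 : ∃ k ∈ I.filter fun x => ¬ δ < T x, χ k x ≠ 0
    · obtain ⟨k, hkI, hkx⟩ := h6
      obtain ⟨hkI, hkT⟩ := Finset.mem_filter.1 hkI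
      have h7 : T k = δ := le_antisymm (not_lt.1 hkT) (hTδ k)
      have h8 : |f x| ≤ A * α := hTgood k (hIB k hkI) h7 x hx (by
        rw [← h7]
        by_contra! h
        exact hkx (hχT k x h.le))
      rw [mul_pow, ← sq_abs (f x)]
      calc |f x| ^ 2 * (1 - ∑ k ∈ J, χ k x) ^ 2 ≤ |f x| ^ 2 * 1 := by
            gcongr
            exact pow_le_one₀ h4 h5
        _ = |f x| * |f x| := by ring
        _ ≤ A * α * |f x| := by gcongr
    · have h7 : ∀ k ∈ I.filter fun x => ¬ δ < T x, χ k x = 0 := fun k hk => by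
        by_contra h
        exact h6 ⟨k, hk, h⟩
      rw [h3, Finset.sum_eq_zero h7, mul_zero]
      simp only [ne_eq, OfNat.ofNat_ne_zero, not_false_eq_true, zero_pow]
      positivity
  have hesum : ∀ x, (∑ k ∈ J, e k x) ^ 2 ≤ N * ∑ k ∈ J, e k x ^ 2 := by
    intro x
    have h3 : ∑ k ∈ J, e k x = ∑ k ∈ J.filter fun k => dist x k ≤ 6 * T k, e k x := by
      refine (Finset.sum_filter_of_ne fun k _ hk => ?_).symm
      by_contra! h
      exact hk (hez k x h)
    rw [h3]
    refine sq_sum_le_card_mul_sum_sq.trans ?_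
    have h4 : ((J.filter fun k => dist x k ≤ 6 * T k).card : ℝ) ≤ N := by
      refine le_trans ?_ (hIcard x)
      exact_mod_cast Finset.card_le_card (Finset.filter_subset_filter _ (Finset.filter_subset _ _))
    have h5 : ∑ k ∈ J.filter fun k => dist x k ≤ 6 * T k, e k x ^ 2 ≤ ∑ k ∈ J, e k x ^ 2 :=
      Finset.sum_le_sum_of_subset_of_nonneg (Finset.filter_subset _ _) fun k _ _ => sq_nonneg _
    exact mul_le_mul h4 h5 (Finset.sum_nonneg fun k _ => sq_nonneg _) hN0.le
  have hLvint : ∫ x in ball (0 : Euc d) 1, diagOp a (fun z => rho z * Qv z) x ^ 2 ≤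
      C₂ * (α * F) := by
    have i1 : ∀ k ∈ J, IntegrableOn (fun x => e k x ^ 2) (ball (0 : Euc d) 1) := fun k _ =>
      integrableOn_ball ((hec k).pow 2)
    have i2 := (hfint.const_mul (2 * (A * α)))
    have i3 := ((integrable_finsetSum J i1).const_mul (2 * N))
    have h3 := setIntegral_mono_on (μ := volume) (s := ball (0 : Euc d) 1)
      (f := fun x => diagOp a (fun z => rho z * Qv z) x ^ 2)
      (integrableOn_ball ((contDiff_diagOp a (contDiff_rho.mul hQvs)).continuous.pow 2))
      (i2.add i3) measurableSet_ball fun x hx => by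
        have h4 : diagOp a (fun z => rho z * Qv z) x =
            f x * (1 - ∑ k ∈ J, χ k x) + ∑ k ∈ J, e k x := by
          rw [hLv]
          simp only [e, Finset.sum_sub_distrib, ← Finset.mul_sum]
          ring
        rw [h4]
        have h5 := hgood x (ball_subset_closedBall hx)
        have h6 := hesum x
        simp only [Pi.add_apply]
        linarith [add_sq_le (a := f x * (1 - ∑ k ∈ J, χ k x)) (b := ∑ k ∈ J, e k x)]
    simp only [Pi.add_apply] at h3
    rw [integral_add i2 i3, integral_const_mul, integral_const_mul, integral_finsetSum _ i1] at h3
    have h4 : ∑ k ∈ J, ∫ x in ball (0 : Euc d) 1, e k x ^ 2 ≤ CK * 4 ^ d * 312 ^ d * (α * F) := by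
      calc _ ≤ ∑ k ∈ J, CK * 4 ^ d * α ^ 2 * T k ^ d := Finset.sum_le_sum fun k _ => heint k
        _ = CK * 4 ^ d * α ^ 2 * ∑ k ∈ J, T k ^ d := by rw [Finset.mul_sum]
        _ ≤ CK * 4 ^ d * α ^ 2 * (312 ^ d / α * F) := by gcongr
        _ = _ := by field_simp
    have h5 := mul_le_mul_of_nonneg_left h4 (by positivity : 0 ≤ 2 * N)
    calc _ ≤ _ := h3
      _ ≤ 2 * (A * α) * F + 2 * N * (CK * 4 ^ d * 312 ^ d * (α * F)) := by linarith
      _ = _ := by rw [hC₂]; ring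
  have hcheb : volume.real {x ∈ ball (0 : Euc d) 1 |
      α < |pd i (pd j fun y => rho y * Qv y) x|} ≤ C₂ / lam ^ 2 / α * F := by
    have hvs := contDiff_rho.mul hQvs
    refine (volume_real_lt_abs_le (contDiff_pd i (contDiff_pd j hvs)).continuous hα).trans ?_
    have h3 := (integral_pd_pd_sq_le hlam h1 hQvs i j).trans hLvint
    rw [div_le_iff₀ (by positivity)]
    calc _ = (lam ^ 2 * ∫ x in ball (0 : Euc d) 1, pd i (pd j fun y => rho y * Qv y) x ^ 2) /
          lam ^ 2 := by field_simp
      _ ≤ C₂ * (α * F) / lam ^ 2 := by gcongr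
      _ = _ := by field_simp
  have hbad : volume.real (⋃ k ∈ J, closedBall k (6 * T k)) ≤ 6 ^ d * 312 ^ d * V / α * F := by
    calc _ ≤ ∑ k ∈ J, volume.real (closedBall k (6 * T k)) := measureReal_biUnion_finset_le _ _
      _ = ∑ k ∈ J, 6 ^ d * V * T k ^ d := Finset.sum_congr rfl fun k _ => by
          rw [volume_real_closedBall k (by have := hT0 k; positivity), mul_pow]; ring
      _ = 6 ^ d * V * ∑ k ∈ J, T k ^ d := by rw [Finset.mul_sum]
      _ ≤ 6 ^ d * V * (312 ^ d / α * F) := by gcongr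
      _ = _ := by ring
  have hsub : {x ∈ ball (0 : Euc d) 1 | α < |pd i (pd j fun y => rho y * Q y) x|} ⊆
      {x ∈ ball (0 : Euc d) 1 | α < |pd i (pd j fun y => rho y * Qv y) x|} ∪
        ⋃ k ∈ J, closedBall k (6 * T k) := by
    intro x hx
    by_cases hxJ : x ∈ ⋃ k ∈ J, closedBall k (6 * T k)
    · exact Or.inr hxJ
    refine Or.inl ⟨hx.1, ?_⟩
    have h3 : pd i (pd j fun z => rho z * Qv z) x = pd i (pd j fun z => rho z * Q z) x := by
      rw [hv, pd_sub j hu hsum, pd_sub i (contDiff_pd j hu) (contDiff_pd j hsum),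
        pd_sum J j fun k _ => hk k, pd_sum J i fun k _ => contDiff_pd j (hk k)]
      beta_reduce
      rw [Finset.sum_eq_zero, sub_zero]
      intro k hkJ
      refine hkz k x ?_ i j
      have h4 : x ∉ closedBall k (6 * T k) := fun h => hxJ (mem_iUnion₂.2 ⟨k, hkJ, h⟩)
      rw [mem_closedBall, not_le] at h4
      have := hT0 k
      linarith
    rw [h3]
    exact hx.2
  have hfinite : volume ({x ∈ ball (0 : Euc d) 1 | α < |pd i (pd j fun y => rho y * Qv y) x|} ∪
        ⋃ k ∈ J, closedBall k (6 * T k)) ≠ ⊤ := by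
    refine ((measure_union_le _ _).trans_lt (ENNReal.add_lt_top.2 ⟨?_, ?_⟩)).ne
    · exact (measure_mono (sep_subset _ _)).trans_lt volume_ball_lt_top
    · exact (J.finite_toSet.isCompact_biUnion fun k _ => isCompact_closedBall _ _).measure_lt_top
  calc _ ≤ _ := measureReal_mono hsub hfinite
    _ ≤ _ := measureReal_union_le _ _
    _ ≤ C₂ / lam ^ 2 / α * F + 6 ^ d * 312 ^ d * V / α * F := add_le_add hcheb hbad
    _ = _ := by ring

end WeakTypeSmooth

section WeakTypeDiag

theorem integral_mul_pd_pd (i j : Fin d) {g v : Euc d → ℝ} (hg : ContDiff ℝ ∞ g)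
    (hc : HasCompactSupport g) (hv : ∀ x ∈ tsupport g, ContDiffAt ℝ 2 v x) :
    ∫ x, g x * pd i (pd j v) x = ∫ x, pd j (pd i g) x * v x := by
  have hs : tsupport (pd i g) ⊆ tsupport g := tsupport_fderiv_apply_subset ℝ _
  rw [integral_mul_pd i (contDiff_infty.1 hg 1) hc fun x hx => contDiffAt_pd (n := 1) j (hv x hx),
    integral_mul_pd j (contDiff_infty.1 (contDiff_pd i hg) 1) (hc.fderiv_apply ℝ _) fun x hx =>
      (hv x (hs hx)).of_le (by norm_num), neg_neg]

/-- Distributional identification of an `L¹` limit of second derivatives. -/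
theorem ae_eq_pd_pd_of_tendsto (i j : Fin d) {u : Euc d → ℝ} {v : ℕ → Euc d → ℝ}
    (hu : ∀ x ∈ ball (0 : Euc d) 1, ContDiffAt ℝ 2 u x) (hv : ∀ n, ContDiff ℝ ∞ (v n))
    {b : ℕ → ℝ} (hvu : ∀ n, ∀ x ∈ ball (0 : Euc d) 1, |v n x - u x| ≤ b n)
    (hb : Tendsto b atTop (𝓝 0)) {G : Euc d → ℝ} (hG : IntegrableOn G (ball (0 : Euc d) 1))
    (hlim : Tendsto (fun n => ∫ x in ball (0 : Euc d) 1, |pd i (pd j (v n)) x - G x|)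
      atTop (𝓝 0)) :
    ∀ᵐ x, x ∈ ball (0 : Euc d) 1 → pd i (pd j u) x - G x = 0 := by
  have hcu : ContinuousOn (pd i (pd j u)) (ball (0 : Euc d) 1) := fun x hx =>
    (contDiffAt_pd (n := 0) i (contDiffAt_pd (n := 1) j (hu x hx))).continuousAt.continuousWithinAt
  refine isOpen_ball.ae_eq_zero_of_integral_contDiff_smul_eq_zero
    ((hcu.locallyIntegrableOn measurableSet_ball).sub hG.locallyIntegrableOn) fun g hg hc hs => ?_
  simp only [smul_eq_mul]
  have hgz : ∀ x, x ∉ ball (0 : Euc d) 1 → g x = 0 := fun x hx =>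
    image_eq_zero_of_notMem_tsupport fun h => hx (hs h)
  have hw : ∀ n, Continuous (pd i (pd j (v n))) := fun n =>
    (contDiff_pd i (contDiff_pd j (hv n))).continuous
  obtain ⟨M, hM⟩ := hg.continuous.bounded_above_of_compact_support hc
  have hgu : Integrable fun x => g x * pd i (pd j u) x :=
    (continuous_mul_of_tsupport hg.continuous fun x hx =>
      hcu.continuousAt (isOpen_ball.mem_nhds (hs hx))).integrable_of_hasCompactSupport hc.mul_right
  have hgw : ∀ n, Integrable fun x => g x * pd i (pd j (v n)) x := fun n =>
    (hg.continuous.mul (hw n)).integrable_of_hasCompactSupport hc.mul_right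
  have hgG' : IntegrableOn (fun x => g x * G x) (ball (0 : Euc d) 1) :=
    Integrable.bdd_mul hG hg.continuous.aestronglyMeasurable (ae_of_all _ hM)
  have hgG : Integrable fun x => g x * G x := by
    rwa [integrableOn_iff_integrable_of_support_subset] at hgG'
    intro x hx
    by_contra h
    exact hx (by simp [hgz x h])
  have hM0 : 0 ≤ M := (norm_nonneg _).trans (hM 0)
  have l1 : Tendsto (fun n => ∫ x, g x * pd i (pd j (v n)) x) atTop (𝓝 (∫ x, g x * G x)) := by
    rw [tendsto_iff_dist_tendsto_zero]
    refine squeeze_zero (fun _ => dist_nonneg) (fun n => ?_)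
      (by simpa using hlim.const_mul M)
    have hz : ∀ x, x ∉ ball (0 : Euc d) 1 → g x * pd i (pd j (v n)) x - g x * G x = 0 := by
      intro x hx
      simp [hgz x hx]
    rw [Real.dist_eq, ← integral_sub (hgw n) hgG, ← setIntegral_eq_integral_of_forall_compl_eq_zero hz,
      ← integral_const_mul]
    refine (norm_integral_le_integral_norm _).trans
      (setIntegral_mono_on ((hgw n).sub hgG).norm.integrableOn
        (((integrableOn_ball (hw n)).sub hG).norm.const_mul M) measurableSet_ball fun x _ => ?_)
    simp only [Pi.sub_apply, ← mul_sub, norm_mul]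
    exact mul_le_mul_of_nonneg_right (hM x) (norm_nonneg _)
  have l2 : Tendsto (fun n => ∫ x, g x * pd i (pd j (v n)) x) atTop
      (𝓝 (∫ x, g x * pd i (pd j u) x)) := by
    rw [tendsto_iff_dist_tendsto_zero]
    refine squeeze_zero (fun _ => dist_nonneg) (fun n => ?_)
      (by simpa using hb.const_mul (∫ x, |pd j (pd i g) x|))
    have hp : Continuous (pd j (pd i g)) := (contDiff_pd j (contDiff_pd i hg)).continuous
    have hpc : HasCompactSupport (pd j (pd i g)) := (hc.fderiv_apply ℝ _).fderiv_apply ℝ _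
    have hps : tsupport (pd j (pd i g)) ⊆ tsupport g :=
      (tsupport_fderiv_apply_subset ℝ _).trans (tsupport_fderiv_apply_subset ℝ _)
    have hpu : Integrable fun x => pd j (pd i g) x * u x :=
      (continuous_mul_of_tsupport hp fun x hx =>
        (hu x (hs (hps hx))).continuousAt).integrable_of_hasCompactSupport hpc.mul_right
    have hpv : Integrable fun x => pd j (pd i g) x * v n x :=
      (hp.mul (hv n).continuous).integrable_of_hasCompactSupport hpc.mul_right
    rw [integral_mul_pd_pd i j hg hc fun x _ => (contDiff_infty.1 (hv n) 2).contDiffAt,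
      integral_mul_pd_pd i j hg hc fun x hx => hu x (hs hx), Real.dist_eq, ← integral_sub hpv hpu,
      ← integral_mul_const]
    refine (norm_integral_le_integral_norm _).trans
      (integral_mono (hpv.sub hpu).norm
        ((hp.integrable_of_hasCompactSupport hpc).abs.mul_const _) fun x => ?_)
    simp only [Pi.sub_apply, ← mul_sub, norm_mul, Real.norm_eq_abs]
    by_cases hx : x ∈ tsupport (pd j (pd i g))
    · exact mul_le_mul_of_nonneg_left (hvu n x (hs (hps hx))) (abs_nonneg _)
    · simp [image_eq_zero_of_notMem_tsupport hx]
  simp only [mul_sub]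
  rw [integral_sub hgu hgG, tendsto_nhds_unique l1 l2, sub_self]

end WeakTypeDiag

section WeakTypeDiagLimit

theorem eLpNorm_one_eq_ofReal_integral_abs {X : Type*} [MeasurableSpace X] {μ : Measure X}
    {g : X → ℝ} (hg : Integrable g μ) : eLpNorm g 1 μ = ENNReal.ofReal (∫ x, |g x| ∂μ) := by
  rw [eLpNorm_one_eq_lintegral_enorm, ← ofReal_integral_norm_eq_lintegral_enorm hg]
  rfl

/-- Completeness of `L¹`, with an explicit Cauchy rate. -/
theorem exists_tendsto_integral_abs_sub {X : Type*} [MeasurableSpace X] {μ : Measure X}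
    {g : ℕ → X → ℝ} (hg : ∀ n, Integrable (g n) μ) {K : ℝ} (hK : 0 < K)
    (hc : ∀ N n m, N ≤ n → N ≤ m → ∫ x, |g n x - g m x| ∂μ ≤ K * (1 / 2) ^ N) :
    ∃ G : X → ℝ, Integrable G μ ∧ Tendsto (fun n => ∫ x, |g n x - G x| ∂μ) atTop (𝓝 0) := by
  have hs : Summable fun N : ℕ => 2 * K * (1 / 2 : ℝ) ^ N := summable_geometric_two.mul_left _
  obtain ⟨G, hG, hlim⟩ := Lp.cauchy_complete_eLpNorm (μ := μ) (p := 1) le_rfl (f := g)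
    (fun n => memLp_one_iff_integrable.2 (hg n))
    (B := fun N => ENNReal.ofReal (2 * K * (1 / 2 : ℝ) ^ N)) hs.tsum_ofReal_ne_top
    fun N n m hn hm => by
      rw [eLpNorm_one_eq_ofReal_integral_abs ((hg n).sub (hg m))]
      refine (ENNReal.ofReal_lt_ofReal_iff (by positivity)).2 ((hc N n m hn hm).trans_lt ?_)
      have : 0 < K * (1 / 2 : ℝ) ^ N := by positivity
      linarith
  rw [memLp_one_iff_integrable] at hG
  refine ⟨G, hG, ?_⟩
  have h1 := (ENNReal.tendsto_toReal ENNReal.zero_ne_top).comp hlim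
  refine h1.congr fun n => ?_
  simp only [Function.comp]
  rw [eLpNorm_one_eq_ofReal_integral_abs ((hg n).sub hG), ENNReal.toReal_ofReal]
  · rfl
  · exact integral_nonneg fun x => abs_nonneg _

theorem integral_abs_le_of_integral_sq_le {g : Euc d → ℝ} (hg : Continuous g) {t A : ℝ}
    (ht : 0 < t) (h : ∫ x in ball (0 : Euc d) 1, g x ^ 2 ≤ A * t ^ 2) :
    ∫ x in ball (0 : Euc d) 1, |g x| ≤ (volume.real (ball (0 : Euc d) 1) + A) * t := by
  have hg2 : IntegrableOn (fun x => g x ^ 2) (ball (0 : Euc d) 1) := integrableOn_ball (hg.pow 2)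
  have h1 := setIntegral_mono_on (μ := volume) (s := ball (0 : Euc d) 1)
    (integrableOn_ball hg.abs)
    ((integrableOn_ball (continuous_const (y := t))).add
      (hg2.const_mul t⁻¹)) measurableSet_ball fun x _ => by
      have h2 : |g x| * t ≤ t ^ 2 + g x ^ 2 := by
        rw [← sq_abs (g x)]
        nlinarith [sq_nonneg (|g x| - t), sq_nonneg (|g x|), sq_nonneg t]
      simp only [Pi.add_apply]
      rw [← sub_nonneg]
      have : t + t⁻¹ * g x ^ 2 - |g x| = (t ^ 2 + g x ^ 2 - |g x| * t) / t := by
        field_simp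
      rw [this]
      exact div_nonneg (sub_nonneg.2 h2) ht.le
  simp only [Pi.add_apply] at h1
  rw [integral_add (integrableOn_ball continuous_const)
    (hg2.const_mul t⁻¹), integral_const_mul, setIntegral_const,
    smul_eq_mul] at h1
  refine h1.trans ?_
  have h3 : t⁻¹ * ∫ x in ball (0 : Euc d) 1, g x ^ 2 ≤ A * t := by
    rw [inv_mul_le_iff₀ ht]
    linarith
  linarith

theorem tendsto_half_pow : Tendsto (fun n : ℕ => (1 / 2 : ℝ) ^ n) atTop (𝓝 0) :=
  tendsto_pow_atTop_nhds_zero_of_lt_one (by norm_num) (by norm_num)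

/-- The weak type `(1,1)` bound for classical solutions, diagonal coefficients. -/
theorem weak_type_diag (hd : 2 ≤ d) {lam Lam : ℝ} (hlam : 0 < lam) (hLam : 0 < Lam) :
    ∃ C : ℝ, 0 < C ∧ ∀ a : Fin d → ℝ, (∀ i, lam ≤ a i) → (∀ i, a i ≤ Lam) →
      ∀ f : Euc d → ℝ, Continuous f → ∀ u : Euc d → ℝ,
        ContinuousOn u (closedBall (0 : Euc d) 1) →
        (∀ x ∈ ball (0 : Euc d) 1, ContDiffAt ℝ 2 u x) →
        (∀ x ∈ sphere (0 : Euc d) 1, u x = 0) →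
        (∀ x ∈ ball (0 : Euc d) 1, diagOp a u x = f x) → ∀ α : ℝ, 0 < α → ∀ i j : Fin d,
        volume.real {x ∈ ball (0 : Euc d) 1 | α < |pd i (pd j u) x|} ≤
          C / α * ∫ x in ball (0 : Euc d) 1, |f x| := by
  have : NeZero d := ⟨by omega⟩
  obtain ⟨C, hC, hw⟩ := weak_type_smooth hd hlam hLam
  refine ⟨2 * C, by positivity, fun a ha1 ha2 f hf u huc hu2 hub hLu α hα i j => ?_⟩
  set V := volume.real (ball (0 : Euc d) 1) with hV
  have hV0 : 0 ≤ V := measureReal_nonneg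
  set ε : ℕ → ℝ := fun n => (1 / 2 : ℝ) ^ n with hε
  have hε0 : ∀ n, 0 < ε n := fun n => by positivity
  have hεanti : ∀ N n, N ≤ n → ε n ≤ ε N := fun N n h =>
    pow_le_pow_of_le_one (by norm_num) (by norm_num) h
  choose q hq hqf using fun n => exists_diagOp_near hlam ha1 f hf (hε0 n)
  set v : ℕ → Euc d → ℝ := fun n y => rho y * q n y with hv
  have hvs : ∀ n, ContDiff ℝ ∞ (v n) := fun n => contDiff_rho.mul (hq n)
  have hvu : ∀ n, ∀ x ∈ closedBall (0 : Euc d) 1, |v n x - u x| ≤ ε n / lam := fun n =>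
    abs_le_of_abs_diagOp_sub_le (κ := 0) (w := fun x => v n x - u x) hlam ha1 le_rfl (hε0 n)
      ((hvs n).continuous.continuousOn.sub huc)
      (fun x hx => (contDiff_infty.1 (hvs n) 2).contDiffAt.sub (hu2 x hx))
      (fun x hx => by simp [hv, rho_eq_zero_of_mem_sphere hx, hub x hx])
      fun x hx => by
        rw [zero_mul, sub_zero, diagOp_sub_apply a (contDiff_infty.1 (hvs n) 2).contDiffAt
          (hu2 x hx), hLu x hx]
        exact hqf n x (ball_subset_closedBall hx)
  have hgc : ∀ n, Continuous (pd i (pd j (v n))) := fun n =>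
    (contDiff_pd i (contDiff_pd j (hvs n))).continuous
  have hcauchy : ∀ N n m, N ≤ n → N ≤ m →
      ∫ x in ball (0 : Euc d) 1, |pd i (pd j (v n)) x - pd i (pd j (v m)) x| ≤
        (V + 4 * V / lam ^ 2 + 1) * ε N := by
    intro N n m hn hm
    have hsub : (fun y => rho y * (q n y - q m y)) = fun y => v n y - v m y := by
      ext y; simp only [hv]; ring
    have h1 := integral_pd_pd_sq_le hlam ha1 ((hq n).sub (hq m)) i j
    rw [hsub] at h1
    have h2 : ∫ x in ball (0 : Euc d) 1, diagOp a (fun y => v n y - v m y) x ^ 2 ≤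
        V * (2 * ε N) ^ 2 := by
      rw [← smul_eq_mul, hV, ← setIntegral_const]
      refine setIntegral_mono_on (integrableOn_ball
        ((contDiff_diagOp a ((hvs n).sub (hvs m))).continuous.pow 2))
        (integrableOn_ball continuous_const) measurableSet_ball fun x hx => ?_
      have hx' := ball_subset_closedBall hx
      rw [diagOp_sub_apply a (contDiff_infty.1 (hvs n) 2).contDiffAt
        (contDiff_infty.1 (hvs m) 2).contDiffAt]
      refine sq_le_sq' ?_ ?_ <;>
        linarith [abs_le.1 (hqf n x hx'), abs_le.1 (hqf m x hx'), hεanti N n hn, hεanti N m hm]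
    rw [pd_sub j (hvs n) (hvs m), pd_sub i (contDiff_pd j (hvs n)) (contDiff_pd j (hvs m))] at h1
    have h3 := integral_abs_le_of_integral_sq_le (A := 4 * V / lam ^ 2) ((hgc n).sub (hgc m))
      (hε0 N) (by
        have h4 := h1.trans h2
        rw [← le_div_iff₀' (by positivity)] at h4
        refine h4.trans (le_of_eq ?_)
        field_simp
        ring)
    refine h3.trans ?_
    have := hε0 N
    nlinarith
  obtain ⟨G, hG, hlim⟩ := exists_tendsto_integral_abs_sub
    (fun n => integrableOn_ball (hgc n)) (by positivity) hcauchy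
  have hb : Tendsto (fun n => ε n / lam) atTop (𝓝 0) := by
    rw [← zero_div lam]
    exact tendsto_half_pow.div_const lam
  have hae := ae_eq_pd_pd_of_tendsto i j hu2 hvs
    (fun n x hx => hvu n x (ball_subset_closedBall hx)) hb hG hlim
  set F := ∫ x in ball (0 : Euc d) 1, |f x| with hF
  have hbound : ∀ n, volume.real {x ∈ ball (0 : Euc d) 1 | α < |pd i (pd j u) x|} ≤
      C / (α / 2) * (F + V * ε n) +
        (∫ x in ball (0 : Euc d) 1, |pd i (pd j (v n)) x - G x|) / (α / 2) := by
    intro n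
    have h1 : volume.real {x ∈ ball (0 : Euc d) 1 | α < |pd i (pd j u) x|} ≤
        volume.real ({x ∈ ball (0 : Euc d) 1 | α / 2 < |pd i (pd j (v n)) x|} ∪
          ({x | α / 2 ≤ |pd i (pd j (v n)) x - G x|} ∩ ball (0 : Euc d) 1)) := by
      refine ENNReal.toReal_mono ?_ (measure_mono_ae ?_)
      · refine ((measure_mono (union_subset (sep_subset _ _) inter_subset_right)).trans_lt
          volume_ball_lt_top).ne
      · filter_upwards [hae] with x hx hxu
        obtain ⟨hxB, hxu⟩ := hxu
        have h2 := hx hxB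
        by_cases h3 : α / 2 < |pd i (pd j (v n)) x|
        · exact Or.inl ⟨hxB, h3⟩
        · refine Or.inr ⟨?_, hxB⟩
          have h4 : |G x| ≤ |pd i (pd j (v n)) x| + |pd i (pd j (v n)) x - G x| := by
            have := abs_sub (pd i (pd j (v n)) x) (pd i (pd j (v n)) x - G x)
            rwa [sub_sub_cancel] at this
          rw [sub_eq_zero.1 h2] at hxu
          show α / 2 ≤ _
          linarith
    refine h1.trans ((measureReal_union_le _ _).trans (add_le_add ?_ ?_))
    · refine (hw a ha1 ha2 (q n) (hq n) (α / 2) (by positivity) i j).trans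
        (mul_le_mul_of_nonneg_left ?_ (by positivity))
      have h2 := setIntegral_mono_on (μ := volume) (s := ball (0 : Euc d) 1)
        (integrableOn_ball (contDiff_diagOp a (hvs n)).continuous.abs)
        ((integrableOn_ball hf.abs).add (integrableOn_ball (continuous_const (y := ε n))))
        measurableSet_ball fun x hx => by
          have h3 := hqf n x (ball_subset_closedBall hx)
          have h4 := abs_sub_abs_le_abs_sub (diagOp a (fun y => rho y * q n y) x) (f x)
          simp only [Pi.add_apply]
          show |diagOp a (fun y => rho y * q n y) x| ≤ _
          linarith
      simp only [Pi.add_apply] at h2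
      rwa [integral_add (integrableOn_ball hf.abs) (integrableOn_ball continuous_const),
        setIntegral_const, smul_eq_mul] at h2
    · rw [le_div_iff₀ (by positivity), mul_comm]
      have h2 := mul_meas_ge_le_integral_of_nonneg
        (μ := volume.restrict (ball (0 : Euc d) 1))
        (f := fun x => |pd i (pd j (v n)) x - G x|) (ae_of_all _ fun x => abs_nonneg _)
        ((integrableOn_ball (hgc n)).sub hG).abs (α / 2)
      rwa [measureReal_restrict_apply' measurableSet_ball] at h2
  have hfin : Tendsto (fun n => C / (α / 2) * (F + V * ε n) +
      (∫ x in ball (0 : Euc d) 1, |pd i (pd j (v n)) x - G x|) / (α / 2)) atTop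
      (𝓝 (C / (α / 2) * (F + V * 0) + 0 / (α / 2))) :=
    (((tendsto_half_pow.const_mul V).const_add F).const_mul _).add (hlim.div_const _)
  refine (ge_of_tendsto' hfin hbound).trans (le_of_eq ?_)
  field_simp
  ring

end WeakTypeDiagLimit

section Rotation

theorem diagOp_fin_one (a : Fin 1 → ℝ) (u : Euc 1 → ℝ) (x : Euc 1) (i j : Fin 1) :
    diagOp a u x = a i * pd i (pd j u) x := by
  rw [Subsingleton.elim j i, Subsingleton.elim i 0]
  simp [diagOp]

/-- The weak type bound in dimension one is Chebyshev's inequality. -/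
theorem weak_type_diag_one {lam : ℝ} (hlam : 0 < lam) {a : Fin 1 → ℝ} (ha : ∀ i, lam ≤ a i)
    {f u : Euc 1 → ℝ} (hf : Continuous f) (hLu : ∀ x ∈ ball (0 : Euc 1) 1, diagOp a u x = f x)
    {α : ℝ} (hα : 0 < α) (i j : Fin 1) :
    volume.real {x ∈ ball (0 : Euc 1) 1 | α < |pd i (pd j u) x|} ≤
      1 / lam / α * ∫ x in ball (0 : Euc 1) 1, |f x| := by
  have h1 := mul_meas_ge_le_integral_of_nonneg (μ := volume.restrict (ball (0 : Euc 1) 1))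
    (f := fun x => |f x|) (ae_of_all _ fun x => abs_nonneg _) (integrableOn_ball hf.abs)
    (lam * α)
  rw [div_div, one_div_mul_eq_div, le_div_iff₀ (by positivity), mul_comm]
  refine le_trans (mul_le_mul_of_nonneg_left ?_ (by positivity)) h1
  rw [measureReal_restrict_apply' measurableSet_ball]
  refine measureReal_mono (fun x hx => ⟨?_, hx.1⟩)
    (ne_top_of_le_ne_top volume_ball_lt_top.ne (measure_mono inter_subset_right))
  rw [mem_ofPred_eq, ← hLu x hx.1, diagOp_fin_one a u x i j, abs_mul]
  exact mul_le_mul ((ha i).trans (le_abs_self _)) hx.2.le hα.le (abs_nonneg _)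

theorem weak_type_diag_of_pos (hd : 1 ≤ d) {lam Lam : ℝ} (hlam : 0 < lam) (hLam : 0 < Lam) :
    ∃ C : ℝ, 0 < C ∧ ∀ a : Fin d → ℝ, (∀ i, lam ≤ a i) → (∀ i, a i ≤ Lam) →
      ∀ f : Euc d → ℝ, Continuous f → ∀ u : Euc d → ℝ,
        ContinuousOn u (closedBall (0 : Euc d) 1) →
        (∀ x ∈ ball (0 : Euc d) 1, ContDiffAt ℝ 2 u x) →
        (∀ x ∈ sphere (0 : Euc d) 1, u x = 0) →
        (∀ x ∈ ball (0 : Euc d) 1, diagOp a u x = f x) → ∀ α : ℝ, 0 < α → ∀ i j : Fin d,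
        volume.real {x ∈ ball (0 : Euc d) 1 | α < |pd i (pd j u) x|} ≤
          C / α * ∫ x in ball (0 : Euc d) 1, |f x| := by
  obtain rfl | hd := hd.eq_or_lt
  · exact ⟨1 / lam, by positivity, fun a ha _ f hf u _ _ _ hLu α hα i j =>
      weak_type_diag_one hlam ha hf hLu hα i j⟩
  · exact weak_type_diag hd hlam hLam

theorem iteratedFDeriv_two_eq_sum (u : Euc d → ℝ) (x v w : Euc d) :
    iteratedFDeriv ℝ 2 u x ![v, w] = ∑ i, ∑ j, v i * w j * hess u x i j := by
  have hexp : ∀ z : Euc d, z = ∑ i, z i • EuclideanSpace.single i (1 : ℝ) := fun z => by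
    simpa using ((EuclideanSpace.basisFun (Fin d) ℝ).sum_repr z).symm
  simp only [hess, iteratedFDeriv_two_apply, Matrix.cons_val_zero, Matrix.cons_val_one]
  conv_lhs => rw [hexp v, hexp w]
  simp only [map_sum, map_smul, _root_.sum_apply, _root_.smul_apply,
    smul_eq_mul, Finset.mul_sum]
  rw [Finset.sum_comm]
  refine Finset.sum_congr rfl fun i _ => Finset.sum_congr rfl fun j _ => ?_
  ring

theorem norm_iteratedFDeriv_two_le (u : Euc d → ℝ) (x : Euc d) :
    ‖iteratedFDeriv ℝ 2 u x‖ ≤ ∑ i, ∑ j, |hess u x i j| := by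
  refine ContinuousMultilinearMap.opNorm_le_bound
    (Finset.sum_nonneg fun i _ => Finset.sum_nonneg fun j _ => abs_nonneg _) fun m => ?_
  have hm : m = ![m 0, m 1] := by
    ext k
    fin_cases k <;> rfl
  rw [hm, iteratedFDeriv_two_eq_sum, Fin.prod_univ_two]
  simp only [Matrix.cons_val_zero, Matrix.cons_val_one, Finset.sum_mul]
  refine (Finset.abs_sum_le_sum_abs _ _).trans (Finset.sum_le_sum fun i _ =>
    (Finset.abs_sum_le_sum_abs _ _).trans (Finset.sum_le_sum fun j _ => ?_))
  rw [abs_mul, abs_mul, mul_comm]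
  refine mul_le_mul_of_nonneg_left ?_ (abs_nonneg _)
  exact mul_le_mul (PiLp.norm_apply_le (m 0) i) (PiLp.norm_apply_le (m 1) j) (abs_nonneg _)
    (norm_nonneg _)

theorem iteratedFDeriv_two_comp_isometry (O : Euc d ≃ₗᵢ[ℝ] Euc d) (u : Euc d → ℝ)
    (x v w : Euc d) :
    iteratedFDeriv ℝ 2 (u ∘ O) x ![v, w] = iteratedFDeriv ℝ 2 u (O x) ![O v, O w] := by
  have h := O.toContinuousLinearEquiv.iteratedFDerivWithin_comp_right u uniqueDiffOn_univ
    (mem_univ (O x)) 2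
  simp only [preimage_univ, iteratedFDerivWithin_univ] at h
  have h2 := congrArg (fun T => T ![v, w]) h
  refine h2.trans ?_
  rw [ContinuousMultilinearMap.compContinuousLinearMap_apply]
  congr 1
  ext k
  fin_cases k <;> rfl

/-- Orthogonal diagonalization, with entries written out. -/
theorem exists_diagonalization (A : Matrix (Fin d) (Fin d) ℝ) (hA : A.IsSymm) :
    ∃ (b : OrthonormalBasis (Fin d) ℝ (Euc d)) (a : Fin d → ℝ),
      (∀ k, A *ᵥ (b k : Fin d → ℝ) = a k • (b k : Fin d → ℝ)) ∧
      ∀ i j, A i j = ∑ k, a k * b k i * b k j := by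
  have hH : A.IsHermitian := by
    rw [Matrix.IsHermitian, Matrix.conjTranspose_eq_transpose_of_trivial]
    exact hA
  refine ⟨hH.eigenvectorBasis, hH.eigenvalues, hH.mulVec_eigenvectorBasis, fun i j => ?_⟩
  set b := hH.eigenvectorBasis with hb
  have h1 : EuclideanSpace.single j (1 : ℝ) = ∑ k, b k j • b k := by
    have := (b.sum_repr (EuclideanSpace.single j (1 : ℝ))).symm
    refine this.trans (Finset.sum_congr rfl fun k _ => ?_)
    rw [b.repr_apply_apply, EuclideanSpace.inner_single_right]
    simp
  have h2 : A i j = (A *ᵥ (EuclideanSpace.single j (1 : ℝ) : Fin d → ℝ)) i := by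
    simp
  have h3 : ((∑ k, b k j • b k : Euc d) : Fin d → ℝ) = ∑ k, b k j • (b k : Fin d → ℝ) := by
    ext l
    simp
  rw [h2, h1, h3, Matrix.mulVec_sum, Finset.sum_apply]
  refine Finset.sum_congr rfl fun k _ => ?_
  rw [Matrix.mulVec_smul, hb, hH.mulVec_eigenvectorBasis]
  simp only [Pi.smul_apply, smul_eq_mul]
  ring

theorem sum_sq_eq_one (b : OrthonormalBasis (Fin d) ℝ (Euc d)) (k : Fin d) :
    ∑ i, b k i ^ 2 = 1 := by
  rw [← EuclideanSpace.real_norm_sq_eq, b.orthonormal.1 k, one_pow]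

theorem le_eigenvalue {A : Matrix (Fin d) (Fin d) ℝ} {lam : ℝ}
    (h : ∀ ξ : Fin d → ℝ, lam * ∑ i, ξ i ^ 2 ≤ (A *ᵥ ξ) ⬝ᵥ ξ) {v : Fin d → ℝ} {a : ℝ}
    (hv : A *ᵥ v = a • v) (h1 : ∑ i, v i ^ 2 = 1) : lam ≤ a := by
  have h2 := h v
  rw [hv, smul_dotProduct, h1, mul_one] at h2
  have h3 : v ⬝ᵥ v = 1 := by rw [← h1]; simp only [dotProduct, sq]
  simpa [h3] using h2

theorem eigenvalue_le {A : Matrix (Fin d) (Fin d) ℝ} {Lam : ℝ}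
    (h : Real.sqrt (∑ i, ∑ j, (A i j) ^ 2) ≤ Lam) {v : Fin d → ℝ} {a : ℝ}
    (hv : A *ᵥ v = a • v) (h1 : ∑ i, v i ^ 2 = 1) : a ≤ Lam := by
  refine le_trans (Real.le_sqrt_of_sq_le ?_) h
  calc a ^ 2 = ∑ i, (A *ᵥ v) i ^ 2 := by
        simp only [hv, Pi.smul_apply, smul_eq_mul, mul_pow, ← Finset.mul_sum, h1, mul_one]
    _ ≤ ∑ i, (∑ j, A i j ^ 2) * ∑ j, v j ^ 2 := Finset.sum_le_sum fun i _ =>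
        by simpa only [mulVec, dotProduct] using Finset.sum_mul_sq_le_sq_mul_sq Finset.univ (A i) v
    _ = _ := by simp only [h1, mul_one]

end Rotation

end WeakHessian

open WeakHessian

/-- Weak type-(1,1) estimate for the Hessian of solutions of the constant-coefficient
non-divergence form problem `tr(A₀ D²u) = f` in `B = B(0,1)`, `u = 0` on `∂B`:
`|{x ∈ B : |D²u(x)| > α}| ≤ (C/α) ∫_B |f|` with `C = C(d,λ,Λ)`. -/
theorem weak11_nondiv_constant_coeff
    (d : ℕ) (hd : 1 ≤ d) (lam Lam : ℝ) (hlam : 0 < lam) (hLam : 0 < Lam) :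
    ∃ C : ℝ, 0 < C ∧
      ∀ A₀ : Matrix (Fin d) (Fin d) ℝ, A₀.IsSymm →
        (∀ ξ : Fin d → ℝ, lam * ∑ i, ξ i ^ 2 ≤ (A₀ *ᵥ ξ) ⬝ᵥ ξ) →
        Real.sqrt (∑ i, ∑ j, (A₀ i j) ^ 2) ≤ Lam →
      ∀ f : EuclideanSpace ℝ (Fin d) → ℝ, ContDiff ℝ (⊤ : ℕ∞) f →
      ∀ u : EuclideanSpace ℝ (Fin d) → ℝ,
        ContinuousOn u (closedBall (0 : EuclideanSpace ℝ (Fin d)) 1) →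
        ContDiffOn ℝ 2 u (ball (0 : EuclideanSpace ℝ (Fin d)) 1) →
        (∀ x ∈ sphere (0 : EuclideanSpace ℝ (Fin d)) 1, u x = 0) →
        (∀ x ∈ ball (0 : EuclideanSpace ℝ (Fin d)) 1,
          ∑ i, ∑ j, A₀ i j * hess u x i j = f x) →
      ∀ α : ℝ, 0 < α →
        volume {x ∈ ball (0 : EuclideanSpace ℝ (Fin d)) 1 | α < ‖iteratedFDeriv ℝ 2 u x‖}
          ≤ ENNReal.ofReal (C / α * ∫ x in ball (0 : EuclideanSpace ℝ (Fin d)) 1, |f x|) := by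
  obtain ⟨C, hC, hw⟩ := weak_type_diag_of_pos hd hlam hLam
  have hd0 : (0 : ℝ) < d := by exact_mod_cast hd
  refine ⟨d ^ 2 * (C * d ^ 2), by positivity, fun A₀ hsymm hell hbd f hf u huc hu2 hub hLu α hα => ?_⟩
  obtain ⟨b, a, hab, hA⟩ := exists_diagonalization A₀ hsymm
  set O : Euc d ≃ₗᵢ[ℝ] Euc d := b.repr.symm with hO
  have hOk : ∀ k, O (EuclideanSpace.single k 1) = b k := fun k => b.repr_symm_single k
  have hmap : ∀ x, x ∈ ball (0 : Euc d) 1 → O x ∈ ball (0 : Euc d) 1 := fun x hx => by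
    simpa [mem_ball_zero_iff] using hx
  have hcl : ∀ x, x ∈ closedBall (0 : Euc d) 1 → O x ∈ closedBall (0 : Euc d) 1 := fun x hx => by
    simpa [mem_closedBall_zero_iff] using hx
  have hsp : ∀ x, x ∈ sphere (0 : Euc d) 1 → O x ∈ sphere (0 : Euc d) 1 := fun x hx => by
    simpa [mem_sphere_zero_iff_norm] using hx
  have hpre : O ⁻¹' ball (0 : Euc d) 1 = ball 0 1 := by
    ext x
    simp
  have hO2 : ∀ x ∈ ball (0 : Euc d) 1, ContDiffAt ℝ 2 (u ∘ O) x := fun x hx =>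
    (hu2.contDiffAt (isOpen_ball.mem_nhds (hmap x hx))).comp x O.contDiff.contDiffAt
  have hdiag : ∀ x ∈ ball (0 : Euc d) 1, diagOp a (u ∘ O) x = (f ∘ O) x := by
    intro x hx
    rw [Function.comp_apply, ← hLu (O x) (hmap x hx)]
    have hk : ∀ k, pd k (pd k (u ∘ O)) x = ∑ i, ∑ j, b k i * b k j * hess u (O x) i j := fun k => by
      rw [← hess_eq_pd (hO2 x hx), hess, iteratedFDeriv_two_comp_isometry, hOk,
        iteratedFDeriv_two_eq_sum]
    simp only [diagOp, hk, hA, Finset.mul_sum, Finset.sum_mul]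
    rw [Finset.sum_comm]
    refine Finset.sum_congr rfl fun i _ => ?_
    rw [Finset.sum_comm]
    refine Finset.sum_congr rfl fun j _ => Finset.sum_congr rfl fun k _ => ?_
    ring
  have hmp : MeasurePreserving O (volume : Measure (Euc d)) volume := O.measurePreserving
  have hemb : MeasurableEmbedding O := O.toMeasurableEquiv.measurableEmbedding
  have hfint : ∫ x in ball (0 : Euc d) 1, |(f ∘ O) x| = ∫ x in ball (0 : Euc d) 1, |f x| := by
    have := hmp.setIntegral_preimage_emb hemb (fun x => |f x|) (ball (0 : Euc d) 1)
    rwa [hpre] at this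
  have hbound := hw a (fun k => le_eigenvalue hell (hab k) (sum_sq_eq_one b k))
    (fun k => eigenvalue_le hbd (hab k) (sum_sq_eq_one b k)) (f ∘ O)
    (hf.continuous.comp O.continuous) (u ∘ O) (huc.comp O.continuous.continuousOn hcl) hO2
    (fun x hx => hub (O x) (hsp x hx)) hdiag (α / d ^ 2) (by positivity)
  rw [hfint] at hbound
  set F := ∫ x in ball (0 : Euc d) 1, |f x|
  have hsub : O ⁻¹' {x ∈ ball (0 : Euc d) 1 | α < ‖iteratedFDeriv ℝ 2 u x‖} ⊆
      ⋃ p ∈ (Finset.univ : Finset (Fin d × Fin d)),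
        {x ∈ ball (0 : Euc d) 1 | α / d ^ 2 < |pd p.1 (pd p.2 (u ∘ O)) x|} := by
    intro x hx
    have hxB : x ∈ ball (0 : Euc d) 1 := by
      rw [← hpre]
      exact hx.1
    have h1 : α < ∑ i, ∑ j, |hess (u ∘ O) x i j| := by
      refine lt_of_lt_of_le ?_ (norm_iteratedFDeriv_two_le (u ∘ O) x)
      rw [O.norm_iteratedFDeriv_comp_right]
      exact hx.2
    by_contra h2
    simp only [mem_iUnion, Finset.mem_univ, exists_prop, true_and, not_exists] at h2
    refine h1.not_ge ?_
    calc ∑ i, ∑ j, |hess (u ∘ O) x i j| ≤ ∑ _i : Fin d, ∑ _j : Fin d, α / d ^ 2 := by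
          refine Finset.sum_le_sum fun i _ => Finset.sum_le_sum fun j _ => ?_
          rw [hess_eq_pd (hO2 x hxB)]
          by_contra! h3
          exact h2 (i, j) ⟨hxB, h3⟩
      _ = α := by
          simp only [Finset.sum_const, Finset.card_univ, Fintype.card_fin, nsmul_eq_mul]
          field_simp
  rw [← hmp.measure_preimage_emb hemb]
  refine (measure_mono hsub).trans ((measure_biUnion_finset_le _ _).trans ?_)
  calc _ ≤ ∑ _p : Fin d × Fin d, ENNReal.ofReal (C / (α / d ^ 2) * F) := by
        refine Finset.sum_le_sum fun p _ => ?_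
        rw [← ofReal_measureReal
          ((measure_mono (sep_subset _ _)).trans_lt volume_ball_lt_top).ne]
        exact ENNReal.ofReal_le_ofReal (hbound p.1 p.2)
    _ = ENNReal.ofReal (d ^ 2 * (C * d ^ 2) / α * F) := by
        rw [Finset.sum_const, Finset.card_univ, Fintype.card_prod, Fintype.card_fin,
          ← ENNReal.ofReal_nsmul]
        congr 1
        rw [nsmul_eq_mul]
        push_cast
        field_simp
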